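/- arXiv:0901.3245 — 2 statements merged into one kernel-verified Lean document; each statement's English description precedes it below -/
import Mathlib

section
/- With probability at least 1 − ε₁ − ε₂ − ε₃ − ε over the Gaussian noise vectors ξ¹,…,ξⁿ, the largest eigenvalue of the sample covariance matrix satisfies the lower bound λ_PCA ≥ κ²[1 − 2σs₁/(κ√n) + (σ²/κ²)·((p−1)/n)·(1 − s₂/√(p−1))/(1 + 2σs₁/(κ√n)) − (σ⁴/κ⁴)·((p−1)/n)²·(1 + s₂/√(p−1))²/(1 − 2σs₁/(κ√n))³]. -/
open MeasureTheory ProbabilityTheory Filter Topology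

/-- The largest eigenvalue of a (symmetric) real matrix, as the supremum of its real
spectrum. -/
noncomputable def maxEig {m : ℕ} (M : Matrix (Fin m) (Fin m) ℝ) : ℝ :=
  sSup (spectrum ℝ M)

/-- The sample covariance matrix `(1/n) ∑_ν x^ν (x^ν)ᵀ` of the samples `x 0, …, x (n-1)`. -/
noncomputable def sampleCov (n p : ℕ) (x : Fin n → Fin p → ℝ) :
    Matrix (Fin p) (Fin p) ℝ :=
  (n : ℝ)⁻¹ • ∑ ν : Fin n, Matrix.vecMulVec (x ν) (x ν)

/-- Rayleigh quotients are bounded by the largest eigenvalue. -/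
lemma rayleigh_le_maxEig {m : ℕ} (M : Matrix (Fin m) (Fin m) ℝ) (hM : M.IsHermitian)
    (x : Fin m → ℝ) : x ⬝ᵥ (M.mulVec x) ≤ maxEig M * (x ⬝ᵥ x) := by
  have hps : (algebraMap ℝ (Matrix (Fin m) (Fin m) ℝ) (maxEig M) - M).PosSemidef := by
    rw [Matrix.posSemidef_iff_isHermitian_and_spectrum_nonneg]
    constructor
    · refine Matrix.IsHermitian.sub ?_ hM
      rw [Matrix.algebraMap_eq_diagonal]
      exact Matrix.isHermitian_diagonal _
    · rw [← spectrum.singleton_sub_eq]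
      rintro _ ⟨a, ha, b, hb, rfl⟩
      rw [Set.mem_singleton_iff] at ha
      subst ha
      have hfin : (spectrum ℝ M).Finite := by
        rw [hM.spectrum_real_eq_range_eigenvalues]
        exact Set.finite_range _
      have := le_csSup hfin.bddAbove hb
      simpa [maxEig] using this
  have h := hps.dotProduct_mulVec_nonneg x
  rw [Matrix.sub_mulVec, dotProduct_sub, Algebra.algebraMap_eq_smul_one, Matrix.smul_mulVec,
    Matrix.one_mulVec, dotProduct_smul, star_trivial, smul_eq_mul] at h
  linarith

lemma sampleCov_isHermitian (n p : ℕ) (x : Fin n → Fin p → ℝ) :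
    (sampleCov n p x).IsHermitian := by
  ext i j
  simp [sampleCov, Matrix.sum_apply, Matrix.vecMulVec_apply, mul_comm]

lemma sampleCov_quad (n p : ℕ) (x : Fin n → Fin p → ℝ) (w : Fin p → ℝ) :
    w ⬝ᵥ ((sampleCov n p x).mulVec w) = (n : ℝ)⁻¹ * ∑ ν, (∑ i, x ν i * w i) ^ 2 := by
  rw [sampleCov, Matrix.smul_mulVec, dotProduct_smul, smul_eq_mul, Matrix.sum_mulVec,
    dotProduct_sum]
  congr 1
  refine Finset.sum_congr rfl fun ν _ => ?_
  rw [Matrix.vecMulVec_mulVec]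
  simp only [dotProduct, Pi.smul_apply, op_smul_eq_smul, smul_eq_mul]
  rw [sq, Finset.sum_mul]
  refine Finset.sum_congr rfl fun i _ => ?_
  ring

/-- Duality bound through the Gram matrix. -/
lemma gram_le (n p : ℕ) (hn : 1 ≤ n) (x : Fin n → Fin p → ℝ) (z : Fin n → ℝ)
    (hpos : 0 < ∑ i, (∑ ν, z ν * x ν i) ^ 2) :
    ∑ i, (∑ ν, z ν * x ν i) ^ 2 ≤ n * maxEig (sampleCov n p x) * ∑ ν, z ν ^ 2 := by
  set w : Fin p → ℝ := fun i => ∑ ν, z ν * x ν i with hw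
  have hr := rayleigh_le_maxEig _ (sampleCov_isHermitian n p x) w
  rw [sampleCov_quad] at hr
  have hww : w ⬝ᵥ w = ∑ i, w i ^ 2 := by
    simp [dotProduct, sq]
  rw [hww] at hr
  have hn0 : (0 : ℝ) < n := by exact_mod_cast hn
  have h1 : ∑ i, w i ^ 2 = ∑ ν, z ν * ∑ i, x ν i * w i := by
    simp only [Finset.mul_sum]
    rw [Finset.sum_comm]
    refine Finset.sum_congr rfl fun i _ => ?_
    rw [sq]
    conv_lhs => enter [1]; rw [hw]
    rw [Finset.sum_mul]
    exact Finset.sum_congr rfl fun ν _ => by ring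
  have h2 : (∑ i, w i ^ 2) ^ 2 ≤ (∑ ν, z ν ^ 2) * ∑ ν, (∑ i, x ν i * w i) ^ 2 := by
    conv_lhs => rw [h1]
    exact Finset.sum_mul_sq_le_sq_mul_sq _ _ _
  have h3 : ∑ ν, (∑ i, x ν i * w i) ^ 2 ≤ n * (maxEig (sampleCov n p x) * ∑ i, w i ^ 2) := by
    rwa [inv_mul_le_iff₀ hn0] at hr
  have hz : 0 ≤ ∑ ν, z ν ^ 2 := Finset.sum_nonneg fun _ _ => sq_nonneg _
  have h4 := h2.trans (mul_le_mul_of_nonneg_left h3 hz)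
  change 0 < ∑ i, w i ^ 2 at hpos
  refine le_of_mul_le_mul_right ?_ hpos
  calc (∑ i, w i ^ 2) * (∑ i, w i ^ 2) = (∑ i, w i ^ 2) ^ 2 := by ring
    _ ≤ _ := h4
    _ = _ := by ring

/-- A unit combination of i.i.d. centred Gaussian vectors has the same law. -/
lemma map_unit_comb {E : Type*} [NormedAddCommGroup E] [NormedSpace ℝ E] [CompleteSpace E]
    [SecondCountableTopology E] [MeasurableSpace E] [BorelSpace E]
    (μ : Measure E) [IsProbabilityMeasure μ] (Q : StrongDual ℝ E → ℝ)
    (hQ : ∀ (t : ℝ) (L : StrongDual ℝ E),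
      charFunDual μ (t • L) = Complex.exp (((-(t ^ 2 * Q L) / 2 : ℝ) : ℂ)))
    {n : ℕ} (a : Fin n → ℝ) (ha : ∑ ν, a ν ^ 2 = 1) :
    (Measure.pi fun _ : Fin n => μ).map (fun η => ∑ ν, a ν • η ν) = μ := by
  have hmeas : Measurable (fun η : Fin n → E => ∑ ν, a ν • η ν) := by fun_prop
  have : IsProbabilityMeasure ((Measure.pi fun _ : Fin n => μ).map
      (fun η => ∑ ν, a ν • η ν)) := Measure.isProbabilityMeasure_map hmeas.aemeasurable
  refine Measure.ext_of_charFunDual ?_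
  ext L
  rw [charFunDual_apply, integral_map hmeas.aemeasurable (by fun_prop)]
  have h1 : ∀ η : Fin n → E, Complex.exp ((L (∑ ν, a ν • η ν) : ℝ) * Complex.I)
      = ∏ ν, Complex.exp (((a ν • L) (η ν) : ℝ) * Complex.I) := by
    intro η
    rw [← Complex.exp_sum]
    congr 1
    simp [map_sum, Finset.sum_mul]
  simp_rw [h1]
  rw [integral_fintype_prod_eq_prod (𝕜 := ℂ)
    (fun ν (y : E) => Complex.exp (((a ν • L) y : ℝ) * Complex.I))]
  simp_rw [← charFunDual_apply, hQ]
  have h2 := hQ 1 L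
  rw [one_smul] at h2
  rw [h2, ← Complex.exp_sum, ← Complex.ofReal_sum]
  congr 2
  rw [← Finset.sum_div, Finset.sum_neg_distrib, ← Finset.sum_mul, ha]
  ring

lemma map_unit_comb_real {n : ℕ} (a : Fin n → ℝ) (ha : ∑ ν, a ν ^ 2 = 1) :
    (Measure.pi fun _ : Fin n => (gaussianReal 0 1 : Measure ℝ)).map
      (fun η => ∑ ν, a ν • η ν) = gaussianReal 0 1 := by
  refine map_unit_comb _ (fun L => (L 1) ^ 2) (fun t L => ?_) a ha
  rw [charFunDual_apply]
  have : ∀ v : ℝ, (t • L) v = (t * L 1) * v := by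
    intro v
    have : L v = v * L 1 := by
      conv_lhs => rw [← mul_one v, ← smul_eq_mul, map_smul, smul_eq_mul]
    rw [smul_apply, smul_eq_mul, this]; ring
  simp_rw [this]
  have h := charFun_gaussianReal (μ := 0) (v := 1) (t * L 1)
  rw [charFun_apply_real] at h
  push_cast at h ⊢
  rw [h]
  congr 1
  simp
  ring

lemma map_unit_comb_pi {n q : ℕ} (a : Fin n → ℝ) (ha : ∑ ν, a ν ^ 2 = 1) :
    (Measure.pi fun _ : Fin n => Measure.pi fun _ : Fin q => (gaussianReal 0 1 : Measure ℝ)).map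
      (fun η => ∑ ν, a ν • η ν) = Measure.pi fun _ : Fin q => (gaussianReal 0 1 : Measure ℝ) := by
  refine map_unit_comb _ (fun L => ∑ j, (L (Pi.single j 1)) ^ 2) (fun t L => ?_) a ha
  rw [charFunDual_apply]
  have h1 : ∀ v : Fin q → ℝ, Complex.exp (((t • L) v : ℝ) * Complex.I)
      = ∏ j, Complex.exp ((t * L (Pi.single j 1) : ℝ) * (v j) * Complex.I) := by
    intro v
    have : L v = ∑ j, v j * L (Pi.single j 1) := by
      conv_lhs => rw [pi_eq_sum_univ' v, map_sum]
      refine Finset.sum_congr rfl fun j _ => ?_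
      rw [map_smul, smul_eq_mul]
    rw [smul_apply, smul_eq_mul, this, ← Complex.exp_sum]
    congr 1
    push_cast
    rw [Finset.mul_sum, Finset.sum_mul]
    exact Finset.sum_congr rfl fun j _ => by ring
  simp_rw [h1]
  rw [integral_fintype_prod_eq_prod (𝕜 := ℂ)
    (fun j (y : ℝ) => Complex.exp ((t * L (Pi.single j 1) : ℝ) * (y : ℂ) * Complex.I))]
  have h2 : ∀ j : Fin q, ∫ y : ℝ, Complex.exp ((t * L (Pi.single j 1) : ℝ) * (y : ℂ) * Complex.I)
      ∂(gaussianReal 0 1) = Complex.exp (((-(t * L (Pi.single j 1)) ^ 2 / 2 : ℝ) : ℂ)) := by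
    intro j
    have h := charFun_gaussianReal (μ := 0) (v := 1) (t * L (Pi.single j 1))
    rw [charFun_apply_real] at h
    rw [h]
    congr 1
    push_cast
    simp
    ring
  simp_rw [h2]
  rw [← Complex.exp_sum, ← Complex.ofReal_sum]
  congr 2
  rw [← Finset.sum_div, Finset.mul_sum, Finset.sum_neg_distrib]
  simp only [mul_pow]

/-- Splitting the noise into first coordinates and the remaining ones. -/
lemma measurePreserving_split (n q : ℕ) :
    MeasurePreserving (fun ξ : Fin n → Fin (q + 1) → ℝ =>
        ((fun ν => ξ ν 0 : Fin n → ℝ), (fun ν j => ξ ν (Fin.succ j) : Fin n → Fin q → ℝ)))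
      (Measure.pi fun _ : Fin n => Measure.pi fun _ : Fin (q + 1) => (gaussianReal 0 1 : Measure ℝ))
      ((Measure.pi fun _ : Fin n => (gaussianReal 0 1 : Measure ℝ)).prod
        (Measure.pi fun _ : Fin n => Measure.pi fun _ : Fin q => (gaussianReal 0 1 : Measure ℝ))) := by
  have h1 := measurePreserving_piFinSuccAbove
    (fun _ : Fin (q + 1) => (gaussianReal 0 1 : Measure ℝ)) 0
  have h2 := measurePreserving_pi (ι := Fin n) _ _ (fun _ => h1)
  have h3 := measurePreserving_arrowProdEquivProdArrow ℝ (Fin q → ℝ) (Fin n)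
    (fun _ => (gaussianReal 0 1 : Measure ℝ))
    (fun _ => Measure.pi fun _ : Fin q => (gaussianReal 0 1 : Measure ℝ))
  exact h3.comp h2

/-- A section-wise bound on the probability of an event. -/
lemma prod_le_of_sections {α β : Type*} [MeasurableSpace α] [MeasurableSpace β]
    (μ : Measure α) (ν : Measure β) [IsProbabilityMeasure μ] [IsProbabilityMeasure ν]
    (A : Set (α × β)) (hA : MeasurableSet A) (c : ENNReal)
    (h : ∀ a, ν (Prod.mk a ⁻¹' A) ≤ c) : (μ.prod ν) A ≤ c := by
  rw [Measure.prod_apply hA]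
  calc ∫⁻ a, ν (Prod.mk a ⁻¹' A) ∂μ ≤ ∫⁻ _, c ∂μ := lintegral_mono h
    _ = c := by simp

/-- Deterministic lower bound for the top eigenvalue. -/
lemma maxEig_lower (n q : ℕ) (hn : 1 ≤ n) (σ V : ℝ) (u : Fin n → ℝ)
    (ξ : Fin n → Fin (q + 1) → ℝ)
    (hD : 0 < ∑ ν, (u ν * V + σ * ξ ν 0) ^ 2) :
    ∑ ν, (u ν * V + σ * ξ ν 0) ^ 2 + σ ^ 2 * ∑ j : Fin q,
        (∑ ν, ((u ν * V + σ * ξ ν 0) / √(∑ ν, (u ν * V + σ * ξ ν 0) ^ 2)) * ξ ν j.succ) ^ 2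
      ≤ n * maxEig (sampleCov n (q + 1)
              (fun ν i => u ν * (if (i : ℕ) = 0 then V else 0) + σ * ξ ν i)) := by
  set z : Fin n → ℝ := fun ν => u ν * V + σ * ξ ν 0 with hz
  change 0 < ∑ ν, z ν ^ 2 at hD
  change ∑ ν, z ν ^ 2 + σ ^ 2 * ∑ j : Fin q,
        (∑ ν, (z ν / √(∑ ν, z ν ^ 2)) * ξ ν j.succ) ^ 2 ≤ _
  set D := ∑ ν, z ν ^ 2 with hDdef
  set x : Fin n → Fin (q + 1) → ℝ :=
    fun ν i => u ν * (if (i : ℕ) = 0 then V else 0) + σ * ξ ν i with hx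
  have hw : ∑ i, (∑ ν, z ν * x ν i) ^ 2
      = D ^ 2 + σ ^ 2 * ∑ j : Fin q, (∑ ν, z ν * ξ ν j.succ) ^ 2 := by
    rw [Fin.sum_univ_succ]
    congr 1
    · congr 1
      rw [hDdef]
      refine Finset.sum_congr rfl fun ν _ => ?_
      simp [hx, hz, sq]
    · rw [Finset.mul_sum]
      refine Finset.sum_congr rfl fun j _ => ?_
      rw [← mul_pow, Finset.mul_sum]
      congr 1
      refine Finset.sum_congr rfl fun ν _ => ?_
      simp [hx]
      ring
  have hnn : 0 ≤ ∑ j : Fin q, (∑ ν, z ν * ξ ν j.succ) ^ 2 :=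
    Finset.sum_nonneg fun _ _ => sq_nonneg _
  have h := gram_le n (q + 1) hn x z (by rw [hw]; positivity)
  rw [hw, ← hDdef] at h
  have hs : ∑ j : Fin q, (∑ ν, (z ν / √D) * ξ ν j.succ) ^ 2
      = (∑ j : Fin q, (∑ ν, z ν * ξ ν j.succ) ^ 2) / D := by
    rw [Finset.sum_div]
    refine Finset.sum_congr rfl fun j _ => ?_
    have : ∑ ν, (z ν / √D) * ξ ν j.succ = (∑ ν, z ν * ξ ν j.succ) / √D := by
      rw [Finset.sum_div]
      exact Finset.sum_congr rfl fun ν _ => by ring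
    rw [this, div_pow, Real.sq_sqrt hD.le]
  rw [hs]
  refine le_of_mul_le_mul_right ?_ hD
  refine le_trans (le_of_eq ?_) h
  field_simp

/-- Final scalar comparison. -/
lemma scalar_bound (κ σ δ r x t B m : ℝ) (hκ : 0 < κ) (hδ : 0 ≤ δ)
    (ht : 0 ≤ t) (ht' : r * (1 - x) ≤ t) (hB : 0 ≤ B)
    (hm : κ ^ 2 * (1 - δ) + σ ^ 2 * t ≤ m) :
    κ ^ 2 * (1 - δ + σ ^ 2 / κ ^ 2 * r * (1 - x) / (1 + δ) - B) ≤ m := by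
  have h1 : r * (1 - x) / (1 + δ) ≤ t := by
    rw [div_le_iff₀ (by linarith)]
    nlinarith
  have h2 : κ ^ 2 * (σ ^ 2 / κ ^ 2 * r * (1 - x) / (1 + δ)) = σ ^ 2 * (r * (1 - x) / (1 + δ)) := by
    field_simp
  have h3 : σ ^ 2 * (r * (1 - x) / (1 + δ)) ≤ σ ^ 2 * t :=
    mul_le_mul_of_nonneg_left h1 (sq_nonneg _)
  have h4 : 0 ≤ κ ^ 2 * B := by positivity
  nlinarith

/-- **Theorem 2.1, lower bound (2.11)**: with probability at least `1 - ε₁ - ε₂ - ε₃ - ε`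
over the i.i.d. standard Gaussian noise vectors `ξ¹, …, ξⁿ`, the largest eigenvalue
`λ_PCA` of the sample covariance matrix of the samples `x^ν = u^ν v + σ ξ^ν`
(with `v = ‖v‖ e₁`) satisfies the stated lower bound. -/
theorem pca_top_eigenvalue_lower_bound
    (n p : ℕ) (hn : 1 ≤ n) (hp : 2 ≤ p) (hnp : n ≤ p)
    (σ V : ℝ) (hσ : 0 < σ) (hV : 0 < V)
    (u : Fin n → ℝ)
    (su : ℝ) (hsu : su = Real.sqrt ((n : ℝ)⁻¹ * ∑ ν, (u ν) ^ 2)) (hsupos : 0 < su)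
    (κ : ℝ) (hκ : κ = V * su)
    (s₁ s₂ s₃ : ℝ) (hs₁ : 0 < s₁) (hs₂ : 0 < s₂) (hs₃ : 0 < s₃)
    (ε ε₁ ε₂ ε₃ : ℝ)
    (hε : ε = Real.exp (-(p : ℝ) / (2 * (Real.sqrt 5 + 2) ^ 2)))
    (hε₁ : ε₁ = ((gaussianReal 0 1 : Measure ℝ) {x | s₁ < |x|}).toReal)
    (hε₂ : ε₂ = ((Measure.pi fun _ : Fin (p - 1) => (gaussianReal 0 1 : Measure ℝ))
        {g : Fin (p - 1) → ℝ |
          s₂ / Real.sqrt ((p : ℝ) - 1) < |(∑ i, (g i) ^ 2) / ((p : ℝ) - 1) - 1|}).toReal)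
    (hε₃ : ε₃ = ((gaussianReal 0 1 : Measure ℝ) {x | s₃ < x ^ 2}).toReal)
    (hsignal : σ ^ 2 * ((1 + Real.sqrt (((p : ℝ) - 1) / n)) ^ 2 + ((p : ℝ) - 1) / n)
        < κ ^ 2 - 2 * σ * s₁ * κ / Real.sqrt n) :
    1 - ε₁ - ε₂ - ε₃ - ε ≤
      ((Measure.pi fun _ : Fin n => Measure.pi fun _ : Fin p => (gaussianReal 0 1 : Measure ℝ))
        {ξ : Fin n → Fin p → ℝ |
          κ ^ 2 * (1 - 2 * σ * s₁ / (κ * Real.sqrt n)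
            + σ ^ 2 / κ ^ 2 * (((p : ℝ) - 1) / n) *
              (1 - s₂ / Real.sqrt ((p : ℝ) - 1)) / (1 + 2 * σ * s₁ / (κ * Real.sqrt n))
            - σ ^ 4 / κ ^ 4 * (((p : ℝ) - 1) / n) ^ 2 *
              (1 + s₂ / Real.sqrt ((p : ℝ) - 1)) ^ 2
                / (1 - 2 * σ * s₁ / (κ * Real.sqrt n)) ^ 3)
          ≤ maxEig (sampleCov n p
              (fun ν i => u ν * (if (i : ℕ) = 0 then V else 0) + σ * ξ ν i))}).toReal := by
  obtain ⟨q, rfl⟩ : ∃ q, p = q + 1 := ⟨p - 1, by omega⟩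
  have hq : 1 ≤ q := by omega
  have hcast : ((q + 1 : ℕ) : ℝ) - 1 = q := by push_cast; ring
  rw [hcast] at hε₂ hsignal ⊢
  have hn0 : (0 : ℝ) < n := by exact_mod_cast hn
  have hq0 : (0 : ℝ) < q := by exact_mod_cast hq
  have hsn : 0 < √(n : ℝ) := Real.sqrt_pos.2 hn0
  have hsn2 : √(n : ℝ) ^ 2 = n := Real.sq_sqrt hn0.le
  have hκ0 : 0 < κ := by rw [hκ]; positivity
  have hu2 : ∑ ν, (u ν) ^ 2 = n * su ^ 2 := by
    rw [hsu, Real.sq_sqrt (mul_nonneg (by positivity)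
      (Finset.sum_nonneg fun _ _ => sq_nonneg _))]
    field_simp
  set δ := 2 * σ * s₁ / (κ * √(n : ℝ)) with hδ
  have hδ0 : 0 ≤ δ := by positivity
  have hκδ : κ ^ 2 - 2 * σ * s₁ * κ / √(n : ℝ) = κ ^ 2 * (1 - δ) := by
    rw [hδ]; field_simp
  have hpos : 0 < κ ^ 2 * (1 - δ) := by
    rw [← hκδ]
    exact lt_of_le_of_lt (by positivity) hsignal
  have hδ1 : 0 < 1 - δ := by
    by_contra hcon
    have : κ ^ 2 * (1 - δ) ≤ 0 := mul_nonpos_of_nonneg_of_nonpos (sq_nonneg _) (not_lt.1 hcon)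
    linarith
  -- the unit vector in the direction of `u`
  set a : Fin n → ℝ := fun ν => u ν / (√(n : ℝ) * su) with ha_def
  have ha : ∑ ν, a ν ^ 2 = 1 := by
    simp only [ha_def, div_pow]
    rw [← Finset.sum_div, hu2, mul_pow, hsn2, div_self (by positivity)]
  set γ : Measure ℝ := gaussianReal 0 1 with hγ
  set P : Measure (Fin n → Fin (q + 1) → ℝ) :=
    Measure.pi fun _ : Fin n => Measure.pi fun _ : Fin (q + 1) => γ with hP
  set P₁ : Measure (Fin n → ℝ) := Measure.pi fun _ : Fin n => γ with hP₁
  set P₂ : Measure (Fin n → Fin q → ℝ) :=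
    Measure.pi fun _ : Fin n => Measure.pi fun _ : Fin q => γ with hP₂
  have hsplit := measurePreserving_split n q
  rw [← hγ, ← hP, ← hP₁, ← hP₂] at hsplit
  -- bad events
  set A₁ : Set (Fin n → ℝ) := {b | s₁ < |∑ ν, a ν • b ν|} with hA₁
  set D : (Fin n → ℝ) → ℝ := fun b => ∑ ν, (u ν * V + σ * b ν) ^ 2 with hDdef
  set C : Set (Fin q → ℝ) := {g | s₂ / √(q : ℝ) < |(∑ i, (g i) ^ 2) / (q : ℝ) - 1|} with hC
  set A₂ : Set ((Fin n → ℝ) × (Fin n → Fin q → ℝ)) :=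
    {b | 0 < D b.1 ∧ (∑ ν, ((u ν * V + σ * b.1 ν) / √(D b.1)) • b.2 ν) ∈ C} with hA₂
  have hCm : MeasurableSet C := measurableSet_lt (by fun_prop) (by fun_prop)
  have hDm : Measurable D := by fun_prop
  have hA₁m : MeasurableSet A₁ := measurableSet_lt (by fun_prop) (by fun_prop)
  have hA₂m : MeasurableSet A₂ := by
    refine MeasurableSet.inter (measurableSet_lt measurable_const (hDm.comp measurable_fst)) ?_
    refine hCm.preimage (f := fun b : (Fin n → ℝ) × (Fin n → Fin q → ℝ) =>
      ∑ ν, ((u ν * V + σ * b.1 ν) / √(D b.1)) • b.2 ν) ?_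
    fun_prop
  have hP1A : P₁ A₁ = γ {x | s₁ < |x|} := by
    have h := map_unit_comb_real a ha
    rw [← hγ, ← hP₁] at h
    conv_rhs => rw [← h]
    have hm : MeasurableSet {x : ℝ | s₁ < |x|} := measurableSet_lt (by fun_prop) (by fun_prop)
    rw [Measure.map_apply (by fun_prop) hm]
    rfl
  have hA₂le : (P₁.prod P₂) A₂ ≤ (Measure.pi fun _ : Fin q => γ) C := by
    refine prod_le_of_sections _ _ _ hA₂m _ fun b => ?_
    by_cases hb : 0 < D b
    · have hunit : ∑ ν, ((u ν * V + σ * b ν) / √(D b)) ^ 2 = 1 := by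
        simp only [div_pow]
        rw [← Finset.sum_div, Real.sq_sqrt hb.le]
        exact div_self hb.ne'
      have h := map_unit_comb_pi (q := q) _ hunit
      rw [← hγ, ← hP₂] at h
      conv_rhs => rw [← h]
      rw [Measure.map_apply (by fun_prop) hCm]
      exact measure_mono fun η hη => hη.2
    · have : Prod.mk b ⁻¹' A₂ = ∅ := by
        ext η
        simp [hA₂, hb]
      rw [this]
      simp
  have hA₁le : (P₁.prod P₂) (Prod.fst ⁻¹' A₁) = γ {x | s₁ < |x|} := by
    rw [← hP1A]
    have := (measurePreserving_fst (μ := P₁) (ν := P₂)).measure_preimage hA₁m.nullMeasurableSet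
    exact this
  set F : (Fin n → Fin (q + 1) → ℝ) → (Fin n → ℝ) × (Fin n → Fin q → ℝ) := fun ξ =>
    ((fun ν => ξ ν 0), (fun ν j => ξ ν (Fin.succ j))) with hF
  have hB₁ : P (F ⁻¹' (Prod.fst ⁻¹' A₁)) = γ {x | s₁ < |x|} := by
    rw [hsplit.measure_preimage (hA₁m.preimage measurable_fst).nullMeasurableSet, hA₁le]
  have hB₂ : P (F ⁻¹' A₂) ≤ (Measure.pi fun _ : Fin q => γ) C := by
    rw [hsplit.measure_preimage hA₂m.nullMeasurableSet]
    exact hA₂le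
  set G : Set (Fin n → Fin (q + 1) → ℝ) := _ with hG
  change 1 - ε₁ - ε₂ - ε₃ - ε ≤ (P G).toReal
  have hcover : (Set.univ : Set (Fin n → Fin (q + 1) → ℝ)) ⊆
      G ∪ (F ⁻¹' (Prod.fst ⁻¹' A₁) ∪ F ⁻¹' A₂) := by
    intro ξ _
    by_cases h1 : ξ ∈ F ⁻¹' (Prod.fst ⁻¹' A₁)
    · exact Or.inr (Or.inl h1)
    by_cases h2 : ξ ∈ F ⁻¹' A₂
    · exact Or.inr (Or.inr h2)
    left
    have hg : |∑ ν, a ν * ξ ν 0| ≤ s₁ := by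
      have : ¬ (s₁ < |∑ ν, a ν • ξ ν 0|) := h1
      simpa using this
    have hDlow : n * (κ ^ 2 * (1 - δ)) ≤ ∑ ν, (u ν * V + σ * ξ ν 0) ^ 2 := by
      have e1 : ∑ ν, (u ν * V + σ * ξ ν 0) ^ 2
          = V ^ 2 * ∑ ν, u ν ^ 2 + 2 * σ * V * (√(n : ℝ) * su) * (∑ ν, a ν * ξ ν 0)
            + σ ^ 2 * ∑ ν, ξ ν 0 ^ 2 := by
        simp only [Finset.mul_sum]
        rw [← Finset.sum_add_distrib, ← Finset.sum_add_distrib]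
        refine Finset.sum_congr rfl fun ν _ => ?_
        simp only [ha_def]
        field_simp
        ring
      have e2 : n * (κ ^ 2 * (1 - δ)) = n * κ ^ 2 - 2 * σ * κ * √(n : ℝ) * s₁ := by
        rw [← hκδ]
        field_simp
        linear_combination (2 * σ * s₁) * hsn2
      have e3 : 0 ≤ ∑ ν, ξ ν 0 ^ 2 := Finset.sum_nonneg fun _ _ => sq_nonneg _
      have e4 : 0 ≤ σ ^ 2 * ∑ ν, ξ ν 0 ^ 2 := by positivity
      have e5 : 2 * σ * κ * √(n : ℝ) * (-s₁) ≤ 2 * σ * κ * √(n : ℝ) * (∑ ν, a ν * ξ ν 0) :=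
        mul_le_mul_of_nonneg_left (abs_le.1 hg).1 (by positivity)
      rw [e1, e2, hu2]
      have e6 : 2 * σ * V * (√(n : ℝ) * su) = 2 * σ * κ * √(n : ℝ) := by rw [hκ]; ring
      have e7 : V ^ 2 * (n * su ^ 2) = n * κ ^ 2 := by rw [hκ]; ring
      rw [e6, e7]
      linarith
    have hDpos : 0 < ∑ ν, (u ν * V + σ * ξ ν 0) ^ 2 :=
      lt_of_lt_of_le (by positivity) hDlow
    have hlow := maxEig_lower n q hn σ V u ξ hDpos
    set T := ∑ j : Fin q,
        (∑ ν, ((u ν * V + σ * ξ ν 0) / √(∑ ν, (u ν * V + σ * ξ ν 0) ^ 2)) * ξ ν j.succ) ^ 2 with hT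
    have hT0 : 0 ≤ T := Finset.sum_nonneg fun _ _ => sq_nonneg _
    have hTC : |T / q - 1| ≤ s₂ / √(q : ℝ) := by
      by_contra hcon
      refine h2 ⟨hDpos, ?_⟩
      have := not_le.1 hcon
      simpa [hC, hT, hF, hDdef, Finset.sum_apply] using this
    have hTq : q * (1 - s₂ / √(q : ℝ)) ≤ T := by
      have := (abs_le.1 hTC).1
      have h' : 1 - s₂ / √(q : ℝ) ≤ T / q := by linarith
      rw [le_div_iff₀ hq0] at h'
      linarith
    refine scalar_bound κ σ δ (q / n) (s₂ / √(q : ℝ)) (T / n) _ _ hκ0 hδ0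
      (by positivity) ?_ ?_ ?_
    · rw [div_mul_eq_mul_div]
      exact div_le_div_of_nonneg_right hTq hn0.le
    · positivity
    · refine le_of_mul_le_mul_left ?_ hn0
      refine le_trans ?_ hlow
      have : n * (κ ^ 2 * (1 - δ) + σ ^ 2 * (T / n)) = n * (κ ^ 2 * (1 - δ)) + σ ^ 2 * T := by
        field_simp
      rw [this]
      linarith
  have hmeas : 1 ≤ P.real G + (ε₁ + ε₂) := by
    have h1 : P.real Set.univ ≤ P.real (G ∪ (F ⁻¹' (Prod.fst ⁻¹' A₁) ∪ F ⁻¹' A₂)) :=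
      measureReal_mono hcover
    have h2 := measureReal_union_le (μ := P) G (F ⁻¹' (Prod.fst ⁻¹' A₁) ∪ F ⁻¹' A₂)
    have h3 := measureReal_union_le (μ := P) (F ⁻¹' (Prod.fst ⁻¹' A₁)) (F ⁻¹' A₂)
    have h4 : P.real (F ⁻¹' (Prod.fst ⁻¹' A₁)) = ε₁ := by
      rw [hε₁, Measure.real, hB₁]
    have h5 : P.real (F ⁻¹' A₂) ≤ ε₂ := by
      rw [hε₂]
      exact ENNReal.toReal_mono (measure_ne_top _ _) hB₂
    have h6 : P.real Set.univ = 1 := by simp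
    linarith
  have hε0 : 0 ≤ ε := by rw [hε]; positivity
  have hε₃0 : 0 ≤ ε₃ := by rw [hε₃]; positivity
  have : P.real G = (P G).toReal := rfl
  linarith
end

section
/- With probability at least 1 − ε₁ − ε₂ − ε₃ − ε over the Gaussian noise vectors ξ¹,…,ξⁿ, the largest eigenvalue of the sample covariance matrix satisfies the upper bound λ_PCA ≤ κ²(1 + 2σs₁/(κ√n) + σ²s₃/κ²) + σκ√((p−1)/n)·√(1 + 2σs₁/(κ√n) + σ²s₃/κ²)·(1 + s₂/√(p−1)). -/
open MeasureTheory ProbabilityTheory Filter Topology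

lemma gpdf_eq (x : ℝ) : gaussianPDFReal 0 1 x = (Real.sqrt (2 * Real.pi))⁻¹ * Real.exp (-x ^ 2 / 2) := by
  simp [gaussianPDFReal]

lemma gpdf_hasDerivAt (x : ℝ) :
    HasDerivAt (gaussianPDFReal 0 1) (-x * gaussianPDFReal 0 1 x) x := by
  have h1 : HasDerivAt (fun x : ℝ => (Real.sqrt (2 * Real.pi))⁻¹ * Real.exp (-x ^ 2 / 2))
      ((Real.sqrt (2 * Real.pi))⁻¹ * (Real.exp (-x ^ 2 / 2) * (-(2 * x) / 2))) x := by
    have : HasDerivAt (fun x : ℝ => -x ^ 2 / 2) (-(2 * x) / 2) x := by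
      simpa using ((hasDerivAt_pow 2 x).neg.div_const 2)
    exact (this.exp).const_mul _
  have h2 : gaussianPDFReal 0 1 = fun x : ℝ => (Real.sqrt (2 * Real.pi))⁻¹ * Real.exp (-x ^ 2 / 2) :=
    funext gpdf_eq
  rw [h2]
  convert h1 using 1
  ring

lemma integrable_gauss_iff (f : ℝ → ℝ) :
    Integrable f (gaussianReal 0 1) ↔ Integrable (fun x => gaussianPDFReal 0 1 x * f x) := by
  rw [gaussianReal_of_var_ne_zero _ one_ne_zero]
  rw [integrable_withDensity_iff_integrable_smul₀' (by fun_prop) (by simp [gaussianPDF])]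
  simp [gaussianPDF, ENNReal.toReal_ofReal (gaussianPDFReal_nonneg 0 1 _)]

lemma stein_one (f f' : ℝ → ℝ) (hd : ∀ x, HasDerivAt f (f' x) x)
    (hf : Integrable f (gaussianReal 0 1)) (hf' : Integrable f' (gaussianReal 0 1))
    (hxf : Integrable (fun x => x * f x) (gaussianReal 0 1)) :
    ∫ x, x * f x ∂(gaussianReal 0 1) = ∫ x, f' x ∂(gaussianReal 0 1) := by
  rw [integral_gaussianReal_eq_integral_smul one_ne_zero,
    integral_gaussianReal_eq_integral_smul one_ne_zero]
  rw [integrable_gauss_iff] at hf hf' hxf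
  have key := integral_eq_zero_of_hasDerivAt_of_integrable
    (f := fun x => gaussianPDFReal 0 1 x * f x)
    (f' := fun x => gaussianPDFReal 0 1 x * f' x - gaussianPDFReal 0 1 x * (x * f x))
    (fun x => by
      have h := (gpdf_hasDerivAt x).mul (hd x)
      exact h.congr_deriv (by ring)) (hf'.sub hxf) hf
  rw [integral_sub hf' hxf] at key
  simp only [smul_eq_mul]
  linarith


/-- product Gaussian measure -/
noncomputable abbrev gpi (κ : Type*) [Fintype κ] : Measure (κ → ℝ) :=
  Measure.pi fun _ : κ => (gaussianReal 0 1 : Measure ℝ)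

lemma mp_update {κ : Type*} [Fintype κ] [DecidableEq κ] (k : κ) : MeasurePreserving (fun q : (κ → ℝ) × ℝ => Function.update q.1 k q.2)
    ((gpi κ).prod (gaussianReal 0 1)) (gpi κ) := by
  have hm : Measurable (fun q : (κ → ℝ) × ℝ => Function.update q.1 k q.2) := by
    rw [measurable_pi_iff]
    intro j
    by_cases h : j = k
    · subst h; simpa using measurable_snd
    · simp only [Function.update_of_ne h]; fun_prop
  refine ⟨hm, ?_⟩
  symm
  apply Measure.pi_eq
  intro s hs
  rw [Measure.map_apply hm (MeasurableSet.univ_pi hs)]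
  have : (fun q : (κ → ℝ) × ℝ => Function.update q.1 k q.2) ⁻¹' (Set.univ.pi s) =
      (Set.univ.pi (Function.update s k Set.univ)) ×ˢ (s k) := by
    ext ⟨w, x⟩
    simp only [Set.mem_preimage, Set.mem_univ_pi, Set.mem_prod]
    constructor
    · intro h
      refine ⟨fun i => ?_, by simpa using h k⟩
      by_cases hi : i = k
      · subst hi; simp
      · have := h i
        rw [Function.update_of_ne hi] at this ⊢
        exact this
    · rintro ⟨h1, h2⟩ i
      by_cases hi : i = k
      · subst hi; simpa using h2
      · have := h1 i
        rw [Function.update_of_ne hi] at this ⊢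
        exact this
  rw [this, Measure.prod_prod, Measure.pi_pi]
  rw [← Finset.mul_prod_erase Finset.univ _ (Finset.mem_univ k),
    ← Finset.mul_prod_erase Finset.univ (fun i => gaussianReal 0 1 (s i)) (Finset.mem_univ k)]
  simp only [Function.update_self, measure_univ, one_mul]
  rw [mul_comm]
  congr 1
  apply Finset.prod_congr rfl
  intro i hi
  rw [Function.update_of_ne (Finset.ne_of_mem_erase hi)]

lemma stein_pi {κ : Type*} [Fintype κ] [DecidableEq κ] (k : κ) (f f' : (κ → ℝ) → ℝ)
    (hd : ∀ w x, HasDerivAt (fun s => f (Function.update w k s)) (f' (Function.update w k x)) x)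
    (hf : Integrable f (gpi κ)) (hf' : Integrable f' (gpi κ))
    (hxf : Integrable (fun w => w k * f w) (gpi κ)) :
    ∫ w, w k * f w ∂(gpi κ) = ∫ w, f' w ∂(gpi κ) := by
  have mp := mp_update k
  have tr : ∀ g : (κ → ℝ) → ℝ, Integrable g (gpi κ) → ∫ w, g w ∂(gpi κ) =
      ∫ w, ∫ x, g (Function.update w k x) ∂(gaussianReal 0 1) ∂(gpi κ) := by
    intro g hg
    have h2 : Integrable (fun q : (κ → ℝ) × ℝ => g (Function.update q.1 k q.2))
      ((gpi κ).prod (gaussianReal 0 1)) := mp.integrable_comp_of_integrable hg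
    rw [← integral_prod _ h2]
    conv_lhs => rw [← mp.map_eq]
    rw [integral_map mp.measurable.aemeasurable]
    rw [mp.map_eq]; exact hg.aestronglyMeasurable
  rw [tr _ hxf, tr _ hf']
  have i1 := (mp.integrable_comp_of_integrable hf).prod_right_ae
  have i2 := (mp.integrable_comp_of_integrable hf').prod_right_ae
  have i3 := (mp.integrable_comp_of_integrable hxf).prod_right_ae
  apply integral_congr_ae
  filter_upwards [i1, i2, i3] with w h1 h2 h3
  simp only [Function.comp_def, Function.update_self] at h1 h2 h3 ⊢
  exact stein_one _ _ (hd w) h1 h2 h3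


noncomputable def lseZ {ι : Type*} [Fintype ι] (β : ℝ) (x : ι → ℝ) : ℝ := ∑ i, Real.exp (β * x i)
noncomputable def lseF {ι : Type*} [Fintype ι] (β θ : ℝ) (x : ι → ℝ) : ℝ :=
  Real.exp (θ / β * Real.log (lseZ β x))
noncomputable def lseW {ι : Type*} [Fintype ι] (β : ℝ) (i : ι) (x : ι → ℝ) : ℝ :=
  Real.exp (β * x i) / lseZ β x

section lse
set_option linter.unusedSectionVars false
variable {ι : Type*} [Fintype ι] [Nonempty ι]

lemma lseZ_pos (β : ℝ) (x : ι → ℝ) : 0 < lseZ β x :=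
  Finset.sum_pos (fun _ _ => Real.exp_pos _) Finset.univ_nonempty

lemma lseW_nonneg (β : ℝ) (i : ι) (x : ι → ℝ) : 0 ≤ lseW β i x :=
  div_nonneg (Real.exp_pos _).le (lseZ_pos β x).le

lemma lseW_sum (β : ℝ) (x : ι → ℝ) : ∑ i, lseW β i x = 1 := by
  simp only [lseW]
  rw [← Finset.sum_div]
  exact div_self (lseZ_pos β x).ne'

lemma lseW_le_one (β : ℝ) (i : ι) (x : ι → ℝ) : lseW β i x ≤ 1 := by
  rw [← lseW_sum β x]
  exact Finset.single_le_sum (f := fun i => lseW β i x) (fun j _ => lseW_nonneg β j x) (Finset.mem_univ i)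

lemma lseZ_deriv (β : ℝ) (x : ℝ → ι → ℝ) (x' : ι → ℝ) (s : ℝ)
    (h : ∀ i, HasDerivAt (fun s => x s i) (x' i) s) :
    HasDerivAt (fun s => lseZ β (x s)) (β * lseZ β (x s) * ∑ i, lseW β i (x s) * x' i) s := by
  have : HasDerivAt (fun s => ∑ i, Real.exp (β * x s i))
      (∑ i, Real.exp (β * x s i) * (β * x' i)) s :=
    HasDerivAt.fun_sum (fun i _ => ((h i).const_mul β).exp)
  refine this.congr_deriv ?_
  rw [Finset.mul_sum]
  refine Finset.sum_congr rfl fun i _ => ?_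
  have := (lseZ_pos β (x s)).ne'
  simp only [lseW]
  field_simp

lemma lseF_deriv (β θ : ℝ) (hβ : 0 < β) (x : ℝ → ι → ℝ) (x' : ι → ℝ) (s : ℝ)
    (h : ∀ i, HasDerivAt (fun s => x s i) (x' i) s) :
    HasDerivAt (fun s => lseF β θ (x s)) (θ * lseF β θ (x s) * ∑ i, lseW β i (x s) * x' i) s := by
  have h1 := (((lseZ_deriv β x x' s h).log (lseZ_pos β (x s)).ne').const_mul (θ / β)).exp
  refine h1.congr_deriv ?_
  have := (lseZ_pos β (x s)).ne'
  simp only [lseF]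
  field_simp

lemma lseW_deriv (β : ℝ) (x : ℝ → ι → ℝ) (x' : ι → ℝ) (s : ℝ) (i : ι)
    (h : ∀ i, HasDerivAt (fun s => x s i) (x' i) s) :
    HasDerivAt (fun s => lseW β i (x s))
      (β * lseW β i (x s) * (x' i - ∑ j, lseW β j (x s) * x' j)) s := by
  have h1 := (((h i).const_mul β).exp).div (lseZ_deriv β x x' s h) (lseZ_pos β (x s)).ne'
  refine h1.congr_deriv ?_
  have := (lseZ_pos β (x s)).ne'
  simp only [lseW]
  field_simp

lemma lseF_pos (β θ : ℝ) (x : ι → ℝ) : 0 < lseF β θ x := Real.exp_pos _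

lemma lseF_le (β θ : ℝ) (hβ : 0 < β) (hθ : 0 < θ) (x : ι → ℝ) (M : ℝ) (hx : ∀ i, x i ≤ M) :
    lseF β θ x ≤ Real.exp (θ / β * Real.log (Fintype.card ι)) * Real.exp (θ * M) := by
  rw [← Real.exp_add, lseF, Real.exp_le_exp]
  have h1 : lseZ β x ≤ Fintype.card ι * Real.exp (β * M) := by
    have : lseZ β x ≤ ∑ i : ι, Real.exp (β * M) :=
      Finset.sum_le_sum fun i _ => Real.exp_le_exp.2 (by have := hx i; gcongr)
    simpa using this
  have h2 := Real.log_le_log (lseZ_pos β x) h1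
  have hc : (0:ℝ) < Fintype.card ι := by exact_mod_cast Fintype.card_pos
  rw [Real.log_mul hc.ne' (Real.exp_pos _).ne', Real.log_exp] at h2
  calc θ / β * Real.log (lseZ β x) ≤ θ / β * (Real.log (Fintype.card ι) + β * M) := by gcongr
    _ = _ := by field_simp

lemma le_lseF (β θ : ℝ) (hβ : 0 < β) (hθ : 0 < θ) (x : ι → ℝ) (i : ι) :
    Real.exp (θ * x i) ≤ lseF β θ x := by
  rw [lseF, Real.exp_le_exp]
  have h1 : Real.exp (β * x i) ≤ lseZ β x :=
    Finset.single_le_sum (f := fun i => Real.exp (β * x i)) (fun j _ => (Real.exp_pos _).le) (Finset.mem_univ i)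
  have h2 := Real.log_le_log (Real.exp_pos _) h1
  rw [Real.log_exp] at h2
  calc θ * x i = θ / β * (β * x i) := by field_simp
    _ ≤ _ := by gcongr

@[fun_prop]
lemma lseZ_continuous (β : ℝ) : Continuous (lseZ (ι := ι) β) := by
  unfold lseZ; fun_prop

@[fun_prop]
lemma lseF_continuous (β θ : ℝ) : Continuous (lseF (ι := ι) β θ) := by
  unfold lseF
  have := (lseZ_continuous (ι := ι) β).log (fun x => (lseZ_pos β x).ne')
  fun_prop

@[fun_prop]
lemma lseW_continuous (β : ℝ) (i : ι) : Continuous (lseW (ι := ι) β i) := by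
  unfold lseW
  exact Continuous.div (by fun_prop) (by fun_prop) (fun x => (lseZ_pos β x).ne')
end lse

lemma integrable_exp_abs (B : ℝ) : Integrable (fun x : ℝ => Real.exp (B * |x|)) (gaussianReal 0 1) := by
  apply integrable_exp_mul_abs (integrable_exp_mul_gaussianReal B)
    (integrable_exp_mul_gaussianReal (-B))

lemma integrable_dom (κ : Type*) [Fintype κ] (B : ℝ) :
    Integrable (fun w : κ → ℝ => Real.exp (B * ∑ k, |w k|)) (gpi κ) := by
  have : (fun w : κ → ℝ => Real.exp (B * ∑ k, |w k|)) = fun w => ∏ k, Real.exp (B * |w k|) := by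
    funext w; rw [Finset.mul_sum, Real.exp_sum]
  rw [this]
  exact Integrable.fintype_prod (f := fun (_ : κ) (x : ℝ) => Real.exp (B * |x|)) (fun k => integrable_exp_abs B)

lemma integrable_of_dom {κ : Type*} [Fintype κ] (f : (κ → ℝ) → ℝ) (hf : Continuous f) (A B : ℝ)
    (h : ∀ w, |f w| ≤ A * Real.exp (B * ∑ k, |w k|)) : Integrable f (gpi κ) :=
  ((integrable_dom κ B).const_mul A).mono' hf.aestronglyMeasurable
    (ae_of_all _ fun w => by simpa using h w)


noncomputable def lin {ι κ : Type*} [Fintype κ] (c : ι → ℝ) (l : ι → κ → ℝ) (w : κ → ℝ) (i : ι) : ℝ :=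
  c i + ∑ k, l i k * w k

section slep
set_option linter.unusedSectionVars false
variable {ι κ : Type*} [Fintype ι] [Nonempty ι] [Fintype κ]

@[fun_prop]
lemma lin_continuous (c : ι → ℝ) (l : ι → κ → ℝ) : Continuous (lin c l) := by
  unfold lin; fun_prop

lemma lin_bound (c : ι → ℝ) (l : ι → κ → ℝ) (C L : ℝ) (hc : ∀ i, |c i| ≤ C) (hl : ∀ i k, |l i k| ≤ L)
    (w : κ → ℝ) (i : ι) : lin c l w i ≤ C + L * ∑ k, |w k| := by
  unfold lin
  rw [Finset.mul_sum]
  have h1 := (abs_le.1 (hc i)).2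
  have h2 : ∑ k, l i k * w k ≤ ∑ k, L * |w k| := by
    refine Finset.sum_le_sum fun k _ => ?_
    calc l i k * w k ≤ |l i k * w k| := le_abs_self _
      _ = |l i k| * |w k| := abs_mul _ _
      _ ≤ _ := by gcongr; exact hl i k
  linarith

lemma F_dom (β θ : ℝ) (hβ : 0 < β) (hθ : 0 < θ) (c : ι → ℝ) (C L : ℝ) (hc : ∀ i, |c i| ≤ C) :
    ∃ A : ℝ, 0 ≤ A ∧ ∀ l : ι → κ → ℝ, (∀ i k, |l i k| ≤ L) → ∀ w,
      lseF β θ (lin c l w) ≤ A * Real.exp (θ * L * ∑ k, |w k|) := by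
  refine ⟨Real.exp (θ / β * Real.log (Fintype.card ι)) * Real.exp (θ * C), by positivity, ?_⟩
  intro l hl w
  have := lseF_le β θ hβ hθ _ _ (lin_bound c l C L hc hl w)
  refine this.trans (le_of_eq ?_)
  rw [mul_add, Real.exp_add, ← mul_assoc, ← mul_assoc]

lemma exists_bd (l : ι → κ → ℝ) : ∃ L : ℝ, 0 ≤ L ∧ ∀ i k, |l i k| ≤ L := by
  refine ⟨∑ i, ∑ k, |l i k|, by positivity, fun i k => ?_⟩
  calc |l i k| ≤ ∑ k, |l i k| := Finset.single_le_sum (f := fun k => |l i k|) (fun _ _ => abs_nonneg _) (Finset.mem_univ k)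
    _ ≤ _ := Finset.single_le_sum (f := fun i => ∑ k, |l i k|) (fun _ _ => by positivity) (Finset.mem_univ i)

lemma exists_bd1 (c : ι → ℝ) : ∃ L : ℝ, 0 ≤ L ∧ ∀ i, |c i| ≤ L :=
  ⟨∑ i, |c i|, by positivity, fun i => Finset.single_le_sum (f := fun k => |c k|) (fun _ _ => abs_nonneg _) (Finset.mem_univ i)⟩

lemma abs_le_exp_sum (w : κ → ℝ) (k : κ) : |w k| ≤ Real.exp (1 * ∑ k, |w k|) := by
  have h1 : |w k| ≤ ∑ k, |w k| := Finset.single_le_sum (f := fun k => |w k|) (fun _ _ => abs_nonneg _) (Finset.mem_univ k)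
  have h2 := Real.add_one_le_exp (1 * ∑ k, |w k|)
  linarith

/-- integrability of F * (bounded continuous) -/
lemma int_F_mul (β θ : ℝ) (hβ : 0 < β) (hθ : 0 < θ) (c : ι → ℝ) (l : ι → κ → ℝ)
    (g : (κ → ℝ) → ℝ) (hg : Continuous g) (G : ℝ) (hG : ∀ w, |g w| ≤ G) :
    Integrable (fun w => lseF β θ (lin c l w) * g w) (gpi κ) := by
  obtain ⟨C, hC0, hC⟩ := exists_bd1 c
  obtain ⟨L, hL0, hL⟩ := exists_bd l
  obtain ⟨A, hA0, hA⟩ := F_dom (κ := κ) β θ hβ hθ c C L hC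
  refine integrable_of_dom _ (by fun_prop) (A * G) (θ * L) fun w => ?_
  rw [abs_mul, abs_of_pos (lseF_pos _ _ _)]
  calc _ ≤ (A * Real.exp (θ * L * ∑ k, |w k|)) * G := by
        gcongr
        · exact hA l hL w
        · exact hG w
    _ = _ := by ring

lemma int_wF_mul (β θ : ℝ) (hβ : 0 < β) (hθ : 0 < θ) (c : ι → ℝ) (l : ι → κ → ℝ) (k : κ)
    (g : (κ → ℝ) → ℝ) (hg : Continuous g) (G : ℝ) (hG : ∀ w, |g w| ≤ G) :
    Integrable (fun w => w k * (lseF β θ (lin c l w) * g w)) (gpi κ) := by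
  obtain ⟨C, hC0, hC⟩ := exists_bd1 c
  obtain ⟨L, hL0, hL⟩ := exists_bd l
  obtain ⟨A, hA0, hA⟩ := F_dom (κ := κ) β θ hβ hθ c C L hC
  refine integrable_of_dom _ (by fun_prop) (A * G) (1 + θ * L) fun w => ?_
  rw [abs_mul, abs_mul, abs_of_pos (lseF_pos _ _ _)]
  have hG0 : 0 ≤ G := (abs_nonneg _).trans (hG w)
  calc _ ≤ Real.exp (1 * ∑ k, |w k|) * ((A * Real.exp (θ * L * ∑ k, |w k|)) * G) := by
        gcongr
        · exact mul_nonneg (lseF_pos _ _ _).le (abs_nonneg _)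
        · exact abs_le_exp_sum w k
        · exact hA l hL w
        · exact hG w
    _ = _ := by rw [add_mul, Real.exp_add]; ring

lemma lin_update_deriv [DecidableEq κ] (c : ι → ℝ) (l : ι → κ → ℝ) (w : κ → ℝ) (k : κ) (s : ℝ) (i : ι) :
    HasDerivAt (fun s => lin c l (Function.update w k s) i) (l i k) s := by
  unfold lin
  have h : ∀ j, HasDerivAt (fun s => Function.update w k s j) ((Pi.single k (1:ℝ) : κ → ℝ) j) s :=
    hasDerivAt_pi.1 (hasDerivAt_update w k s)
  have h2 := (HasDerivAt.fun_sum (u := Finset.univ) (fun j _ => (h j).const_mul (l i j))).const_add (c i)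
  refine h2.congr_deriv ?_
  simp [Pi.single_apply]

lemma sumW_bound (β : ℝ) (x : ι → ℝ) (v : ι → ℝ) (L : ℝ) (hv : ∀ j, |v j| ≤ L) :
    |∑ j, lseW β j x * v j| ≤ L := by
  calc |∑ j, lseW β j x * v j| ≤ ∑ j, |lseW β j x * v j| := Finset.abs_sum_le_sum_abs _ _
    _ ≤ ∑ j, lseW β j x * L := by
        refine Finset.sum_le_sum fun j _ => ?_
        rw [abs_mul, abs_of_nonneg (lseW_nonneg _ _ _)]
        exact mul_le_mul_of_nonneg_left (hv j) (lseW_nonneg _ _ _)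
    _ = L := by rw [← Finset.sum_mul, lseW_sum, one_mul]

lemma ibp (β θ : ℝ) (hβ : 0 < β) (hθ : 0 < θ) (c : ι → ℝ) (l : ι → κ → ℝ) (k : κ) (i : ι) :
    ∫ w, w k * (lseF β θ (lin c l w) * lseW β i (lin c l w)) ∂(gpi κ) =
    ∫ w, lseF β θ (lin c l w) * (lseW β i (lin c l w) *
      ((θ - β) * ∑ j, lseW β j (lin c l w) * l j k + β * l i k)) ∂(gpi κ) := by
  classical
  obtain ⟨L, hL0, hL⟩ := exists_bd l
  have hW : ∀ i w, |lseW β i (lin c l w)| ≤ 1 := fun i w => by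
    rw [abs_of_nonneg (lseW_nonneg _ _ _)]; exact lseW_le_one _ _ _
  apply stein_pi k
  · intro w x
    have h1 := lseF_deriv β θ hβ (fun s => lin c l (Function.update w k s)) (fun j => l j k) x
      (fun j => lin_update_deriv c l w k x j)
    have h2 := lseW_deriv β (fun s => lin c l (Function.update w k s)) (fun j => l j k) x i
      (fun j => lin_update_deriv c l w k x j)
    exact (h1.mul h2).congr_deriv (by ring)
  · exact int_F_mul β θ hβ hθ c l _ (by fun_prop) 1 (hW i)
  · refine int_F_mul β θ hβ hθ c l _ (by fun_prop) (|θ - β| * L + β * L) fun w => ?_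
    have h3 := sumW_bound β (lin c l w) (fun j => l j k) L (fun j => hL j k)
    rw [abs_mul]
    calc _ ≤ 1 * |(θ - β) * ∑ j, lseW β j (lin c l w) * l j k + β * l i k| := by
          gcongr; exact hW i w
      _ ≤ |(θ - β) * ∑ j, lseW β j (lin c l w) * l j k| + |β * l i k| := by
          rw [one_mul]; exact abs_add_le _ _
      _ ≤ _ := by
          rw [abs_mul, abs_mul, abs_of_pos hβ]
          gcongr
          exact hL i k
  · exact int_wF_mul β θ hβ hθ c l k _ (by fun_prop) 1 (hW i)
end slep


section slep2
set_option linter.unusedSectionVars false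
variable {ι κ : Type*} [Fintype ι] [Nonempty ι] [Fintype κ]

noncomputable def rot (a b : ι → κ → ℝ) (φ : ℝ) (i : ι) (k : κ) : ℝ :=
  Real.sin φ * a i k + Real.cos φ * b i k
noncomputable def rot' (a b : ι → κ → ℝ) (φ : ℝ) (i : ι) (k : κ) : ℝ :=
  Real.cos φ * a i k - Real.sin φ * b i k

lemma rot_bd (a b : ι → κ → ℝ) : ∃ L : ℝ, 0 ≤ L ∧ ∀ φ i k, |rot a b φ i k| ≤ L ∧ |rot' a b φ i k| ≤ L := by
  obtain ⟨A, hA0, hA⟩ := exists_bd a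
  obtain ⟨B, hB0, hB⟩ := exists_bd b
  refine ⟨A + B, by positivity, fun φ i k => ?_⟩
  have h1 : ∀ s x M : ℝ, |s| ≤ 1 → |x| ≤ M → |s * x| ≤ M := fun s x M hs hx => by
    rw [abs_mul]; nlinarith [abs_nonneg s, abs_nonneg x]
  constructor
  · exact (abs_add_le _ _).trans (add_le_add (h1 _ _ _ (Real.abs_sin_le_one φ) (hA i k)) (h1 _ _ _ (Real.abs_cos_le_one φ) (hB i k)))
  · exact (abs_sub _ _).trans (add_le_add (h1 _ _ _ (Real.abs_cos_le_one φ) (hA i k)) (h1 _ _ _ (Real.abs_sin_le_one φ) (hB i k)))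

lemma rot_deriv (c : ι → ℝ) (a b : ι → κ → ℝ) (w : κ → ℝ) (φ : ℝ) (i : ι) :
    HasDerivAt (fun φ => lin c (rot a b φ) w i) (∑ k, rot' a b φ i k * w k) φ := by
  unfold lin rot rot'
  refine (HasDerivAt.fun_sum (u := Finset.univ) (fun k _ =>
    ((((Real.hasDerivAt_sin φ).mul_const (a i k)).add ((Real.hasDerivAt_cos φ).mul_const (b i k))).mul_const (w k)))).const_add (c i) |>.congr_deriv ?_
  refine Finset.sum_congr rfl fun k _ => by ring

lemma slep_deriv (β θ : ℝ) (hβ : 0 < β) (hθ : 0 < θ) (c : ι → ℝ) (a b : ι → κ → ℝ) (φ : ℝ) :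
    HasDerivAt (fun φ => ∫ w, lseF β θ (lin c (rot a b φ) w) ∂(gpi κ))
      (∫ w, θ * lseF β θ (lin c (rot a b φ) w) *
        ∑ i, lseW β i (lin c (rot a b φ) w) * ∑ k, rot' a b φ i k * w k ∂(gpi κ)) φ := by
  obtain ⟨C, hC0, hC⟩ := exists_bd1 c
  obtain ⟨L, hL0, hL⟩ := rot_bd a b
  obtain ⟨A, hA0, hA⟩ := F_dom (κ := κ) β θ hβ hθ c C L hC
  have hint : ∀ φ, Integrable (fun w => lseF β θ (lin c (rot a b φ) w)) (gpi κ) := fun φ => by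
    simpa using int_F_mul β θ hβ hθ c (rot a b φ) (fun _ => 1) (by fun_prop) 1 (by simp)
  refine (hasDerivAt_integral_of_dominated_loc_of_deriv_le (s := Set.univ) (x₀ := φ)
    (bound := fun w => (θ * A * L) * Real.exp ((θ * L + 1) * ∑ k, |w k|))
    (F' := fun φ w => θ * lseF β θ (lin c (rot a b φ) w) *
        ∑ i, lseW β i (lin c (rot a b φ) w) * ∑ k, rot' a b φ i k * w k)
    Filter.univ_mem
    (Eventually.of_forall fun φ => (hint φ).aestronglyMeasurable) (hint φ) ?_ ?_ ?_ ?_).2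
  · apply Continuous.aestronglyMeasurable
    fun_prop
  · refine ae_of_all _ fun w φ _ => ?_
    have hS : ∀ i, |∑ k, rot' a b φ i k * w k| ≤ L * Real.exp (1 * ∑ k, |w k|) := fun i => by
      calc _ ≤ ∑ k, |rot' a b φ i k * w k| := Finset.abs_sum_le_sum_abs _ _
        _ ≤ ∑ k, L * |w k| := Finset.sum_le_sum fun k _ => by
            rw [abs_mul]; gcongr; exact (hL φ i k).2
        _ = L * ∑ k, |w k| := by rw [Finset.mul_sum]
        _ ≤ _ := by
            gcongr
            have := Real.add_one_le_exp (1 * ∑ k, |w k|)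
            linarith
    have h2 := sumW_bound β (lin c (rot a b φ) w) _ _ hS
    have h3 := hA (rot a b φ) (fun i k => (hL φ i k).1) w
    rw [Real.norm_eq_abs, abs_mul, abs_mul, abs_of_pos hθ, abs_of_pos (lseF_pos _ _ _)]
    calc _ ≤ θ * (A * Real.exp (θ * L * ∑ k, |w k|)) * (L * Real.exp (1 * ∑ k, |w k|)) := by
          gcongr
      _ = _ := by rw [add_mul, Real.exp_add]; ring
  · exact (integrable_dom κ _).const_mul _
  · refine ae_of_all _ fun w φ _ => ?_
    exact lseF_deriv β θ hβ (fun φ => lin c (rot a b φ) w) _ φ (fun i => rot_deriv c a b w φ i)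

lemma slep_deriv_eq (β θ : ℝ) (hβ : 0 < β) (hθ : 0 < θ) (c : ι → ℝ) (a b : ι → κ → ℝ)
    (hab : ∀ i j, ∑ k, a i k * b j k = 0) (φ : ℝ) :
    (∫ w, θ * lseF β θ (lin c (rot a b φ) w) *
        ∑ i, lseW β i (lin c (rot a b φ) w) * ∑ k, rot' a b φ i k * w k ∂(gpi κ)) =
    ∫ w, (lseF β θ (lin c (rot a b φ) w) * (θ * (Real.sin φ * Real.cos φ) *
        ∑ i, lseW β i (lin c (rot a b φ) w) *
        ((θ - β) * ∑ j, lseW β j (lin c (rot a b φ) w) * (∑ k, a i k * a j k - ∑ k, b i k * b j k)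
          + β * (∑ k, a i k * a i k - ∑ k, b i k * b i k)))) ∂(gpi κ) := by
  obtain ⟨L, hL0, hL⟩ := rot_bd a b
  have hW : ∀ i w, |lseW β i (lin c (rot a b φ) w)| ≤ 1 := fun i w => by
    rw [abs_of_nonneg (lseW_nonneg _ _ _)]; exact lseW_le_one _ _ _
  have hD : ∀ i j, ∑ k, rot' a b φ i k * rot a b φ j k = Real.sin φ * Real.cos φ *
      (∑ k, a i k * a j k - ∑ k, b i k * b j k) := fun i j => by
    have : ∑ k, rot' a b φ i k * rot a b φ j k = Real.sin φ * Real.cos φ *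
      (∑ k, a i k * a j k - ∑ k, b i k * b j k) + Real.cos φ ^ 2 * ∑ k, a i k * b j k
      - Real.sin φ ^ 2 * ∑ k, a j k * b i k := by
      simp only [Finset.mul_sum, ← Finset.sum_add_distrib, ← Finset.sum_sub_distrib]
      refine Finset.sum_congr rfl fun k _ => ?_
      unfold rot rot'; ring
    rw [this, hab, hab]; ring
  have e1 : ∀ w : κ → ℝ, θ * lseF β θ (lin c (rot a b φ) w) *
        ∑ i, lseW β i (lin c (rot a b φ) w) * ∑ k, rot' a b φ i k * w k =
      ∑ i, ∑ k, (θ * rot' a b φ i k) * (w k * (lseF β θ (lin c (rot a b φ) w) * lseW β i (lin c (rot a b φ) w))) := by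
    intro w
    simp only [Finset.mul_sum]
    refine Finset.sum_congr rfl fun i _ => Finset.sum_congr rfl fun k _ => by ring
  simp_rw [e1]
  have hi1 : ∀ i k, Integrable (fun w : κ → ℝ => (θ * rot' a b φ i k) * (w k * (lseF β θ (lin c (rot a b φ) w) * lseW β i (lin c (rot a b φ) w)))) (gpi κ) := fun i k =>
    (int_wF_mul β θ hβ hθ c (rot a b φ) k _ (by fun_prop) 1 (hW i)).const_mul _
  have hi2 : ∀ i k, Integrable (fun w : κ → ℝ => (θ * rot' a b φ i k) * (lseF β θ (lin c (rot a b φ) w) * (lseW β i (lin c (rot a b φ) w) *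
      ((θ - β) * ∑ j, lseW β j (lin c (rot a b φ) w) * rot a b φ j k + β * rot a b φ i k)))) (gpi κ) := fun i k => by
    refine (int_F_mul β θ hβ hθ c (rot a b φ) _ (by fun_prop) (|θ - β| * L + β * L) fun w => ?_).const_mul _
    have h3 := sumW_bound β (lin c (rot a b φ) w) (fun j => rot a b φ j k) L (fun j => (hL φ j k).1)
    rw [abs_mul]
    calc _ ≤ 1 * |(θ - β) * ∑ j, lseW β j (lin c (rot a b φ) w) * rot a b φ j k + β * rot a b φ i k| := by
          gcongr; exact hW i w
      _ ≤ |(θ - β) * ∑ j, lseW β j (lin c (rot a b φ) w) * rot a b φ j k| + |β * rot a b φ i k| := by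
          rw [one_mul]; exact abs_add_le _ _
      _ ≤ _ := by
          rw [abs_mul, abs_mul, abs_of_pos hβ]
          gcongr
          exact (hL φ i k).1
  rw [integral_finsetSum _ (fun i _ => integrable_finsetSum _ fun k _ => hi1 i k)]
  simp_rw [fun i => integral_finsetSum Finset.univ (fun k _ => hi1 i k), integral_const_mul, ibp β θ hβ hθ,
    ← integral_const_mul]
  simp_rw [← fun i => integral_finsetSum Finset.univ (fun k _ => hi2 i k)]
  rw [← integral_finsetSum _ (fun i _ => integrable_finsetSum _ fun k _ => hi2 i k)]
  congr 1
  funext w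
  simp only [Finset.mul_sum (s := Finset.univ) (a := θ * (Real.sin φ * Real.cos φ)), Finset.mul_sum (s := Finset.univ) (a := lseF β θ (lin c (rot a b φ) w))]
  refine Finset.sum_congr rfl fun i _ => ?_
  set F := lseF β θ (lin c (rot a b φ) w)
  set W := fun i => lseW β i (lin c (rot a b φ) w) with hWd
  have h5 : ∑ k, rot' a b φ i k * ((θ - β) * ∑ j, W j * rot a b φ j k + β * rot a b φ i k) =
     (θ - β) * ∑ j, W j * ∑ k, rot' a b φ i k * rot a b φ j k + β * ∑ k, rot' a b φ i k * rot a b φ i k := by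
    simp only [mul_add, Finset.sum_add_distrib]
    congr 1
    · simp only [Finset.mul_sum]
      rw [Finset.sum_comm]
      refine Finset.sum_congr rfl fun i _ => Finset.sum_congr rfl fun k _ => by ring
    · simp only [Finset.mul_sum]
      refine Finset.sum_congr rfl fun k _ => by ring
  have h6 : ∑ k, θ * rot' a b φ i k * (F * (W i * ((θ - β) * ∑ j, W j * rot a b φ j k + β * rot a b φ i k))) =
     θ * F * W i * ∑ k, rot' a b φ i k * ((θ - β) * ∑ j, W j * rot a b φ j k + β * rot a b φ i k) := by
    rw [Finset.mul_sum]
    refine Finset.sum_congr rfl fun k _ => by ring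
  change ∑ k, θ * rot' a b φ i k * (F * (W i * ((θ - β) * ∑ j, W j * rot a b φ j k + β * rot a b φ i k))) = F * (θ * (Real.sin φ * Real.cos φ) * (W i * ((θ - β) * ∑ j, W j * (∑ k, a i k * a j k - ∑ k, b i k * b j k)
          + β * (∑ k, a i k * a i k - ∑ k, b i k * b i k))))
  rw [h6, h5]
  simp_rw [hD]
  have h7 : ∑ j, W j * (Real.sin φ * Real.cos φ * (∑ k, a i k * a j k - ∑ k, b i k * b j k)) =
     Real.sin φ * Real.cos φ * ∑ j, W j * (∑ k, a i k * a j k - ∑ k, b i k * b j k) := by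
    rw [Finset.mul_sum]
    refine Finset.sum_congr rfl fun k _ => by ring
  rw [h7]; ring

theorem slepian (β θ : ℝ) (hθ : 0 < θ) (hθβ : θ ≤ β) (c : ι → ℝ) (a b : ι → κ → ℝ)
    (hab : ∀ i j, ∑ k, a i k * b j k = 0)
    (hdiag : ∀ i, ∑ k, a i k * a i k - ∑ k, b i k * b i k = -1)
    (hoff : ∀ i j, -1 ≤ ∑ k, a i k * a j k - ∑ k, b i k * b j k) :
    Real.exp (θ ^ 2 / 2) * ∫ w, lseF β θ (lin c a w) ∂(gpi κ) ≤ ∫ w, lseF β θ (lin c b w) ∂(gpi κ) := by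
  have hβ : 0 < β := hθ.trans_le hθβ
  have hd := slep_deriv β θ hβ hθ c a b
  set G : ℝ → ℝ := fun φ => ∫ w, lseF β θ (lin c (rot a b φ) w) ∂(gpi κ) with hG
  have hint : ∀ φ, Integrable (fun w => lseF β θ (lin c (rot a b φ) w)) (gpi κ) := fun φ => by
    simpa using int_F_mul β θ hβ hθ c (rot a b φ) (fun _ => 1) (by fun_prop) 1 (by simp)
  set D : ℝ → ℝ := fun φ => (∫ w, θ * lseF β θ (lin c (rot a b φ) w) *
        ∑ i, lseW β i (lin c (rot a b φ) w) * ∑ k, rot' a b φ i k * w k ∂(gpi κ)) with hDd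
  have hbd : ∀ φ ∈ Set.Icc 0 (Real.pi / 2), D φ ≤ - θ ^ 2 * (Real.sin φ * Real.cos φ) * G φ := by
    intro φ hφ
    have hs : 0 ≤ Real.sin φ := Real.sin_nonneg_of_nonneg_of_le_pi hφ.1 (by linarith [hφ.2, Real.pi_pos])
    have hc : 0 ≤ Real.cos φ := Real.cos_nonneg_of_neg_pi_div_two_le_of_le (by linarith [hφ.1, Real.pi_pos]) hφ.2
    simp only [hDd, hG]
    rw [slep_deriv_eq β θ hβ hθ c a b hab φ, ← integral_const_mul]
    have hpt : ∀ w : κ → ℝ, (lseF β θ (lin c (rot a b φ) w) * (θ * (Real.sin φ * Real.cos φ) *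
        ∑ i, lseW β i (lin c (rot a b φ) w) *
        ((θ - β) * ∑ j, lseW β j (lin c (rot a b φ) w) * (∑ k, a i k * a j k - ∑ k, b i k * b j k)
          + β * (∑ k, a i k * a i k - ∑ k, b i k * b i k)))) ≤ - θ ^ 2 * (Real.sin φ * Real.cos φ) * lseF β θ (lin c (rot a b φ) w) := by
      intro w
      have h1 : ∑ i, lseW β i (lin c (rot a b φ) w) *
        ((θ - β) * ∑ j, lseW β j (lin c (rot a b φ) w) * (∑ k, a i k * a j k - ∑ k, b i k * b j k)
          + β * (∑ k, a i k * a i k - ∑ k, b i k * b i k)) ≤ ∑ i, lseW β i (lin c (rot a b φ) w) * (-θ) := by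
        refine Finset.sum_le_sum fun i _ => mul_le_mul_of_nonneg_left ?_ (lseW_nonneg _ _ _)
        have h2 : ∑ j, lseW β j (lin c (rot a b φ) w) * (-1) ≤ ∑ j, lseW β j (lin c (rot a b φ) w) * (∑ k, a i k * a j k - ∑ k, b i k * b j k) :=
          Finset.sum_le_sum fun j _ => mul_le_mul_of_nonneg_left (hoff i j) (lseW_nonneg _ _ _)
        rw [← Finset.sum_mul, lseW_sum] at h2
        rw [hdiag]
        nlinarith
      rw [← Finset.sum_mul, lseW_sum] at h1
      have h3 : 0 ≤ lseF β θ (lin c (rot a b φ) w) * (θ * (Real.sin φ * Real.cos φ)) :=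
        mul_nonneg (lseF_pos _ _ _).le (by positivity)
      calc _ = lseF β θ (lin c (rot a b φ) w) * (θ * (Real.sin φ * Real.cos φ)) * _ := (mul_assoc _ _ _).symm
        _ ≤ lseF β θ (lin c (rot a b φ) w) * (θ * (Real.sin φ * Real.cos φ)) * (1 * (-θ)) := mul_le_mul_of_nonneg_left h1 h3
        _ = _ := by ring
    obtain ⟨E, hE0, hE⟩ := exists_bd (fun i j : ι => ∑ k, a i k * a j k - ∑ k, b i k * b j k)
    refine integral_mono ?_ ((hint φ).const_mul _) hpt
    refine int_F_mul β θ hβ hθ c (rot a b φ) _ (by fun_prop) (|θ * (Real.sin φ * Real.cos φ)| * (|θ - β| * E + β * E)) fun w => ?_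
    rw [abs_mul]
    gcongr
    refine sumW_bound β _ _ _ fun i => (abs_add_le _ _).trans ?_
    rw [abs_mul, abs_mul, abs_of_pos hβ]
    gcongr
    · exact sumW_bound β _ _ _ (hE i)
    · exact hE i i
  have hH : ∀ φ, HasDerivAt (fun φ => Real.exp (θ ^ 2 * Real.sin φ ^ 2 / 2) * G φ)
      (Real.exp (θ ^ 2 * Real.sin φ ^ 2 / 2) * (θ ^ 2 * (Real.sin φ * Real.cos φ)) * G φ + Real.exp (θ ^ 2 * Real.sin φ ^ 2 / 2) * D φ) φ := by
    intro φ
    have h1 := ((((Real.hasDerivAt_sin φ).pow 2).const_mul (θ ^ 2)).div_const 2).exp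
    refine (h1.mul (hd φ)).congr_deriv ?_
    simp only [Pi.pow_apply]
    push_cast
    ring
  have hanti : AntitoneOn (fun φ => Real.exp (θ ^ 2 * Real.sin φ ^ 2 / 2) * G φ) (Set.Icc 0 (Real.pi / 2)) := by
    refine antitoneOn_of_deriv_nonpos (convex_Icc _ _) (fun φ _ => (hH φ).continuousAt.continuousWithinAt)
      (fun φ _ => (hH φ).differentiableAt.differentiableWithinAt) fun φ hφ => ?_
    rw [(hH φ).deriv]
    have := hbd φ (interior_subset hφ)
    have h2 := Real.exp_pos (θ ^ 2 * Real.sin φ ^ 2 / 2)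
    nlinarith
  have hfin := hanti (Set.left_mem_Icc.2 (by positivity)) (Set.right_mem_Icc.2 (by positivity)) (by positivity)
  have r0 : rot a b 0 = b := by funext i k; simp [rot]
  have r1 : rot a b (Real.pi / 2) = a := by funext i k; simp [rot]
  simpa [hG, r0, r1] using hfin
end slep2


lemma chernoff_fin {ι κ : Type*} [Fintype ι] [Nonempty ι] [Fintype κ]
    (θ t : ℝ) (hθ : 0 < θ) (c : ι → ℝ) (a b : ι → κ → ℝ)
    (hab : ∀ i j, ∑ k, a i k * b j k = 0)
    (hdiag : ∀ i, ∑ k, a i k * a i k - ∑ k, b i k * b i k = -1)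
    (hoff : ∀ i j, -1 ≤ ∑ k, a i k * a j k - ∑ k, b i k * b j k)
    (R : (κ → ℝ) → ℝ) (hR : ∀ w i, lin c b w i ≤ R w)
    (hRi : Integrable (fun w => Real.exp (θ * R w)) (gpi κ)) :
    gpi κ {w | ∃ i, t < lin c a w i} ≤
      ENNReal.ofReal (Real.exp (-θ * t - θ ^ 2 / 2) * ∫ w, Real.exp (θ * R w) ∂(gpi κ)) := by
  have key : ∀ β, θ ≤ β → (gpi κ).real {w | ∃ i, t < lin c a w i} ≤
      Real.exp (θ / β * Real.log (Fintype.card ι)) * (Real.exp (-θ * t - θ ^ 2 / 2) * ∫ w, Real.exp (θ * R w) ∂(gpi κ)) := by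
    intro β hβθ
    have hβ : 0 < β := hθ.trans_le hβθ
    have hint : ∀ l : ι → κ → ℝ, Integrable (fun w => lseF β θ (lin c l w)) (gpi κ) := fun l => by
      simpa using int_F_mul β θ hβ hθ c l (fun _ => 1) (by fun_prop) 1 (by simp)
    have h1 := slepian β θ hθ hβθ c a b hab hdiag hoff
    have h2 : ∫ w, lseF β θ (lin c b w) ∂(gpi κ) ≤ Real.exp (θ / β * Real.log (Fintype.card ι)) * ∫ w, Real.exp (θ * R w) ∂(gpi κ) := by
      rw [← integral_const_mul]
      exact integral_mono (hint b) (hRi.const_mul _) fun w => lseF_le β θ hβ hθ _ _ (hR w)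
    have h3 := mul_meas_ge_le_integral_of_nonneg (μ := gpi κ) (f := fun w => lseF β θ (lin c a w)) (ae_of_all _ fun w => (lseF_pos _ _ _).le) (hint a) (Real.exp (θ * t))
    have h4 : (gpi κ).real {w | ∃ i, t < lin c a w i} ≤ (gpi κ).real {w | Real.exp (θ * t) ≤ lseF β θ (lin c a w)} := by
      refine measureReal_mono ?_ 
      rintro w ⟨i, hi⟩
      refine le_trans ?_ (le_lseF β θ hβ hθ _ i)
      exact Real.exp_le_exp.2 (by gcongr)
    have e1 : Real.exp (-θ * t - θ ^ 2 / 2) = (Real.exp (θ * t))⁻¹ * (Real.exp (θ ^ 2 / 2))⁻¹ := by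
      rw [← Real.exp_neg, ← Real.exp_neg, ← Real.exp_add]; ring_nf
    rw [e1]
    have p1 := Real.exp_pos (θ * t)
    have p2 := Real.exp_pos (θ ^ 2 / 2)
    have h5 : Real.exp (θ * t) * Real.exp (θ ^ 2 / 2) * (gpi κ).real {w | ∃ i, t < lin c a w i} ≤ Real.exp (θ / β * Real.log (Fintype.card ι)) * ∫ w, Real.exp (θ * R w) ∂(gpi κ) := by
      refine le_trans ?_ (h1.trans h2)
      rw [mul_comm (Real.exp (θ * t)), mul_assoc]
      gcongr
      refine le_trans ?_ h3
      gcongr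
    calc _ = (Real.exp (θ * t))⁻¹ * (Real.exp (θ ^ 2 / 2))⁻¹ * (Real.exp (θ * t) * Real.exp (θ ^ 2 / 2) * (gpi κ).real {w | ∃ i, t < lin c a w i}) := by field_simp
      _ ≤ (Real.exp (θ * t))⁻¹ * (Real.exp (θ ^ 2 / 2))⁻¹ * (Real.exp (θ / β * Real.log (Fintype.card ι)) * ∫ w, Real.exp (θ * R w) ∂(gpi κ)) := by gcongr
      _ = _ := by ring
  have hlim : Tendsto (fun β : ℝ => Real.exp (θ / β * Real.log (Fintype.card ι)) * (Real.exp (-θ * t - θ ^ 2 / 2) * ∫ w, Real.exp (θ * R w) ∂(gpi κ))) atTop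
      (𝓝 (Real.exp (0 * Real.log (Fintype.card ι)) * (Real.exp (-θ * t - θ ^ 2 / 2) * ∫ w, Real.exp (θ * R w) ∂(gpi κ)))) := by
    refine Tendsto.mul_const _ ?_
    refine (Real.continuous_exp.tendsto _).comp ?_
    exact (tendsto_const_nhds.div_atTop tendsto_id).mul_const _
  have := ge_of_tendsto hlim ((eventually_ge_atTop θ).mono fun β hβ => key β hβ)
  simp only [zero_mul, Real.exp_zero, one_mul] at this
  rw [← ENNReal.ofReal_toReal (measure_ne_top (gpi κ) {w | ∃ i, t < lin c a w i})]
  exact ENNReal.ofReal_le_ofReal this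

lemma chernoff_nat {κ : Type*} [Fintype κ]
    (θ t : ℝ) (hθ : 0 < θ) (c : ℕ → ℝ) (a b : ℕ → κ → ℝ)
    (hab : ∀ i j, ∑ k, a i k * b j k = 0)
    (hdiag : ∀ i, ∑ k, a i k * a i k - ∑ k, b i k * b i k = -1)
    (hoff : ∀ i j, -1 ≤ ∑ k, a i k * a j k - ∑ k, b i k * b j k)
    (R : (κ → ℝ) → ℝ) (hR : ∀ w i, lin c b w i ≤ R w)
    (hRi : Integrable (fun w => Real.exp (θ * R w)) (gpi κ)) :
    gpi κ {w | ∃ i, t < lin c a w i} ≤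
      ENNReal.ofReal (Real.exp (-θ * t - θ ^ 2 / 2) * ∫ w, Real.exp (θ * R w) ∂(gpi κ)) := by
  have e : {w | ∃ i, t < lin c a w i} = ⋃ N : ℕ, {w | ∃ i : Fin (N + 1), t < lin c a w i} := by
    ext w
    simp only [Set.mem_ofPred_eq, Set.mem_iUnion]
    constructor
    · rintro ⟨i, hi⟩; exact ⟨i, ⟨i, by omega⟩, hi⟩
    · rintro ⟨N, i, hi⟩; exact ⟨i, hi⟩
  have hm : Monotone fun N : ℕ => {w | ∃ i : Fin (N + 1), t < lin c a w i} := by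
    intro N M hNM w
    rintro ⟨i, hi⟩
    exact ⟨⟨i, by omega⟩, hi⟩
  rw [e, hm.measure_iUnion]
  refine iSup_le fun N => ?_
  exact chernoff_fin (ι := Fin (N + 1)) θ t hθ (fun i => c i) (fun i => a i) (fun i => b i)
    (fun i j => hab i j) (fun i => hdiag i) (fun i j => hoff i j) R (fun w i => hR w i) hRi


lemma young_bd (K τ α γ h g H G sa sg : ℝ) (hK : 0 < K) (hτ : 0 < τ) (hα : 0 ≤ α) (hα1 : α ≤ 1) (hγ1 : γ ≤ 1)
    (hH : H ≤ K * τ * (1 - α ^ 2) / 2 + sa / (2 * (K * τ)))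
    (hG : G ≤ K * (1 - γ ^ 2) / (2 * τ) + τ * sg / (2 * K)) :
    K * α * γ + h * α + H + g * γ + G ≤ K * τ / 2 + K / (2 * τ) + (max h 0 + sa / (2 * (K * τ)))
      + ((max g 0 + τ / (2 * K) * (min g 0) ^ 2) + τ * sg / (2 * K)) := by
  have h1 : h * α ≤ max h 0 := by
    have := le_max_left h 0
    have := le_max_right h 0
    nlinarith
  have h2 : K * α * γ + g * γ ≤ K * τ * α ^ 2 / 2 + K * γ ^ 2 / (2 * τ) + (max g 0 + τ / (2 * K) * (min g 0) ^ 2) := by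
    by_cases hγ : 0 ≤ γ
    · have a1 : g * γ ≤ max g 0 := by
        have := le_max_left g 0
        have := le_max_right g 0
        nlinarith
      have a2 : 0 ≤ τ / (2 * K) * (min g 0) ^ 2 := by positivity
      have a3 : K * τ * α ^ 2 / 2 + K * γ ^ 2 / (2 * τ) - K * α * γ = K / (2 * τ) * (τ * α - γ) ^ 2 := by
        field_simp; ring
      have a4 : 0 ≤ K / (2 * τ) * (τ * α - γ) ^ 2 := by positivity
      linarith
    · push Not at hγ
      have a1 : g * γ ≤ min g 0 * γ := by
        have := min_le_left g 0
        nlinarith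
      have a0 : K * α * γ ≤ 0 := by
        have : 0 ≤ K * α := by positivity
        nlinarith
      have a2 : K * γ ^ 2 / (2 * τ) + τ / (2 * K) * (min g 0) ^ 2 - min g 0 * γ = 1 / (2 * K * τ) * (K * γ - τ * min g 0) ^ 2 := by
        field_simp; ring
      have a3 : 0 ≤ 1 / (2 * K * τ) * (K * γ - τ * min g 0) ^ 2 := by positivity
      have a4 : 0 ≤ K * τ * α ^ 2 / 2 := by positivity
      have a5 := le_max_right g 0
      linarith
  have e1 : K * τ * (1 - α ^ 2) / 2 = K * τ / 2 - K * τ * α ^ 2 / 2 := by ring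
  have e2 : K * (1 - γ ^ 2) / (2 * τ) = K / (2 * τ) - K * γ ^ 2 / (2 * τ) := by ring
  linarith

/-- per-coordinate comparison function -/
noncomputable def rho {A B : Type*} [DecidableEq A] [DecidableEq B] (a0 : A) (b0 : B) (K τ : ℝ) :
    (A × B) ⊕ (A ⊕ B) → ℝ → ℝ
  | Sum.inl _, _ => 0
  | Sum.inr (Sum.inl j), x => if j = a0 then max x 0 + τ / (2 * K) * (min x 0) ^ 2 else τ / (2 * K) * x ^ 2
  | Sum.inr (Sum.inr k), x => if k = b0 then max x 0 else 1 / (2 * (K * τ)) * x ^ 2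

lemma le_one_of_sum_sq {X : Type*} [Fintype X] (f : X → ℝ) (x : X) (hf : ∑ k, f k ^ 2 = 1) : f x ≤ 1 := by
  have := Finset.single_le_sum (f := fun k => f k ^ 2) (fun _ _ => sq_nonneg _) (Finset.mem_univ x)
  simp only [hf] at this
  nlinarith

lemma quad_bd {A : Type*} [Fintype A] [DecidableEq A] (a0 : A) (η g : A → ℝ) (hη : ∑ j, η j ^ 2 = 1) (C : ℝ) (hC : 0 < C) :
    ∑ j ∈ Finset.univ.erase a0, g j * η j ≤ C * (1 - η a0 ^ 2) / 2 + (∑ j ∈ Finset.univ.erase a0, g j ^ 2) / (2 * C) := by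
  have h1 : ∑ j ∈ Finset.univ.erase a0, η j ^ 2 = 1 - η a0 ^ 2 := by
    rw [← hη, ← Finset.add_sum_erase _ _ (Finset.mem_univ a0)]; ring
  rw [← h1, Finset.mul_sum, Finset.sum_div, Finset.sum_div, ← Finset.sum_add_distrib]
  refine Finset.sum_le_sum fun j _ => ?_
  have : C * η j ^ 2 / 2 + g j ^ 2 / (2 * C) - g j * η j = 1 / (2 * C) * (C * η j - g j) ^ 2 := by
    field_simp; ring
  have : 0 ≤ 1 / (2 * C) * (C * η j - g j) ^ 2 := by positivity
  linarith

section app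
set_option linter.unusedSectionVars false
variable {A B : Type*} [Fintype A] [Fintype B] [DecidableEq A] [DecidableEq B]

noncomputable def cfn (a0 : A) (b0 : B) (K : ℝ) (e : OrthonormalBasis A ℝ (EuclideanSpace ℝ A))
    (q : EuclideanSpace ℝ B × EuclideanSpace ℝ A) : ℝ := K * q.1 b0 * inner ℝ (e a0) q.2
noncomputable def afn (q : EuclideanSpace ℝ B × EuclideanSpace ℝ A) : (A × B) ⊕ (A ⊕ B) → ℝ
  | Sum.inl r => q.2 r.1 * q.1 r.2
  | Sum.inr _ => 0
noncomputable def bfn (e : OrthonormalBasis A ℝ (EuclideanSpace ℝ A)) (q : EuclideanSpace ℝ B × EuclideanSpace ℝ A) : (A × B) ⊕ (A ⊕ B) → ℝ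
  | Sum.inl _ => 0
  | Sum.inr (Sum.inl j) => inner ℝ (e j) q.2
  | Sum.inr (Sum.inr k) => q.1 k

lemma afn_bfn (e : OrthonormalBasis A ℝ (EuclideanSpace ℝ A)) (q q' : EuclideanSpace ℝ B × EuclideanSpace ℝ A) :
    ∑ k, afn q k * bfn e q' k = 0 := by
  simp [Fintype.sum_sum_type, afn, bfn]

lemma eu_inner {A : Type*} [Fintype A] (x y : EuclideanSpace ℝ A) : inner ℝ x y = ∑ i, x i * y i := by
  simp [PiLp.inner_apply, mul_comm]

lemma afn_afn (q q' : EuclideanSpace ℝ B × EuclideanSpace ℝ A) :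
    ∑ k, afn q k * afn q' k = inner ℝ q.2 q'.2 * inner ℝ q.1 q'.1 := by
  simp only [Fintype.sum_sum_type, afn, eu_inner, mul_zero, Finset.sum_const_zero, add_zero]
  rw [Finset.sum_mul_sum, Fintype.sum_prod_type]
  refine Finset.sum_congr rfl fun i _ => Finset.sum_congr rfl fun k _ => by ring

lemma bfn_bfn (e : OrthonormalBasis A ℝ (EuclideanSpace ℝ A)) (q q' : EuclideanSpace ℝ B × EuclideanSpace ℝ A) :
    ∑ k, bfn e q k * bfn e q' k = inner ℝ q.2 q'.2 + inner ℝ q.1 q'.1 := by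
  simp only [Fintype.sum_sum_type, bfn, mul_zero, Finset.sum_const_zero, zero_add]
  rw [eu_inner q.1, ← e.sum_inner_mul_inner]
  simp [real_inner_comm]

lemma bfn_bound (a0 : A) (b0 : B) (K τ : ℝ) (hK : 0 < K) (hτ : 0 < τ) (e : OrthonormalBasis A ℝ (EuclideanSpace ℝ A))
    (q : EuclideanSpace ℝ B × EuclideanSpace ℝ A) (h1 : ‖q.1‖ = 1) (h2 : ‖q.2‖ = 1) (h0 : 0 ≤ q.1 b0)
    (ω : (A × B) ⊕ (A ⊕ B) → ℝ) :
    cfn a0 b0 K e q + ∑ k, bfn e q k * ω k ≤ K * τ / 2 + K / (2 * τ) + ∑ k, rho a0 b0 K τ k (ω k) := by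
  simp only [Fintype.sum_sum_type, bfn, rho, zero_mul, Finset.sum_const_zero, zero_add, cfn]
  have hw : ∑ k, q.1 k ^ 2 = 1 := by
    have := EuclideanSpace.norm_sq_eq q.1
    simpa [h1] using this.symm
  have hy : ∑ j, (inner ℝ (e j) q.2 : ℝ) ^ 2 = 1 := by
    have := e.sum_sq_norm_inner_right q.2
    simpa [h2] using this
  have q1 := quad_bd b0 (fun k => q.1 k) (fun k => ω (Sum.inr (Sum.inr k))) hw (K * τ) (by positivity)
  have q2 := quad_bd a0 (fun j => (inner ℝ (e j) q.2 : ℝ)) (fun k => ω (Sum.inr (Sum.inl k))) hy (K / τ) (by positivity)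
  have q2' : ∑ j ∈ Finset.univ.erase a0, ω (Sum.inr (Sum.inl j)) * (inner ℝ (e j) q.2 : ℝ) ≤ K * (1 - (inner ℝ (e a0) q.2 : ℝ) ^ 2) / (2 * τ) + τ * (∑ j ∈ Finset.univ.erase a0, ω (Sum.inr (Sum.inl j)) ^ 2) / (2 * K) := by
    refine q2.trans (le_of_eq ?_)
    field_simp
  have y := young_bd K τ (q.1 b0) (inner ℝ (e a0) q.2) (ω (Sum.inr (Sum.inr b0))) (ω (Sum.inr (Sum.inl a0))) _ _ _ _ hK hτ h0
    (le_one_of_sum_sq (fun k => q.1 k) b0 hw) (le_one_of_sum_sq (fun j => (inner ℝ (e j) q.2 : ℝ)) a0 hy) q1 q2'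
  rw [← Finset.add_sum_erase _ _ (Finset.mem_univ a0), ← Finset.add_sum_erase (a := b0) _ _ (Finset.mem_univ b0),
    ← Finset.add_sum_erase (a := a0) (f := fun x => if x = a0 then _ else _) _ (Finset.mem_univ a0), ← Finset.add_sum_erase (a := b0) (f := fun x => if x = b0 then _ else _) _ (Finset.mem_univ b0)]
  have s1 : ∑ x ∈ Finset.univ.erase a0, (if x = a0 then max (ω (Sum.inr (Sum.inl x))) 0 + τ / (2 * K) * (min (ω (Sum.inr (Sum.inl x))) 0) ^ 2 else τ / (2 * K) * ω (Sum.inr (Sum.inl x)) ^ 2) = τ * (∑ j ∈ Finset.univ.erase a0, ω (Sum.inr (Sum.inl j)) ^ 2) / (2 * K) := by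
    rw [Finset.mul_sum, Finset.sum_div]
    refine Finset.sum_congr rfl fun x hx => ?_
    rw [if_neg (Finset.ne_of_mem_erase hx)]; ring
  have s2 : ∑ x ∈ Finset.univ.erase b0, (if x = b0 then max (ω (Sum.inr (Sum.inr x))) 0 else 1 / (2 * (K * τ)) * ω (Sum.inr (Sum.inr x)) ^ 2) = (∑ j ∈ Finset.univ.erase b0, ω (Sum.inr (Sum.inr j)) ^ 2) / (2 * (K * τ)) := by
    rw [Finset.sum_div]
    refine Finset.sum_congr rfl fun x hx => ?_
    rw [if_neg (Finset.ne_of_mem_erase hx)]; ring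
  rw [s1, s2, if_pos rfl, if_pos rfl]
  simp only [mul_comm (ω _)] at y
  linarith
end app


section app2
set_option linter.unusedSectionVars false
variable {A B : Type*} [Fintype A] [Fintype B] [DecidableEq A] [DecidableEq B]

lemma rho_bound (a0 : A) (b0 : B) (K τ : ℝ) (k : (A × B) ⊕ (A ⊕ B)) : Measurable (rho a0 b0 K τ k) := by
  rcases k with _ | j | k
  · exact measurable_const
  · show Measurable fun x => rho a0 b0 K τ (Sum.inr (Sum.inl j)) x
    simp only [rho]; split_ifs <;> fun_prop
  · show Measurable fun x => rho a0 b0 K τ (Sum.inr (Sum.inr k)) x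
    simp only [rho]; split_ifs <;> fun_prop

theorem tail0 (a0 : A) (b0 : B) (K τ θ t : ℝ) (hK : 0 < K) (hτ : 0 < τ) (hθ : 0 < θ)
    (ub : EuclideanSpace ℝ A) (hub : ‖ub‖ = 1)
    (hint : ∀ k, Integrable (fun x => Real.exp (θ * rho a0 b0 K τ k x)) (gaussianReal 0 1)) :
    gpi ((A × B) ⊕ (A ⊕ B)) {ω | ∃ (w : EuclideanSpace ℝ B) (y : EuclideanSpace ℝ A), ‖w‖ = 1 ∧ ‖y‖ = 1 ∧
        t < K * w b0 * inner ℝ ub y + ∑ r : A × B, y r.1 * w r.2 * ω (Sum.inl r)} ≤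
      ENNReal.ofReal (Real.exp (-θ * t - θ ^ 2 / 2) * (Real.exp (θ * (K * τ / 2 + K / (2 * τ))) *
        ∏ k, ∫ x, Real.exp (θ * rho a0 b0 K τ k x) ∂(gaussianReal 0 1))) := by
  classical
  obtain ⟨e, he⟩ : ∃ e : OrthonormalBasis A ℝ (EuclideanSpace ℝ A), e a0 = ub := by
    have := Orthonormal.exists_orthonormalBasis_extension_of_card_eq (𝕜 := ℝ) (E := EuclideanSpace ℝ A) (ι := A)
      (by simp) (v := fun _ => ub) (s := {a0}) (by
        rw [orthonormal_iff_ite]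
        rintro ⟨i, hi⟩ ⟨j, hj⟩
        simp only [Set.mem_singleton_iff] at hi hj
        subst hi; subst hj
        simp [hub])
    obtain ⟨e, he⟩ := this
    exact ⟨e, he a0 rfl⟩
  let D : Set (EuclideanSpace ℝ B × EuclideanSpace ℝ A) := {q | ‖q.1‖ = 1 ∧ ‖q.2‖ = 1 ∧ 0 ≤ q.1 b0}
  have : Nonempty D := ⟨⟨(EuclideanSpace.single b0 1, ub), by simp [D, hub]⟩⟩
  let s : ℕ → D := TopologicalSpace.denseSeq D
  have hs : DenseRange s := TopologicalSpace.denseRange_denseSeq D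
  have hch := chernoff_nat (κ := (A × B) ⊕ (A ⊕ B)) θ t hθ (fun i => cfn a0 b0 K e (s i).1) (fun i => afn (s i).1)
    (fun i => bfn e (s i).1) (fun i j => afn_bfn e _ _)
    (fun i => by
      have h := (s i).2
      rw [afn_afn, bfn_bfn, real_inner_self_eq_norm_sq, real_inner_self_eq_norm_sq, h.1, h.2.1]; norm_num)
    (fun i j => by
      have hi := (s i).2
      have hj := (s j).2
      rw [afn_afn, bfn_bfn]
      have h1 := real_inner_le_norm (s i).1.1 (s j).1.1
      have h2 := real_inner_le_norm (s i).1.2 (s j).1.2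
      rw [hi.1, hj.1] at h1
      rw [hi.2.1, hj.2.1] at h2
      nlinarith)
    (fun ω => K * τ / 2 + K / (2 * τ) + ∑ k, rho a0 b0 K τ k (ω k))
    (fun ω i => bfn_bound a0 b0 K τ hK hτ e _ (s i).2.1 (s i).2.2.1 (s i).2.2.2 ω)
  have eprod : ∀ ω : (A × B) ⊕ (A ⊕ B) → ℝ, Real.exp (θ * (K * τ / 2 + K / (2 * τ) + ∑ k, rho a0 b0 K τ k (ω k))) =
      Real.exp (θ * (K * τ / 2 + K / (2 * τ))) * ∏ k, Real.exp (θ * rho a0 b0 K τ k (ω k)) := by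
    intro ω
    rw [mul_add, Real.exp_add, Finset.mul_sum, Real.exp_sum]
  simp_rw [eprod] at hch
  rw [integral_const_mul, integral_fintype_prod_eq_prod (fun k x => Real.exp (θ * rho a0 b0 K τ k x))] at hch
  refine le_trans (measure_mono ?_) (hch ((Integrable.fintype_prod (f := fun k x => Real.exp (θ * rho a0 b0 K τ k x)) hint).const_mul _))
  rintro ω ⟨w, y, hw, hy, ht⟩
  have main : ∀ (w : EuclideanSpace ℝ B) (y : EuclideanSpace ℝ A), ‖w‖ = 1 → ‖y‖ = 1 → 0 ≤ w b0 → 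
        t < K * w b0 * inner ℝ ub y + ∑ r : A × B, y r.1 * w r.2 * ω (Sum.inl r) →
        ∃ i, t < lin (fun i => cfn a0 b0 K e (s i).1) (fun i => afn (s i).1) ω i := by
    intro w y hw hy h0 ht
    let f : D → ℝ := fun q => K * q.1.1 b0 * inner ℝ ub q.1.2 + ∑ r : A × B, q.1.2 r.1 * q.1.1 r.2 * ω (Sum.inl r)
    have hf : Continuous f := by
      have c1 : ∀ k, Continuous fun q : D => q.1.1 k := fun k =>
        (EuclideanSpace.proj (𝕜 := ℝ) k).continuous.comp (continuous_fst.comp continuous_subtype_val)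
      have c2 : ∀ k, Continuous fun q : D => q.1.2 k := fun k =>
        (EuclideanSpace.proj (𝕜 := ℝ) k).continuous.comp (continuous_snd.comp continuous_subtype_val)
      refine Continuous.add ((continuous_const.mul (c1 b0)).mul (Continuous.inner continuous_const (by fun_prop))) ?_
      exact continuous_finsetSum _ fun r _ => ((c2 _).mul (c1 _)).mul continuous_const
    obtain ⟨i, hi⟩ := hs.exists_mem_open (hf.isOpen_preimage _ isOpen_Ioi) ⟨⟨(w, y), hw, hy, h0⟩, ht⟩
    refine ⟨i, ?_⟩
    have : f (s i) = lin (fun i => cfn a0 b0 K e (s i).1) (fun i => afn (s i).1) ω i := by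
      simp [f, lin, cfn, afn, he, Fintype.sum_sum_type]
    rw [← this]; exact hi
  by_cases h0 : 0 ≤ w b0
  · exact main w y hw hy h0 ht
  · refine main (-w) (-y) (by simpa using hw) (by simpa using hy) (by simp; linarith) ?_
    simpa using ht
end app2


noncomputable def gP (s : ℝ) : ℝ := 2 * ∫ x in (0:ℝ)..s, gaussianPDFReal 0 1 x

lemma gpdf_cont : Continuous (gaussianPDFReal 0 1) := by
  rw [show gaussianPDFReal 0 1 = fun x : ℝ => (Real.sqrt (2 * Real.pi))⁻¹ * Real.exp (-x ^ 2 / 2) from funext gpdf_eq]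
  fun_prop

lemma gpdf_neg (x : ℝ) : gaussianPDFReal 0 1 (-x) = gaussianPDFReal 0 1 x := by
  rw [gpdf_eq, gpdf_eq]; simp

lemma gpdf_abs (x : ℝ) : gaussianPDFReal 0 1 |x| = gaussianPDFReal 0 1 x := by
  rw [gpdf_eq, gpdf_eq]; simp

lemma gpdf_pos (x : ℝ) : 0 < gaussianPDFReal 0 1 x := gaussianPDFReal_pos 0 1 x one_ne_zero

lemma gP_deriv (s : ℝ) : HasDerivAt gP (2 * gaussianPDFReal 0 1 s) s :=
  (intervalIntegral.integral_hasDerivAt_right (gpdf_cont.intervalIntegrable _ _)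
    gpdf_cont.aestronglyMeasurable.stronglyMeasurableAtFilter gpdf_cont.continuousAt).const_mul 2

lemma gP_zero : gP 0 = 0 := by simp [gP]

lemma gP_symm (s : ℝ) : ∫ x in (-s)..0, gaussianPDFReal 0 1 x = ∫ x in (0:ℝ)..s, gaussianPDFReal 0 1 x := by
  have := intervalIntegral.integral_comp_neg (a := 0) (b := s) (fun x => gaussianPDFReal 0 1 x)
  simp only [gpdf_neg, neg_zero] at this
  exact this.symm

lemma gP_eq (s : ℝ) : ∫ x in (-s)..s, gaussianPDFReal 0 1 x = gP s := by
  rw [← intervalIntegral.integral_add_adjacent_intervals (b := 0) (gpdf_cont.intervalIntegrable _ _) (gpdf_cont.intervalIntegrable _ _), gP_symm, gP]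
  ring

lemma meas_abs (s : ℝ) (hs : 0 ≤ s) : ((gaussianReal 0 1 : Measure ℝ) {x | s < |x|}).toReal = 1 - gP s := by
  have h1 : {x : ℝ | s < |x|} = (Set.Icc (-s) s)ᶜ := by
    ext x
    simp only [Set.mem_ofPred_eq, Set.mem_compl_iff, Set.mem_Icc, ← abs_le, not_le]
  have h2 : ((gaussianReal 0 1 : Measure ℝ) (Set.Icc (-s) s)).toReal = gP s := by
    rw [gaussianReal_apply_eq_integral 0 one_ne_zero, ENNReal.toReal_ofReal, integral_Icc_eq_integral_Ioc,
      ← intervalIntegral.integral_of_le (by linarith), gP_eq]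
    exact integral_nonneg fun x => gaussianPDFReal_nonneg _ _ _
  rw [h1, prob_compl_eq_one_sub measurableSet_Icc, ENNReal.toReal_sub_of_le prob_le_one ENNReal.one_ne_top, h2]
  simp

lemma gP_le_one (s : ℝ) (hs : 0 ≤ s) : gP s ≤ 1 := by
  have := meas_abs s hs
  have h := ENNReal.toReal_nonneg (a := (gaussianReal 0 1 : Measure ℝ) {x | s < |x|})
  linarith

lemma gP_mono : Monotone gP := monotone_of_deriv_nonneg (fun s => (gP_deriv s).differentiableAt)
  (fun s => by rw [(gP_deriv s).deriv]; have := gpdf_pos s; positivity)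

lemma gP_nonneg (s : ℝ) (hs : 0 ≤ s) : 0 ≤ gP s := by
  have := gP_mono hs; rwa [gP_zero] at this

lemma meas_sq (s : ℝ) (hs : 0 ≤ s) : ((gaussianReal 0 1 : Measure ℝ) {x | s < x ^ 2}).toReal = 1 - gP (Real.sqrt s) := by
  rw [← meas_abs _ (Real.sqrt_nonneg s)]
  congr 2
  ext x
  simp only [Set.mem_ofPred_eq]
  rw [← Real.sqrt_sq_eq_abs, Real.sqrt_lt_sqrt_iff hs]

lemma gauss_half : ∫ x in Set.Ioi (0:ℝ), gaussianPDFReal 0 1 x = 1 / 2 := by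
  have h := integral_comp_abs (f := fun x => gaussianPDFReal 0 1 x)
  simp only [gpdf_abs, integral_gaussianPDFReal_eq_one 0 one_ne_zero] at h
  linarith

lemma exp_abs_int (θ : ℝ) : ∫ x, Real.exp (θ * |x|) ∂(gaussianReal 0 1) = Real.exp (θ ^ 2 / 2) * (1 + gP θ) := by
  rw [integral_gaussianReal_eq_integral_smul one_ne_zero]
  simp only [smul_eq_mul]
  have h := integral_comp_abs (f := fun x => gaussianPDFReal 0 1 x * Real.exp (θ * x))
  simp only [gpdf_abs] at h
  rw [h]
  have e : ∀ x, gaussianPDFReal 0 1 x * Real.exp (θ * x) = Real.exp (θ ^ 2 / 2) * gaussianPDFReal 0 1 (x - θ) := by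
    intro x
    rw [gpdf_eq, gpdf_eq, mul_assoc, ← Real.exp_add, mul_left_comm, ← Real.exp_add]
    congr 2; ring
  simp_rw [e]
  rw [integral_const_mul]
  have h2 : ∫ x in Set.Ioi (0:ℝ), gaussianPDFReal 0 1 (x - θ) = ∫ x in Set.Ioi (-θ), gaussianPDFReal 0 1 x := by
    have mp : MeasurePreserving (fun x : ℝ => x - θ) volume volume := measurePreserving_sub_right volume θ
    have := mp.setIntegral_preimage_emb (MeasurableEquiv.subRight θ).measurableEmbedding (fun x => gaussianPDFReal 0 1 x) (Set.Ioi (-θ))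
    rw [← this]
    congr 2
    ext x; simp
  have h3 : ∫ x in Set.Ioi (-θ), gaussianPDFReal 0 1 x = 1 / 2 + gP θ / 2 := by
    have hi := integrable_gaussianPDFReal 0 1
    have := intervalIntegral.integral_interval_add_Ioi (a := -θ) (b := 0) (f := fun x => gaussianPDFReal 0 1 x) (μ := volume) hi.integrableOn hi.integrableOn
    rw [gP_symm, gauss_half] at this
    rw [← this, gP]; ring
  rw [h2, h3]; ring

lemma quad_int (s : ℝ) (hs : s < 1) : Integrable (fun x : ℝ => Real.exp (s / 2 * x ^ 2)) (gaussianReal 0 1) ∧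
    ∫ x, Real.exp (s / 2 * x ^ 2) ∂(gaussianReal 0 1) = (Real.sqrt (1 - s))⁻¹ := by
  have e : ∀ x : ℝ, gaussianPDFReal 0 1 x * Real.exp (s / 2 * x ^ 2) = (Real.sqrt (2 * Real.pi))⁻¹ * Real.exp (-((1 - s) / 2) * x ^ 2) := by
    intro x
    rw [gpdf_eq, mul_assoc, ← Real.exp_add]
    congr 2; ring
  constructor
  · rw [integrable_gauss_iff]
    simp_rw [e]
    exact (integrable_exp_neg_mul_sq (by linarith)).const_mul _
  · rw [integral_gaussianReal_eq_integral_smul one_ne_zero]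
    simp only [smul_eq_mul]
    simp_rw [e]
    rw [integral_const_mul, integral_gaussian]
    have : Real.pi / ((1 - s) / 2) = (2 * Real.pi) / (1 - s) := by
      have : 1 - s ≠ 0 := by linarith
      field_simp
    rw [this, Real.sqrt_div (by positivity)]
    have : Real.sqrt (2 * Real.pi) ≠ 0 := by positivity
    field_simp

lemma gauss_symm (f : ℝ → ℝ) (hf : Integrable f (gaussianReal 0 1)) :
    ∫ x, f x ∂(gaussianReal 0 1) = (∫ x, (f x + f (-x)) ∂(gaussianReal 0 1)) / 2 := by
  have mp : MeasurePreserving (fun x : ℝ => -x) (gaussianReal 0 1) (gaussianReal 0 1) :=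
    ⟨measurable_neg, by simpa using gaussianReal_map_neg (μ := 0) (v := 1)⟩
  have h1 : Integrable (fun x => f (-x)) (gaussianReal 0 1) := mp.integrable_comp_of_integrable hf
  have h2 : ∫ x, f (-x) ∂(gaussianReal 0 1) = ∫ x, f x ∂(gaussianReal 0 1) :=
    mp.integral_comp (MeasurableEquiv.neg ℝ).measurableEmbedding f
  rw [integral_add hf h1, h2]; ring

/-- M1 -/
lemma M1_int (θ : ℝ) (hθ : 0 < θ) : Integrable (fun x : ℝ => Real.exp (θ * max x 0)) (gaussianReal 0 1) ∧
    ∫ x, Real.exp (θ * max x 0) ∂(gaussianReal 0 1) = (1 + Real.exp (θ ^ 2 / 2) * (1 + gP θ)) / 2 := by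
  have hi : Integrable (fun x : ℝ => Real.exp (θ * max x 0)) (gaussianReal 0 1) := by
    refine (integrable_exp_abs θ).mono' (by fun_prop) (ae_of_all _ fun x => ?_)
    rw [Real.norm_eq_abs, Real.abs_exp]
    refine Real.exp_le_exp.2 (mul_le_mul_of_nonneg_left (max_le (le_abs_self x) (abs_nonneg x)) hθ.le)
  refine ⟨hi, ?_⟩
  rw [gauss_symm _ hi]
  have : ∀ x : ℝ, Real.exp (θ * max x 0) + Real.exp (θ * max (-x) 0) = 1 + Real.exp (θ * |x|) := by
    intro x
    rcases le_total 0 x with h | h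
    · rw [max_eq_left h, max_eq_right (by linarith), abs_of_nonneg h]; simp [add_comm]
    · rw [max_eq_right h, max_eq_left (by linarith), abs_of_nonpos h]; simp
  simp_rw [this]
  rw [integral_add (integrable_const _) (integrable_exp_abs θ), exp_abs_int]
  simp

lemma M2_int (θ s : ℝ) (hs : θ * s < 1) :
    Integrable (fun x : ℝ => Real.exp (θ * (max x 0 + s / 2 * (min x 0) ^ 2))) (gaussianReal 0 1) ∧
    ∫ x, Real.exp (θ * (max x 0 + s / 2 * (min x 0) ^ 2)) ∂(gaussianReal 0 1) =
      ((Real.sqrt (1 - θ * s))⁻¹ + Real.exp (θ ^ 2 / 2) * (1 + gP θ)) / 2 := by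
  have hq := quad_int (θ * s) hs
  have hsum : ∀ x : ℝ, Real.exp (θ * (max x 0 + s / 2 * (min x 0) ^ 2)) + Real.exp (θ * (max (-x) 0 + s / 2 * (min (-x) 0) ^ 2)) = Real.exp (θ * s / 2 * x ^ 2) + Real.exp (θ * |x|) := by
    intro x
    rcases le_total 0 x with h | h
    · rw [max_eq_left h, max_eq_right (by linarith), abs_of_nonneg h, min_eq_right h, min_eq_left (by linarith), add_comm]
      congr 2 <;> ring
    · rw [max_eq_right h, max_eq_left (by linarith), abs_of_nonpos h, min_eq_left h, min_eq_right (by linarith)]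
      congr 2 <;> ring
  have hi : Integrable (fun x : ℝ => Real.exp (θ * (max x 0 + s / 2 * (min x 0) ^ 2))) (gaussianReal 0 1) := by
    refine (hq.1.add (integrable_exp_abs θ)).mono' (by fun_prop) (ae_of_all _ fun x => ?_)
    rw [Real.norm_eq_abs, Real.abs_exp]
    have := hsum x
    have h2 := Real.exp_pos (θ * (max (-x) 0 + s / 2 * (min (-x) 0) ^ 2))
    simp only [Pi.add_apply]
    linarith
  refine ⟨hi, ?_⟩
  rw [gauss_symm _ hi]
  simp_rw [hsum]
  rw [integral_add hq.1 (integrable_exp_abs θ), exp_abs_int, hq.2]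


noncomputable def M1 (θ : ℝ) : ℝ := (1 + Real.exp (θ ^ 2 / 2) * (1 + gP θ)) / 2
noncomputable def M2 (θ z : ℝ) : ℝ := ((Real.sqrt (1 - z))⁻¹ + Real.exp (θ ^ 2 / 2) * (1 + gP θ)) / 2

section app3
set_option linter.unusedSectionVars false
variable {A B : Type*} [Fintype A] [Fintype B] [DecidableEq A] [DecidableEq B]

lemma rho_prod (a0 : A) (b0 : B) (K τ θ : ℝ) (hθ : 0 < θ)
    (hz1 : θ / (K * τ) < 1) (hz2 : θ * τ / K < 1) :
    (∀ k, Integrable (fun x => Real.exp (θ * rho a0 b0 K τ k x)) (gaussianReal 0 1)) ∧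
    ∏ k, ∫ x, Real.exp (θ * rho a0 b0 K τ k x) ∂(gaussianReal 0 1) =
      (M2 θ (θ * τ / K) * (Real.sqrt (1 - θ * τ / K))⁻¹ ^ (Fintype.card A - 1)) *
      (M1 θ * (Real.sqrt (1 - θ / (K * τ)))⁻¹ ^ (Fintype.card B - 1)) := by
  have q1 := quad_int (θ / (K * τ)) hz1
  have q2 := quad_int (θ * τ / K) hz2
  have m1 := M1_int θ hθ
  have m2 := M2_int θ (τ / K) (by rw [← mul_div_assoc]; exact hz2)
  have e1 : ∀ x : ℝ, θ * (1 / (2 * (K * τ)) * x ^ 2) = θ / (K * τ) / 2 * x ^ 2 := fun x => by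
    rw [div_div, one_div, div_eq_mul_inv, mul_comm (K * τ) 2]; ring
  have e2 : ∀ x : ℝ, θ * (τ / (2 * K) * x ^ 2) = θ * τ / K / 2 * x ^ 2 := fun x => by
    rw [div_div, div_eq_mul_inv, div_eq_mul_inv, mul_comm K 2]; ring
  have e3 : τ / (2 * K) = τ / K / 2 := by rw [div_div, mul_comm]
  constructor
  · rintro (_ | j | k)
    · simp [rho]
    · simp only [rho]
      split_ifs
      · rw [e3]; exact m2.1
      · simp_rw [e2]; exact q2.1
    · simp only [rho]
      split_ifs
      · exact m1.1
      · simp_rw [e1]; exact q1.1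
  · rw [Fintype.prod_sum_type, Fintype.prod_sum_type]
    have p0 : ∏ r : A × B, ∫ x, Real.exp (θ * rho a0 b0 K τ (Sum.inl r) x) ∂(gaussianReal 0 1) = 1 := by
      refine Finset.prod_eq_one fun r _ => by simp [rho]
    rw [p0, one_mul]
    congr 1
    · rw [← Finset.mul_prod_erase _ _ (Finset.mem_univ a0)]
      congr 1
      · simp only [rho, if_true]
        rw [e3, m2.2, M2, ← mul_div_assoc]
      · rw [Finset.prod_eq_pow_card (b := (Real.sqrt (1 - θ * τ / K))⁻¹), Finset.card_erase_of_mem (Finset.mem_univ _), Finset.card_univ]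
        intro j hj
        simp only [rho, if_neg (Finset.ne_of_mem_erase hj)]
        simp_rw [e2]; exact q2.2
    · rw [← Finset.mul_prod_erase _ _ (Finset.mem_univ b0)]
      congr 1
      · simp only [rho, if_true]
        rw [m1.2, M1]
      · rw [Finset.prod_eq_pow_card (b := (Real.sqrt (1 - θ / (K * τ)))⁻¹), Finset.card_erase_of_mem (Finset.mem_univ _), Finset.card_univ]
        intro j hj
        simp only [rho, if_neg (Finset.ne_of_mem_erase hj)]
        simp_rw [e1]; exact q1.2

lemma marg_mp : MeasurePreserving (fun (ω : (A × B) ⊕ (A ⊕ B) → ℝ) (a : A) (b : B) => ω (Sum.inl (a, b)))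
    (gpi ((A × B) ⊕ (A ⊕ B))) (Measure.pi fun _ : A => Measure.pi fun _ : B => (gaussianReal 0 1 : Measure ℝ)) := by
  have h1 := measurePreserving_sumPiEquivProdPi (fun _ : (A × B) ⊕ (A ⊕ B) => (gaussianReal 0 1 : Measure ℝ))
  have h2 : MeasurePreserving Prod.fst ((gpi (A × B)).prod (gpi (A ⊕ B))) (gpi (A × B)) := measurePreserving_fst
  have h3 : MeasurePreserving (MeasurableEquiv.curry A B ℝ) (gpi (A × B)) (Measure.pi fun _ : A => Measure.pi fun _ : B => (gaussianReal 0 1 : Measure ℝ)) := by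
    refine ⟨MeasurableEquiv.measurable _, ?_⟩
    have := Measure.infinitePi_map_curry (fun (_ : A) (_ : B) => (gaussianReal 0 1 : Measure ℝ))
    simp only [Measure.infinitePi_eq_pi] at this
    exact this
  exact h3.comp (h2.comp h1)

theorem tail1 (a0 : A) (b0 : B) (K τ θ t : ℝ) (hK : 0 < K) (hτ : 0 < τ) (hθ : 0 < θ)
    (hz1 : θ / (K * τ) < 1) (hz2 : θ * τ / K < 1)
    (ub : EuclideanSpace ℝ A) (hub : ‖ub‖ = 1) :
    (Measure.pi fun _ : A => Measure.pi fun _ : B => (gaussianReal 0 1 : Measure ℝ))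
      {ξ | ∃ (w : EuclideanSpace ℝ B) (y : EuclideanSpace ℝ A), ‖w‖ = 1 ∧ ‖y‖ = 1 ∧
        t < K * w b0 * inner ℝ ub y + ∑ r : A × B, y r.1 * w r.2 * ξ r.1 r.2} ≤
      ENNReal.ofReal (Real.exp (-θ * t - θ ^ 2 / 2 + θ * (K * τ / 2 + K / (2 * τ))) *
        ((M2 θ (θ * τ / K) * (Real.sqrt (1 - θ * τ / K))⁻¹ ^ (Fintype.card A - 1)) *
      (M1 θ * (Real.sqrt (1 - θ / (K * τ)))⁻¹ ^ (Fintype.card B - 1)))) := by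
  have hp := rho_prod a0 b0 K τ θ hθ hz1 hz2
  have h := tail0 a0 b0 K τ θ t hK hτ hθ ub hub hp.1
  rw [hp.2, ← mul_assoc, ← Real.exp_add] at h
  rw [← marg_mp.measure_preimage]
  · exact h
  · apply MeasurableSet.nullMeasurableSet
    apply IsOpen.measurableSet
    have : {ξ : A → B → ℝ | ∃ (w : EuclideanSpace ℝ B) (y : EuclideanSpace ℝ A), ‖w‖ = 1 ∧ ‖y‖ = 1 ∧
        t < K * w b0 * inner ℝ ub y + ∑ r : A × B, y r.1 * w r.2 * ξ r.1 r.2} =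
      ⋃ (w : EuclideanSpace ℝ B), ⋃ (y : EuclideanSpace ℝ A), ⋃ (_ : ‖w‖ = 1), ⋃ (_ : ‖y‖ = 1),
        {ξ : A → B → ℝ | t < K * w b0 * inner ℝ ub y + ∑ r : A × B, y r.1 * w r.2 * ξ r.1 r.2} := by
      ext ξ; simp only [Set.mem_iUnion, Set.mem_ofPred_eq, exists_prop]
    rw [this]
    refine isOpen_iUnion fun w => isOpen_iUnion fun y => isOpen_iUnion fun _ => isOpen_iUnion fun _ => ?_
    exact isOpen_lt continuous_const (by fun_prop)
end app3


lemma eig_bad (n p : ℕ) (hn : 1 ≤ n) (X : Fin n → Fin p → ℝ) (T : ℝ) (hT : 0 ≤ T)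
    (h : T ^ 2 / n < maxEig (sampleCov n p X)) :
    ∃ (w : EuclideanSpace ℝ (Fin p)) (y : EuclideanSpace ℝ (Fin n)), ‖w‖ = 1 ∧ ‖y‖ = 1 ∧
      T < ∑ r : Fin n × Fin p, y r.1 * w r.2 * X r.1 r.2 := by
  have hn0 : (0:ℝ) < n := by exact_mod_cast hn
  obtain ⟨l, hl, hlB⟩ : ∃ l ∈ spectrum ℝ (sampleCov n p X), T ^ 2 / n < l := by
    by_contra hc
    push Not at hc
    have : maxEig (sampleCov n p X) ≤ T ^ 2 / n := Real.sSup_le hc (by positivity)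
    linarith
  rw [← Matrix.spectrum_toLin', ← Module.End.hasEigenvalue_iff_mem_spectrum] at hl
  obtain ⟨v, hv⟩ := hl.exists_hasEigenvector
  have hv1 : (sampleCov n p X).mulVec v = l • v := by
    have := hv.apply_eq_smul
    simpa using this
  have hv0 : v ≠ 0 := hv.2
  set v' : EuclideanSpace ℝ (Fin p) := WithLp.toLp 2 v with hv'
  have hv'0 : v' ≠ 0 := by
    intro h0
    apply hv0
    funext i
    have : v' i = 0 := by rw [h0]; rfl
    simpa [hv'] using this
  have hnorm : 0 < ‖v'‖ := norm_pos_iff.2 hv'0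
  have hsq : ‖v'‖ ^ 2 = ∑ i, v i ^ 2 := by
    rw [EuclideanSpace.norm_sq_eq]; simp [hv']
  let z : Fin n → ℝ := fun ν => ∑ i, X ν i * v i
  have hquad : ∑ ν, z ν ^ 2 = n * l * ‖v'‖ ^ 2 := by
    have h1 : v ⬝ᵥ (sampleCov n p X).mulVec v = l * ‖v'‖ ^ 2 := by
      rw [hv1, hsq]
      simp only [dotProduct, Pi.smul_apply, smul_eq_mul, Finset.mul_sum]
      refine Finset.sum_congr rfl fun i _ => by ring
    have h2 : v ⬝ᵥ (sampleCov n p X).mulVec v = (n:ℝ)⁻¹ * ∑ ν, z ν ^ 2 := by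
      simp only [sampleCov, Matrix.smul_mulVec, dotProduct_smul, smul_eq_mul, Matrix.sum_mulVec, dotProduct_sum]
      congr 1
      refine Finset.sum_congr rfl fun ν _ => ?_
      have : Matrix.mulVec (Matrix.vecMulVec (X ν) (X ν)) v = (z ν) • X ν := by
        funext i
        simp only [Matrix.mulVec, Matrix.vecMulVec_apply, dotProduct, Pi.smul_apply, smul_eq_mul, z, Finset.sum_mul]
        refine Finset.sum_congr rfl fun j _ => by ring
      rw [this, dotProduct_smul, smul_eq_mul, sq]
      congr 1
      simp only [dotProduct, z]
      refine Finset.sum_congr rfl fun j _ => by ring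
    rw [h2] at h1
    field_simp at h1
    linarith
  let z' : EuclideanSpace ℝ (Fin n) := WithLp.toLp 2 z
  have hz'sq : ‖z'‖ ^ 2 = ∑ i, z i ^ 2 := by
    rw [EuclideanSpace.norm_sq_eq]; simp [z']
  have hbig : T * ‖v'‖ < ‖z'‖ := by
    apply lt_of_pow_lt_pow_left₀ 2 (norm_nonneg _)
    rw [hz'sq, hquad, mul_pow]
    rw [div_lt_iff₀ hn0] at hlB
    have : 0 < ‖v'‖ ^ 2 := by positivity
    nlinarith
  have hz0 : 0 < ‖z'‖ := lt_of_le_of_lt (by positivity) hbig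
  refine ⟨(‖v'‖⁻¹) • v', (‖z'‖⁻¹) • z', ?_, ?_, ?_⟩
  · rw [norm_smul, norm_inv, norm_norm, inv_mul_cancel₀ hnorm.ne']
  · rw [norm_smul, norm_inv, norm_norm, inv_mul_cancel₀ hz0.ne']
  · have : ∑ r : Fin n × Fin p, ((‖z'‖⁻¹) • z') r.1 * ((‖v'‖⁻¹) • v') r.2 * X r.1 r.2 = ‖z'‖⁻¹ * ‖v'‖⁻¹ * ∑ ν, z ν ^ 2 := by
      rw [Fintype.sum_prod_type, Finset.mul_sum]
      refine Finset.sum_congr rfl fun ν _ => ?_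
      have : z ν ^ 2 = z ν * ∑ i, X ν i * v i := by rw [sq]
      rw [this, Finset.mul_sum, Finset.mul_sum]
      refine Finset.sum_congr rfl fun i _ => ?_
      simp only [PiLp.smul_apply, smul_eq_mul, hv', z']
      ring
    rw [this, ← hz'sq]
    have e : ‖z'‖⁻¹ * ‖v'‖⁻¹ * ‖z'‖ ^ 2 = ‖z'‖ / ‖v'‖ := by field_simp
    rw [e, lt_div_iff₀ hnorm]
    exact hbig

theorem tail2 (n p : ℕ) (hn : 1 ≤ n) (hp : 1 ≤ p) (σ V su : ℝ) (hσ : 0 < σ) (hV : 0 < V) (u : Fin n → ℝ)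
    (hsu : su = Real.sqrt ((n : ℝ)⁻¹ * ∑ ν, (u ν) ^ 2)) (hsupos : 0 < su)
    (K τ θ t : ℝ) (hKd : K = V * su * Real.sqrt n / σ) (hτ : 0 < τ) (hθ : 0 < θ) (ht : 0 ≤ t)
    (hz1 : θ / (K * τ) < 1) (hz2 : θ * τ / K < 1) (Bd : ℝ) (hB : t ^ 2 * σ ^ 2 / n ≤ Bd) :
    (Measure.pi fun _ : Fin n => Measure.pi fun _ : Fin p => (gaussianReal 0 1 : Measure ℝ))
      {ξ | Bd < maxEig (sampleCov n p (fun ν i => u ν * (if (i : ℕ) = 0 then V else 0) + σ * ξ ν i))} ≤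
      ENNReal.ofReal (Real.exp (-θ * t - θ ^ 2 / 2 + θ * (K * τ / 2 + K / (2 * τ))) *
        ((M2 θ (θ * τ / K) * (Real.sqrt (1 - θ * τ / K))⁻¹ ^ (n - 1)) *
      (M1 θ * (Real.sqrt (1 - θ / (K * τ)))⁻¹ ^ (p - 1)))) := by
  have hn0 : (0:ℝ) < n := by exact_mod_cast hn
  have hsn : 0 < Real.sqrt n := Real.sqrt_pos.2 hn0
  have hK : 0 < K := by rw [hKd]; positivity
  let ub : EuclideanSpace ℝ (Fin n) := WithLp.toLp 2 (fun ν => u ν / (Real.sqrt n * su))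
  have hub : ‖ub‖ = 1 := by
    have h1 : ‖ub‖ ^ 2 = 1 := by
      rw [EuclideanSpace.norm_sq_eq]
      simp only [ub, Real.norm_eq_abs, sq_abs, div_pow, ← Finset.sum_div]
      have h2 : su ^ 2 = (n : ℝ)⁻¹ * ∑ ν, (u ν) ^ 2 := by
        rw [hsu, Real.sq_sqrt (by positivity)]
      rw [mul_pow, h2, Real.sq_sqrt hn0.le]
      have h3 : (∑ ν, (u ν) ^ 2) ≠ 0 := by
        intro h0
        rw [h0] at h2
        have : 0 < su ^ 2 := by positivity
        simp at h2
        linarith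
      field_simp
    nlinarith [norm_nonneg ub]
  have h := tail1 (A := Fin n) (B := Fin p) ⟨0, hn⟩ ⟨0, hp⟩ K τ θ t hK hτ hθ hz1 hz2 ub hub
  rw [Fintype.card_fin, Fintype.card_fin] at h
  refine le_trans (measure_mono ?_) h
  intro ξ hξ
  have hlt : (t * σ) ^ 2 / n < maxEig (sampleCov n p (fun ν i => u ν * (if (i : ℕ) = 0 then V else 0) + σ * ξ ν i)) := by
    rw [mul_pow]; exact lt_of_le_of_lt hB hξ
  obtain ⟨w, y, hw, hy, hwy⟩ := eig_bad n p hn _ (t * σ) (by positivity) hlt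
  refine ⟨w, y, hw, hy, ?_⟩
  have e : ∑ r : Fin n × Fin p, y r.1 * w r.2 * (u r.1 * (if (r.2 : ℕ) = 0 then V else 0) + σ * ξ r.1 r.2) =
      σ * (K * w ⟨0, hp⟩ * inner ℝ ub y + ∑ r : Fin n × Fin p, y r.1 * w r.2 * ξ r.1 r.2) := by
    simp only [mul_add, Finset.sum_add_distrib]
    congr 1
    · rw [Fintype.sum_prod_type, eu_inner, Finset.mul_sum, Finset.mul_sum]
      refine Finset.sum_congr rfl fun ν _ => ?_
      rw [Finset.sum_eq_single (⟨0, hp⟩ : Fin p)]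
      · simp only [if_true, ub, hKd]
        field_simp
      · intro b _ hb
        have : (b : ℕ) ≠ 0 := fun h => hb (Fin.ext h)
        simp [this]
      · simp
    · rw [Finset.mul_sum]
      refine Finset.sum_congr rfl fun r _ => by ring
  rw [e] at hwy
  rw [mul_comm t] at hwy
  exact lt_of_mul_lt_mul_left hwy hσ.le


/-- L lower bound via Cauchy -/
lemma L_lb (L a x α γ c : ℝ) (hL : 0 < L) (hαγ : α ^ 2 + γ ^ 2 ≤ 1) 
    (hc : 0 ≤ c) (hcx : c ^ 2 ≤ (1 + x) ^ 2 + 1) (ha : 0 ≤ a)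
    (h : (1 + x) ^ 2 + 1 ≤ L ^ 2 - 2 * L * a) : (1 + α) * a + γ * c ≤ L := by
  have hLa : a ≤ L := by nlinarith
  have h1 : (α * a + γ * c) ^ 2 ≤ (L - a) ^ 2 := by
    have : (α * a + γ * c) ^ 2 ≤ (α ^ 2 + γ ^ 2) * (a ^ 2 + c ^ 2) := by nlinarith [sq_nonneg (α * c - γ * a)]
    have : (α ^ 2 + γ ^ 2) * (a ^ 2 + c ^ 2) ≤ 1 * (a ^ 2 + c ^ 2) := by gcongr
    nlinarith
  have := abs_le_of_sq_le_sq' h1 (by linarith)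
  linarith [this.2]

lemma A_e (L a x : ℝ) (hL : 0 < L) (ha : 0 ≤ a) (ha1 : a ≤ 13/10) (hx : 0 ≤ x) (hx1 : x ≤ 1)
    (h : (1 + x) ^ 2 + 1 ≤ L ^ 2 - 2 * L * a) : a ≤ L - (1 + x/5 + x ^ 2) ∧ a ^ 2 ≤ L - (1 + x ^ 2 + x ^ 2 / L ^ 2) ∧
      x ^ 2 / L ^ 2 ≤ x / 5 := by
  have l1 := L_lb L a x 0 1 (13416/10000 + 8944/10000 * x) hL (by norm_num) (by positivity) (by nlinarith) ha h
  have l2 := L_lb L a x (5025/10000) (8645/10000) (13416/10000 + 8944/10000 * x) hL (by norm_num) (by positivity) (by nlinarith) ha h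
  have e1 : a ≤ L - (1 + x/5 + x ^ 2) := by nlinarith
  have e3 : x ^ 2 / L ^ 2 ≤ x / 5 := by
    rw [div_le_div_iff₀ (by positivity) (by norm_num)]
    have h0 : 0 ≤ L * a := by positivity
    have h1 : 5 * x ≤ L ^ 2 := by nlinarith
    nlinarith [mul_nonneg hx (sub_nonneg.2 h1)]
  refine ⟨e1, ?_, e3⟩
  by_cases h1 : a ≤ 1
  · nlinarith
  · push Not at h1
    have h2 : a ^ 2 ≤ 23/10 * a - 13/10 := by nlinarith
    have h3 : 5/2 ≤ L := by nlinarith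
    have h4 : x ^ 2 / L ^ 2 ≤ x ^ 2 / (25/4) := by
      apply div_le_div_of_nonneg_left (by positivity) (by norm_num); nlinarith
    nlinarith

lemma A_v1 (L a x : ℝ) (hL : 0 < L) (ha : 0 ≤ a) (ha1 : a ≤ 13/10) (hx : 0 ≤ x) (hx1 : x ≤ 1)
    (h : (1 + x) ^ 2 + 1 ≤ L ^ 2 - 2 * L * a) :
    0 ≤ 78/100 * L ^ 2 + L * (-1 - x/5 - a ^ 2 + 78/100 * a - 121/10000) - (1 + x/5 + x^2) * (a + 11/100) - a ^ 2 / 2 := by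
  have key : ∀ L0 : ℝ, L0 ≤ L → 0 ≤ 156/100 * L0 + (-1 - x/5 - a ^ 2 + 78/100 * a - 121/10000) →
     0 ≤ 78/100 * L0 ^ 2 + L0 * (-1 - x/5 - a ^ 2 + 78/100 * a - 121/10000) - (1 + x/5 + x^2) * (a + 11/100) - a ^ 2 / 2 →
     0 ≤ 78/100 * L ^ 2 + L * (-1 - x/5 - a ^ 2 + 78/100 * a - 121/10000) - (1 + x/5 + x^2) * (a + 11/100) - a ^ 2 / 2 := by
    intro L0 h0 h1 h2
    nlinarith [mul_nonneg (sub_nonneg.2 h0) h1, sq_nonneg (L - L0)]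
  by_cases ha9 : a ≤ 9/10
  · have l1 := L_lb L a x 0 1 (1414/1000 + 7/10 * x) hL (by norm_num) (by positivity) (by nlinarith) ha h
    refine key (a + 1414/1000 + 7/10 * x) (by linarith) (by nlinarith) ?_
    nlinarith [mul_nonneg ha hx, mul_nonneg ha (sub_nonneg.2 ha9), mul_nonneg hx (sub_nonneg.2 hx1), mul_nonneg (mul_nonneg ha (sub_nonneg.2 ha9)) hx, mul_nonneg (mul_nonneg ha (sub_nonneg.2 ha9)) ha, mul_nonneg (mul_nonneg hx (sub_nonneg.2 hx1)) ha, mul_nonneg (mul_nonneg ha hx) hx]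
  · push Not at ha9
    have l2 := L_lb L a x (5025/10000) (8645/10000) (13416/10000 + 8944/10000 * x) hL (by norm_num) (by positivity) (by nlinarith) ha h
    refine key (15025/10000 * a + 11598/10000 + 7732/10000 * x) (by nlinarith) (by nlinarith) ?_
    have ha9' := ha9.le
    nlinarith [mul_nonneg (sub_nonneg.2 ha9') hx, mul_nonneg (sub_nonneg.2 ha1) (sub_nonneg.2 ha9'), mul_nonneg hx (sub_nonneg.2 hx1), mul_nonneg (mul_nonneg (sub_nonneg.2 ha1) (sub_nonneg.2 ha9')) hx, mul_nonneg (mul_nonneg (sub_nonneg.2 ha1) (sub_nonneg.2 ha9')) ha, mul_nonneg (mul_nonneg hx (sub_nonneg.2 hx1)) ha, mul_nonneg (mul_nonneg (sub_nonneg.2 ha9') hx) hx,mul_nonneg (mul_nonneg hx (sub_nonneg.2 hx1)) (sub_nonneg.2 ha1), mul_nonneg (sub_nonneg.2 ha1) hx, mul_nonneg (sub_nonneg.2 ha1) (sub_nonneg.2 hx1)]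

set_option maxHeartbeats 2000000 in
/-- Lemma (A) -/
lemma lemA (L a x v q bh : ℝ) (hL : 0 < L) (ha : 0 ≤ a) (ha1 : a ≤ 13/10) (hx : 0 ≤ x) (hx1 : x ≤ 1)
    (hv : 0 ≤ v) (hv1 : v ≤ 1) (h : (1 + x) ^ 2 + 1 ≤ L ^ 2 - 2 * L * a)
    (hq : 0 ≤ q) (hq2 : L ^ 2 + 2 * L * a + x ^ 2 * v ≤ q ^ 2)
    (hb : 0 ≤ bh) (hb2 : bh ^ 2 = (L ^ 2 + 1) * (L ^ 2 + x ^ 2) / L ^ 2) :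
    (bh + a + 11/100 * v) ^ 2 ≤ q ^ 2 + q := by
  obtain ⟨e1, e2, e3⟩ := A_e L a x hL ha ha1 hx hx1 h
  have v1 := A_v1 L a x hL ha ha1 hx hx1 h
  set g := 1 + x ^ 2 + x ^ 2 / L ^ 2 with hg
  have hgg : g ≤ 1 + x/5 + x ^ 2 := by linarith
  have hg0 : 0 ≤ x ^ 2 / L ^ 2 := by positivity
  have hb3 : bh ^ 2 = L ^ 2 + g := by rw [hb2, hg]; field_simp; ring
  have hb4 : bh ≤ L + g / (2 * L) := by
    apply abs_le_of_sq_le_sq' _ (by positivity) |>.2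
    rw [hb3]
    have : (L + g / (2 * L)) ^ 2 = L ^ 2 + g + (g / (2 * L)) ^ 2 := by field_simp; ring
    rw [this]; nlinarith [sq_nonneg (g / (2 * L))]
  have hLa : a ≤ L := by nlinarith
  have hq4 : L + a - a ^ 2 / (2 * L) ≤ q := by
    apply abs_le_of_sq_le_sq' _ hq |>.2
    have : (L + a - a ^ 2 / (2 * L)) ^ 2 = L ^ 2 + 2 * L * a - a ^ 3 / L * (1 - a / (4 * L)) := by field_simp; ring
    rw [this]
    have : a / (4 * L) ≤ 1 := by rw [div_le_one (by positivity)]; linarith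
    have : 0 ≤ a ^ 3 / L * (1 - a / (4 * L)) := mul_nonneg (by positivity) (by linarith)
    have : 0 ≤ x ^ 2 * v := by positivity
    linarith
  -- endpoint inequalities, multiplied by L
  have hmain : (L - g) * (L + a) + x ^ 2 * v * L - a ^ 2 * (L + 1/2) - v * (11/100) * (2 * L ^ 2 + g + 2 * a * L + 11/100 * L) ≥ 0 := by
    have z0 : (L - g) * (L + a) - a ^ 2 * (L + 1/2) ≥ 0 := by
      have p1 : a ≤ L - g := by linarith
      have p2 : a ^ 2 ≤ L - g := by linarith
      nlinarith
    have z1 : (L - g) * (L + a) + x ^ 2 * L - a ^ 2 * (L + 1/2) - (11/100) * (2 * L ^ 2 + g + 2 * a * L + 11/100 * L) ≥ 0 := by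
      have h5 := mul_nonneg (sub_nonneg.2 hgg) (show 0 ≤ L + a + 11/100 by positivity)
      clear_value g
      linarith
    have z2 := mul_nonneg hv z1
    have z3 := mul_nonneg (sub_nonneg.2 hv1) z0
    clear_value g
    linarith
  have hfin : 2 * L * a + x ^ 2 * v + (L + a - a ^ 2 / (2 * L)) - g ≥ 2 * (L + g / (2 * L)) * (a + 11/100 * v) + (a + 11/100 * v) ^ 2 := by
    have hid : L * (2 * L * a + x ^ 2 * v + (L + a - a ^ 2 / (2 * L)) - g - (2 * (L + g / (2 * L)) * (a + 11/100 * v) + (a ^ 2 + 2 * a * (11/100 * v) + (11/100) ^ 2 * v))) =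
      (L - g) * (L + a) + x ^ 2 * v * L - a ^ 2 * (L + 1/2) - v * (11/100) * (2 * L ^ 2 + g + 2 * a * L + 11/100 * L) := by
      field_simp; ring
    rw [← hid] at hmain
    have := nonneg_of_mul_nonneg_right hmain hL
    nlinarith
  have hav : 0 ≤ a + 11/100 * v := by positivity
  nlinarith [mul_le_mul_of_nonneg_right hb4 hav]


lemma inv_sqrt_le (z : ℝ) (h0 : 0 ≤ z) (h1 : z < 1) :
    (Real.sqrt (1 - z))⁻¹ ≤ Real.exp (z / 2 + z ^ 2 / (4 * (1 - z))) := by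
  have hz : 0 < 1 - z := by linarith
  set w := (1 - z)⁻¹ with hw
  have hwpos : 0 < w := by positivity
  have hw1 : 1 ≤ w := by rw [hw]; exact (one_le_inv₀ hz).2 (by linarith)
  have hl : 0 ≤ Real.log w := Real.log_nonneg hw1
  have hs := Real.self_le_sinh_iff.2 hl
  rw [Real.sinh_eq, Real.exp_neg, Real.exp_log hwpos] at hs
  have e : (Real.sqrt (1 - z))⁻¹ = Real.exp (Real.log w / 2) := by
    rw [Real.exp_half, Real.exp_log hwpos, hw, Real.sqrt_inv]
  rw [e]
  apply Real.exp_le_exp.2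
  have : (w - w⁻¹) / 2 = 2 * (z / 2 + z ^ 2 / (4 * (1 - z))) := by
    rw [hw]; field_simp; ring
  linarith

lemma claim_w (w x : ℝ) (hx : 0 ≤ x) (hx1 : x ≤ 1) (hw : (1 + x) ^ 2 + 1 ≤ w) :
    (w + x ^ 2) ^ 2 + x ^ 2 * (w + 1) ^ 2 ≤ 42/100 * (w * (w + 1) * (w + x ^ 2)) := by
  obtain ⟨d, hd, rfl⟩ : ∃ d, 0 ≤ d ∧ w = (1 + x) ^ 2 + 1 + d := ⟨w - ((1 + x) ^ 2 + 1), by linarith, by ring⟩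
  have a : ∀ k, 0 ≤ x ^ k := fun k => pow_nonneg hx k
  have b : ∀ k, 0 ≤ x ^ k * d := fun k => mul_nonneg (a k) hd
  have c : ∀ k, 0 ≤ x ^ k * d ^ 2 := fun k => mul_nonneg (a k) (by positivity)
  have e : ∀ k, 0 ≤ x ^ k * (1 - x) := fun k => mul_nonneg (a k) (by linarith)
  have f : ∀ k, 0 ≤ x ^ k * (1 - x) * d := fun k => mul_nonneg (e k) hd
  have g : 0 ≤ d ^ 3 := by positivity
  nlinarith [a 1, a 2, a 3, a 4, a 5, a 6, b 0, b 1, b 2, b 3, b 4, c 0, c 1, c 2, e 0, e 1, e 2, e 3, e 4, e 5, f 0, f 1, f 2, f 3, mul_nonneg (a 1) (sq_nonneg (1-x)), mul_nonneg (a 2) (sq_nonneg (1-x)), mul_nonneg (a 3) (sq_nonneg (1-x)), sq_nonneg (1-x), sq_nonneg (1 - 2 * x), sq_nonneg (x*(1-2*x))]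


lemma S_lb (r y K s v Q b : ℝ) (hy : 0 < y) (hr : 0 ≤ r) (hry : r ≤ y) (hK : 0 < K)
    (hs : 0 ≤ s) (hsy : s ≤ 13/10 * y) (hv : 0 ≤ v) (hv1 : v ≤ 1)
    (h : (y + r) ^ 2 + y ^ 2 ≤ K ^ 2 - 2 * K * s) (hQ : 0 ≤ Q)
    (hQ2 : K ^ 2 + 2 * K * s + r ^ 2 * v ≤ Q ^ 2)
    (hb : 0 ≤ b) (hb2 : b ^ 2 * K ^ 2 = (K ^ 2 + y ^ 2) * (K ^ 2 + r ^ 2)) :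
    b + s + 11/100 * v * y ≤ Real.sqrt (Q ^ 2 + Q * y) := by
  have hy2 : 0 < y ^ 2 := by positivity
  have key := lemA (K / y) (s / y) (r / y) v (Q / y) (b / y) (by positivity) (by positivity)
    (by rw [div_le_iff₀ hy]; exact hsy) (by positivity) (by rw [div_le_one hy]; exact hry) hv hv1
    (by
      have e1 : (1 + r / y) ^ 2 + 1 = ((y + r) ^ 2 + y ^ 2) / y ^ 2 := by field_simp
      have e2 : (K / y) ^ 2 - 2 * (K / y) * (s / y) = (K ^ 2 - 2 * K * s) / y ^ 2 := by field_simp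
      rw [e1, e2]; gcongr)
    (by positivity)
    (by
      have e1 : (K / y) ^ 2 + 2 * (K / y) * (s / y) + (r / y) ^ 2 * v = (K ^ 2 + 2 * K * s + r ^ 2 * v) / y ^ 2 := by field_simp
      rw [e1, div_pow]; gcongr)
    (by positivity)
    (by
      have : (b / y) ^ 2 = (b ^ 2 * K ^ 2) / (y ^ 2 * K ^ 2) := by field_simp
      rw [this, hb2]; field_simp)
  apply Real.le_sqrt_of_sq_le
  have e1 : (b + s + 11/100 * v * y) ^ 2 = y ^ 2 * (b / y + s / y + 11/100 * v) ^ 2 := by field_simp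
  have e2 : Q ^ 2 + Q * y = y ^ 2 * ((Q / y) ^ 2 + Q / y) := by field_simp
  rw [e1, e2]; gcongr

lemma M1_pos (θ : ℝ) (hθ : 0 ≤ θ) : 0 < M1 θ := by
  have := gP_nonneg θ hθ
  unfold M1; positivity

lemma M2_pos (θ z : ℝ) (hθ : 0 ≤ θ) : 0 < M2 θ z := by
  have := gP_nonneg θ hθ
  unfold M2; positivity

lemma M2_mono (θ z w : ℝ) (h : z ≤ w) (hw : w < 1) : M2 θ z ≤ M2 θ w := by
  unfold M2
  have h1 : 0 < Real.sqrt (1 - w) := Real.sqrt_pos.2 (by linarith)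
  have : (Real.sqrt (1 - z))⁻¹ ≤ (Real.sqrt (1 - w))⁻¹ := by
    apply inv_anti₀ h1
    exact Real.sqrt_le_sqrt (by linarith)
  linarith

set_option maxHeartbeats 3000000 in
lemma tailR (N m : ℕ) (hm : 1 ≤ m) (hNm : N ≤ m) (K s v θ z Q y : ℝ) (hyd : y = Real.sqrt m)
    (hK : 0 < K) (hs : 0 ≤ s) (hsy : s ≤ 13/10 * y) (hv : 0 ≤ v) (hv1 : v ≤ 1)
    (h : (y + Real.sqrt N) ^ 2 + y ^ 2 ≤ K ^ 2 - 2 * K * s) (hQ : 0 ≤ Q)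
    (hQ2 : K ^ 2 + 2 * K * s + N * v ≤ Q ^ 2) (hθ : 0 < θ) (hz : 12248/10000 * θ / K ≤ z) (hz1 : z < 1) :
    ∃ τ : ℝ, 0 < τ ∧ θ / (K * τ) < 1 ∧ θ * τ / K < 1 ∧
    Real.exp (-θ * Real.sqrt (Q ^ 2 + Q * y) - θ ^ 2 / 2 + θ * (K * τ / 2 + K / (2 * τ))) *
      ((M2 θ (θ * τ / K) * (Real.sqrt (1 - θ * τ / K))⁻¹ ^ N) * (M1 θ * (Real.sqrt (1 - θ / (K * τ)))⁻¹ ^ m))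
    ≤ Real.exp (-θ * (s + 11/100 * v * y) - θ ^ 2 / 2 + 105/1000 * θ ^ 2 / (1 - z)) * (M1 θ * M2 θ z) := by
  have hm0 : (0:ℝ) < m := by exact_mod_cast hm
  have hy : 0 < y := by rw [hyd]; exact Real.sqrt_pos.2 hm0
  have hy2 : y ^ 2 = m := by rw [hyd]; exact Real.sq_sqrt hm0.le
  set r := Real.sqrt N with hr
  have hr0 : 0 ≤ r := Real.sqrt_nonneg _
  have hr2 : r ^ 2 = N := Real.sq_sqrt (by positivity)
  have hry : r ≤ y := by rw [hyd, hr]; exact Real.sqrt_le_sqrt (by exact_mod_cast hNm)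
  have hKs : 0 ≤ K * s := by positivity
  have hK2 : 2 * y ^ 2 ≤ K ^ 2 := by nlinarith
  set A := Real.sqrt (K ^ 2 + y ^ 2) with hA
  set B := Real.sqrt (K ^ 2 + r ^ 2) with hB
  have hA0 : 0 < A := Real.sqrt_pos.2 (by positivity)
  have hB0 : 0 < B := Real.sqrt_pos.2 (by positivity)
  have hA2 : A ^ 2 = K ^ 2 + y ^ 2 := Real.sq_sqrt (by positivity)
  have hB2 : B ^ 2 = K ^ 2 + r ^ 2 := Real.sq_sqrt (by positivity)
  have hBA : B ≤ A := Real.sqrt_le_sqrt (by nlinarith)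
  have hAB : A ≤ 12248/10000 * B := by
    apply abs_le_of_sq_le_sq' _ (by positivity) |>.2
    nlinarith
  have hS := S_lb r y K s v Q (A * B / K) hy hr0 hry hK hs hsy hv hv1 h hQ (by rw [hr2]; exact hQ2) (by positivity)
    (by rw [← hA2, ← hB2]; field_simp)
  set t := Real.sqrt (Q ^ 2 + Q * y)
  have hτ0 : 0 < A / B := by positivity
  have hτ1 : 1 ≤ A / B := (one_le_div hB0).2 hBA
  have hτ2 : A / B ≤ 12248/10000 := (div_le_iff₀ hB0).2 hAB
  have hθK : 0 < θ / K := by positivity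
  have hz1' : θ / (K * (A / B)) ≤ z := by
    refine le_trans ?_ hz
    have : θ / (K * (A / B)) ≤ θ / K := by
      apply div_le_div_of_nonneg_left hθ.le hK; nlinarith
    have : 12248/10000 * θ / K = 12248/10000 * (θ / K) := by ring
    linarith
  have hz2' : θ * (A / B) / K ≤ z := by
    refine le_trans ?_ hz
    apply div_le_div_of_nonneg_right _ hK.le
    nlinarith
  refine ⟨A / B, hτ0, by linarith, by linarith, ?_⟩
  set z1 := θ / (K * (A / B)) with hz1d
  set z2 := θ * (A / B) / K with hz2d
  have hz10 : 0 ≤ z1 := by positivity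
  have hz20 : 0 ≤ z2 := by positivity
  have hzz : 0 < 1 - z := by linarith
  have p1 : (Real.sqrt (1 - z1))⁻¹ ^ m ≤ Real.exp (m * (z1 / 2 + z1 ^ 2 / (4 * (1 - z)))) := by
    rw [Real.exp_nat_mul]
    apply pow_le_pow_left₀ (by positivity)
    refine (inv_sqrt_le z1 hz10 (by linarith)).trans (Real.exp_le_exp.2 ?_)
    gcongr
  have p2 : (Real.sqrt (1 - z2))⁻¹ ^ N ≤ Real.exp (N * (z2 / 2 + z2 ^ 2 / (4 * (1 - z)))) := by
    rw [Real.exp_nat_mul]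
    apply pow_le_pow_left₀ (by positivity)
    refine (inv_sqrt_le z2 hz20 (by linarith)).trans (Real.exp_le_exp.2 ?_)
    gcongr
  have hM1 := M1_pos θ hθ.le
  have hM2 := M2_pos θ z2 hθ.le
  have hM2' := M2_mono θ z2 z hz2' hz1
  -- the quadratic sum
  have hquad : m * z1 ^ 2 + N * z2 ^ 2 ≤ 42/100 * θ ^ 2 := by
    have c := claim_w (K ^ 2 / y ^ 2) (r / y) (by positivity) ((div_le_one hy).2 hry)
      (by
        have e1 : (1 + r / y) ^ 2 + 1 = ((y + r) ^ 2 + y ^ 2) / y ^ 2 := by field_simp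
        rw [e1]; gcongr; linarith)
    have c2 : (K ^ 2 + r ^ 2) ^ 2 * y ^ 2 + r ^ 2 * (K ^ 2 + y ^ 2) ^ 2 ≤ 42/100 * (K ^ 2 * (K ^ 2 + y ^ 2) * (K ^ 2 + r ^ 2)) := by
      have e1 : (K ^ 2 + r ^ 2) ^ 2 * y ^ 2 + r ^ 2 * (K ^ 2 + y ^ 2) ^ 2 = y ^ 6 * ((K ^ 2 / y ^ 2 + (r / y) ^ 2) ^ 2 + (r / y) ^ 2 * (K ^ 2 / y ^ 2 + 1) ^ 2) := by
        field_simp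
      have e2 : 42/100 * (K ^ 2 * (K ^ 2 + y ^ 2) * (K ^ 2 + r ^ 2)) = y ^ 6 * (42/100 * (K ^ 2 / y ^ 2 * (K ^ 2 / y ^ 2 + 1) * (K ^ 2 / y ^ 2 + (r / y) ^ 2))) := by
        field_simp
      rw [e1, e2]; gcongr
    rw [← hA2, ← hB2] at c2
    rw [← hy2, ← hr2]
    have e : y ^ 2 * z1 ^ 2 + r ^ 2 * z2 ^ 2 = θ ^ 2 * (((B ^ 2) ^ 2 * y ^ 2 + r ^ 2 * (A ^ 2) ^ 2) / (K ^ 2 * A ^ 2 * B ^ 2)) := by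
      rw [hz1d, hz2d]; field_simp
    rw [e]
    have : ((B ^ 2) ^ 2 * y ^ 2 + r ^ 2 * (A ^ 2) ^ 2) / (K ^ 2 * A ^ 2 * B ^ 2) ≤ 42/100 := by
      rw [div_le_iff₀ (by positivity)]; linarith
    nlinarith [sq_nonneg θ]
  have hlin : θ * (K * (A / B) / 2 + K / (2 * (A / B))) + m * (z1 / 2) + N * (z2 / 2) = θ * (A * B / K) := by
    rw [← hy2, ← hr2]
    have e1 : y ^ 2 = A ^ 2 - K ^ 2 := by linarith
    have e2 : r ^ 2 = B ^ 2 - K ^ 2 := by linarith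
    rw [e1, e2, hz1d, hz2d]; field_simp; ring
  calc _ ≤ Real.exp (-θ * t - θ ^ 2 / 2 + θ * (K * (A / B) / 2 + K / (2 * (A / B)))) *
      ((M2 θ z * Real.exp (N * (z2 / 2 + z2 ^ 2 / (4 * (1 - z))))) * (M1 θ * Real.exp (m * (z1 / 2 + z1 ^ 2 / (4 * (1 - z)))))) := by
        have hM3 := M2_pos θ z hθ.le
        gcongr
    _ = Real.exp (-θ * t - θ ^ 2 / 2 + θ * (K * (A / B) / 2 + K / (2 * (A / B))) + N * (z2 / 2 + z2 ^ 2 / (4 * (1 - z))) + m * (z1 / 2 + z1 ^ 2 / (4 * (1 - z)))) * (M1 θ * M2 θ z) := by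
        rw [Real.exp_add (_ + _), Real.exp_add (_ + _) (N * _)]; ring
    _ ≤ _ := by
        have hM3 := M2_pos θ z hθ.le
        refine mul_le_mul_of_nonneg_right (Real.exp_le_exp.2 ?_) (by positivity)
        have q1 : (N * (z2 ^ 2 / (4 * (1 - z))) + m * (z1 ^ 2 / (4 * (1 - z)))) ≤ 105/1000 * θ ^ 2 / (1 - z) := by
          have : (N * (z2 ^ 2 / (4 * (1 - z))) + m * (z1 ^ 2 / (4 * (1 - z)))) = ((m * z1 ^ 2 + N * z2 ^ 2) / 4) / (1 - z) := by field_simp; ring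
          rw [this]; gcongr; linarith
        have q2 := mul_le_mul_of_nonneg_left hS hθ.le
        linarith


lemma signal_scaled (n : ℕ) (hn : 1 ≤ n) (m σ κ s₁ K : ℝ) (hm : 0 ≤ m) (hσ : 0 < σ)
    (hK : K = κ * Real.sqrt n / σ)
    (hsignal : σ ^ 2 * ((1 + Real.sqrt (m / n)) ^ 2 + m / n)
        < κ ^ 2 - 2 * σ * s₁ * κ / Real.sqrt n) :
    (Real.sqrt m + Real.sqrt n) ^ 2 + m < K ^ 2 - 2 * K * s₁ := by
  have hn0 : (0:ℝ) < n := by exact_mod_cast hn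
  have hr : 0 < Real.sqrt n := Real.sqrt_pos.2 hn0
  have hr2 : Real.sqrt n ^ 2 = n := Real.sq_sqrt hn0.le
  rw [Real.sqrt_div hm] at hsignal
  set r := Real.sqrt n
  rw [← hr2] at hsignal
  have e1 : (Real.sqrt m + r) ^ 2 + m = r ^ 2 / σ ^ 2 * (σ ^ 2 * ((1 + Real.sqrt m / r) ^ 2 + m / r ^ 2)) := by
    field_simp; ring
  have e2 : K ^ 2 - 2 * K * s₁ = r ^ 2 / σ ^ 2 * (κ ^ 2 - 2 * σ * s₁ * κ / r) := by
    rw [hK]; field_simp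
  rw [e1, e2]
  gcongr

lemma Bd_lb (n : ℕ) (hn : 1 ≤ n) (m σ κ s₁ s₂ s₃ K Q : ℝ) (hm : 0 ≤ m) (hσ : 0 < σ) (hκ : 0 < κ)
    (hs₁ : 0 < s₁) (hs₂ : 0 < s₂) (hs₃ : 0 < s₃)
    (hK : K = κ * Real.sqrt n / σ) (hQ : Q = Real.sqrt (K ^ 2 + 2 * K * s₁ + n * s₃)) :
    (Real.sqrt (Q ^ 2 + Q * Real.sqrt m)) ^ 2 * σ ^ 2 / n ≤
      κ ^ 2 * (1 + 2 * σ * s₁ / (κ * Real.sqrt n) + σ ^ 2 * s₃ / κ ^ 2)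
            + σ * κ * Real.sqrt (m / n) *
              Real.sqrt (1 + 2 * σ * s₁ / (κ * Real.sqrt n) + σ ^ 2 * s₃ / κ ^ 2) *
              (1 + s₂ / Real.sqrt m) := by
  have hn0 : (0:ℝ) < n := by exact_mod_cast hn
  have hr : 0 < Real.sqrt n := Real.sqrt_pos.2 hn0
  have hr2 : Real.sqrt n ^ 2 = n := Real.sq_sqrt hn0.le
  have hK0 : 0 < K := by rw [hK]; positivity
  have hQ0 : 0 ≤ Q := by rw [hQ]; positivity
  have hQ2 : Q ^ 2 = K ^ 2 + 2 * K * s₁ + n * s₃ := by rw [hQ]; exact Real.sq_sqrt (by positivity)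
  rw [Real.sq_sqrt (by positivity), Real.sqrt_div hm]
  set r := Real.sqrt n
  rw [← hr2] at hQ2
  rw [← hr2]
  have e : 1 + 2 * σ * s₁ / (κ * r) + σ ^ 2 * s₃ / κ ^ 2 = (σ * Q / (κ * r)) ^ 2 := by
    rw [div_pow, mul_pow σ Q, hQ2, hK]; field_simp
  rw [e, Real.sqrt_sq (by positivity)]
  have e2 : κ ^ 2 * (σ * Q / (κ * r)) ^ 2 + σ * κ * (Real.sqrt m / r) * (σ * Q / (κ * r)) * (1 + s₂ / Real.sqrt m) =
    (Q ^ 2 + Q * Real.sqrt m) * σ ^ 2 / r ^ 2 + σ * κ * (Real.sqrt m / r) * (σ * Q / (κ * r)) * (s₂ / Real.sqrt m) := by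
    generalize s₂ / Real.sqrt m = w
    field_simp; ring
  rw [e2]
  have : 0 ≤ σ * κ * (Real.sqrt m / r) * (σ * Q / (κ * r)) * (s₂ / Real.sqrt m) := by positivity
  linarith

theorem tail3 (n p : ℕ) (hn : 1 ≤ n) (hp : 2 ≤ p) (hnp : n ≤ p)
    (σ V : ℝ) (hσ : 0 < σ) (hV : 0 < V)
    (u : Fin n → ℝ)
    (su : ℝ) (hsu : su = Real.sqrt ((n : ℝ)⁻¹ * ∑ ν, (u ν) ^ 2)) (hsupos : 0 < su)
    (κ : ℝ) (hκ : κ = V * su)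
    (s₁ s₂ s₃ : ℝ) (hs₁ : 0 < s₁) (hs₂ : 0 < s₂) (hs₃ : 0 < s₃)
    (hsignal : σ ^ 2 * ((1 + Real.sqrt (((p : ℝ) - 1) / n)) ^ 2 + ((p : ℝ) - 1) / n)
        < κ ^ 2 - 2 * σ * s₁ * κ / Real.sqrt n) (K y : ℝ) (hKd : K = κ * Real.sqrt n / σ)
    (hyd : y = Real.sqrt ((p : ℝ) - 1))
    (s v θ z : ℝ) (hs : 0 ≤ s) (hss : s ≤ s₁) (hsy : s ≤ 13/10 * y) (hv : 0 ≤ v) (hv1 : v ≤ 1) (hvs : v ≤ s₃)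
    (hθ : 0 < θ) (hz : 12248/10000 * θ / K ≤ z) (hz1 : z < 1) :
      (Measure.pi fun _ : Fin n => Measure.pi fun _ : Fin p => (gaussianReal 0 1 : Measure ℝ))
        {ξ : Fin n → Fin p → ℝ |
          κ ^ 2 * (1 + 2 * σ * s₁ / (κ * Real.sqrt n) + σ ^ 2 * s₃ / κ ^ 2)
            + σ * κ * Real.sqrt (((p : ℝ) - 1) / n) *
              Real.sqrt (1 + 2 * σ * s₁ / (κ * Real.sqrt n) + σ ^ 2 * s₃ / κ ^ 2) *
              (1 + s₂ / Real.sqrt ((p : ℝ) - 1)) < maxEig (sampleCov n p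
              (fun ν i => u ν * (if (i : ℕ) = 0 then V else 0) + σ * ξ ν i))} ≤
      ENNReal.ofReal (Real.exp (-θ * (s + 11/100 * v * y) - θ ^ 2 / 2 + 105/1000 * θ ^ 2 / (1 - z)) * (M1 θ * M2 θ z)) := by
  have hn0 : (0:ℝ) < n := by exact_mod_cast hn
  have hκ0 : 0 < κ := by rw [hκ]; positivity
  have hr : 0 < Real.sqrt n := Real.sqrt_pos.2 hn0
  have hK0 : 0 < K := by rw [hKd]; positivity
  have hpm : ((p - 1 : ℕ) : ℝ) = (p:ℝ) - 1 := by rw [Nat.cast_sub (by omega)]; simp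
  have hm0 : (0:ℝ) ≤ (p:ℝ) - 1 := by rw [← hpm]; positivity
  have hnm : ((n - 1 : ℕ) : ℝ) = (n:ℝ) - 1 := by rw [Nat.cast_sub hn]; simp
  set Q := Real.sqrt (K ^ 2 + 2 * K * s₁ + n * s₃) with hQ
  have hQ2 : Q ^ 2 = K ^ 2 + 2 * K * s₁ + n * s₃ := Real.sq_sqrt (by positivity)
  have hsig := signal_scaled n hn _ σ κ s₁ K hm0 hσ hKd hsignal
  rw [← hyd] at hsig
  have hy0 : 0 ≤ y := by rw [hyd]; positivity
  have hy2 : y ^ 2 = (p:ℝ) - 1 := by rw [hyd]; exact Real.sq_sqrt hm0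
  have hKs : K * s ≤ K * s₁ := by gcongr
  obtain ⟨τ, hτ, h1, h2, h3⟩ := tailR (n - 1) (p - 1) (by omega) (by omega) K s v θ z Q y (by rw [hpm, hyd]) hK0 hs hsy hv hv1
    (by
      have : (y + Real.sqrt ((n - 1 : ℕ) : ℝ)) ^ 2 ≤ (y + Real.sqrt n) ^ 2 := by
        gcongr; omega
      linarith) (Real.sqrt_nonneg _)
    (by
      have : ((n - 1 : ℕ) : ℝ) * v ≤ n * s₃ := by
        gcongr; omega
      linarith) hθ hz hz1
  refine (tail2 n p hn (by omega) σ V su hσ hV u hsu hsupos K τ θ (Real.sqrt (Q ^ 2 + Q * y)) (by rw [hKd, hκ]) hτ hθ (Real.sqrt_nonneg _) h1 h2 _ ?_).trans (ENNReal.ofReal_le_ofReal h3)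
  rw [hyd]
  exact Bd_lb n hn _ σ κ s₁ s₂ s₃ K Q hm0 hσ hκ0 hs₁ hs₂ hs₃ hKd hQ


lemma exp_lb (x : ℝ) (hx : 0 ≤ x) (n : ℕ) : ∑ i ∈ Finset.range n, x ^ i / (i.factorial : ℝ) ≤ Real.exp x :=
  Real.sum_le_exp_of_nonneg hx n

lemma exp_neg_le_of (x c S : ℝ) (hx : 0 ≤ x) (n : ℕ) (hS : ∑ i ∈ Finset.range n, x ^ i / (i.factorial : ℝ) = S)
    (hc : 1 ≤ c * S) (hc0 : 0 < c) : Real.exp (-x) ≤ c := by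
  have h := exp_lb x hx n
  rw [hS] at h
  rw [Real.exp_neg, inv_le_comm₀ (Real.exp_pos x) hc0]
  refine le_trans ?_ h
  rw [inv_le_iff_one_le_mul₀ hc0]; linarith

lemma sqrt2pi : 25066/10000 ≤ Real.sqrt (2 * Real.pi) ∧ Real.sqrt (2 * Real.pi) ≤ 25067/10000 := by
  have h1 := Real.pi_gt_d6
  have h2 := Real.pi_lt_d6
  constructor
  · apply Real.le_sqrt_of_sq_le; nlinarith
  · apply Real.sqrt_le_iff.2; constructor <;> nlinarith

lemma exp_neg_quad (u : ℝ) (hu : 0 ≤ u) : Real.exp (-u) ≤ 1 - u + u ^ 2 / 2 := by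
  have h := Real.quadratic_le_exp_of_nonneg hu
  have h0 : 0 < 1 - u + u ^ 2 / 2 := by nlinarith [sq_nonneg (u - 1)]
  rw [Real.exp_neg, inv_le_comm₀ (Real.exp_pos u) h0]
  refine le_trans ?_ h
  rw [inv_le_iff_one_le_mul₀ h0]
  nlinarith [sq_nonneg (u ^ 2)]

lemma gP_series (s : ℝ) (hs : 0 ≤ s) : gP s ≤ 10000/12533 * (s - s ^ 3 / 6 + s ^ 5 / 40) := by
  have hmono : MonotoneOn (fun x => 10000/12533 * (x - x ^ 3 / 6 + x ^ 5 / 40) - gP x) (Set.Ici 0) := by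
    have hd : ∀ x : ℝ, HasDerivAt (fun x => 10000/12533 * (x - x ^ 3 / 6 + x ^ 5 / 40) - gP x)
        (10000/12533 * (1 - x ^ 2 / 2 + x ^ 4 / 8) - 2 * gaussianPDFReal 0 1 x) x := by
      intro x
      have h1 := (((hasDerivAt_id x).sub ((hasDerivAt_pow 3 x).div_const 6)).add ((hasDerivAt_pow 5 x).div_const 40)).const_mul (10000/12533 : ℝ)
      convert! h1.sub (gP_deriv x) using 1
      simp; ring
    apply monotoneOn_of_deriv_nonneg (convex_Ici 0)
    · exact fun x _ => (hd x).continuousAt.continuousWithinAt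
    · exact fun x _ => (hd x).differentiableAt.differentiableWithinAt
    · intro x hx
      rw [(hd x).deriv, gpdf_eq]
      have e := exp_neg_quad (x ^ 2 / 2) (by positivity)
      rw [show -(x ^ 2 / 2) = -x ^ 2 / 2 by ring] at e
      have hi : (Real.sqrt (2 * Real.pi))⁻¹ ≤ 10000/25066 := by
        rw [inv_le_comm₀ (by have := sqrt2pi.1; linarith) (by norm_num)]
        refine le_trans (by norm_num) sqrt2pi.1
      have e0 := Real.exp_pos (-x ^ 2 / 2)
      have : (Real.sqrt (2 * Real.pi))⁻¹ * Real.exp (-x ^ 2 / 2) ≤ 10000/25066 * (1 - x ^ 2 / 2 + (x ^ 2 / 2) ^ 2 / 2) := by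
        gcongr
      nlinarith
  have := hmono (Set.mem_Ici.2 le_rfl) (Set.mem_Ici.2 hs) hs
  simp [gP_zero] at this
  linarith

lemma gP_one : gP 1 ≤ 6849/10000 := by
  have := gP_series 1 (by norm_num); norm_num at this; linarith

lemma gpdf_anti (x y : ℝ) (hx : 0 ≤ x) (hxy : x ≤ y) : gaussianPDFReal 0 1 y ≤ gaussianPDFReal 0 1 x := by
  rw [gpdf_eq, gpdf_eq]
  gcongr

lemma gP_lin (s : ℝ) (hs : 0 ≤ s) : 12533/10000 * gP s ≤ s := by
  have hmono : MonotoneOn (fun x => 10000/12533 * x - gP x) (Set.Ici 0) := by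
    have hd : ∀ x : ℝ, HasDerivAt (fun x => 10000/12533 * x - gP x)
        (10000/12533  - 2 * gaussianPDFReal 0 1 x) x := by
      intro x
      have h1 := (hasDerivAt_id x).const_mul (10000/12533 : ℝ)
      convert! h1.sub (gP_deriv x) using 1
      simp
    apply monotoneOn_of_deriv_nonneg (convex_Ici 0)
    · exact fun x _ => (hd x).continuousAt.continuousWithinAt
    · exact fun x _ => (hd x).differentiableAt.differentiableWithinAt
    · intro x hx
      simp at hx
      rw [(hd x).deriv]
      have h0 := gpdf_anti 0 x le_rfl hx.le
      have hi : gaussianPDFReal 0 1 0 ≤ 10000/25066 := by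
        rw [gpdf_eq]; simp only [ne_eq, OfNat.ofNat_ne_zero, not_false_eq_true, zero_pow, neg_zero, zero_div, Real.exp_zero, mul_one]
        rw [inv_le_comm₀ (by have := sqrt2pi.1; linarith) (by norm_num)]
        refine le_trans (by norm_num) sqrt2pi.1
      linarith
  have := hmono (Set.mem_Ici.2 le_rfl) (Set.mem_Ici.2 hs) hs
  simp [gP_zero] at this
  linarith

lemma gpdf_one : 4839/10000 ≤ 2 * gaussianPDFReal 0 1 1 ∧ 2 * gaussianPDFReal 0 1 1 ≤ 484/1000 := by
  rw [gpdf_eq]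
  have h1 : Real.exp (-1 ^ 2 / 2) ≤ 60654/100000 := by
    have := exp_neg_le_of (1/2) (60654/100000) _ (by norm_num) 8 rfl (by norm_num [Finset.sum_range_succ, Nat.factorial]) (by norm_num)
    convert this using 2; norm_num
  have h2 : 60652/100000 ≤ Real.exp (-1 ^ 2 / 2) := by
    have := Real.exp_one_lt_d9
    have e : Real.exp (-1 ^ 2 / 2) ^ 2 * Real.exp 1 = 1 := by
      rw [← Real.exp_nat_mul, ← Real.exp_add]; norm_num
    have := Real.exp_pos (-1 ^ 2 / 2)
    by_contra! hh
    nlinarith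
  have hs := sqrt2pi
  have hp : 0 < Real.sqrt (2 * Real.pi) := by linarith [hs.1]
  constructor
  · rw [inv_mul_eq_div, ← mul_div_assoc, le_div_iff₀ hp]; nlinarith
  · rw [inv_mul_eq_div, ← mul_div_assoc, div_le_iff₀ hp]; nlinarith

lemma gP_tan (s : ℝ) (hs : 0 ≤ s) : gP s ≤ 201/1000 + 484/1000 * s := by
  have hg1 := gP_one
  have hp := gpdf_one
  by_cases h : s ≤ 1
  · have hmono : AntitoneOn (fun x => 4839/10000 * x - gP x) (Set.Icc 0 1) := by
      have hd : ∀ x : ℝ, HasDerivAt (fun x => 4839/10000 * x - gP x)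
          (4839/10000  - 2 * gaussianPDFReal 0 1 x) x := by
        intro x
        have h1 := (hasDerivAt_id x).const_mul (4839/10000 : ℝ)
        convert! h1.sub (gP_deriv x) using 1
        simp
      apply antitoneOn_of_deriv_nonpos (convex_Icc 0 1)
      · exact fun x _ => (hd x).continuousAt.continuousWithinAt
      · exact fun x _ => (hd x).differentiableAt.differentiableWithinAt
      · intro x hx
        simp at hx
        rw [(hd x).deriv]
        have h0 := gpdf_anti x 1 hx.1.le hx.2.le
        linarith
    have := hmono ⟨hs, h⟩ ⟨zero_le_one, le_rfl⟩ h
    simp only at this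
    linarith
  · push Not at h
    have hmono : MonotoneOn (fun x => 484/1000 * x - gP x) (Set.Ici 1) := by
      have hd : ∀ x : ℝ, HasDerivAt (fun x => 484/1000 * x - gP x)
          (484/1000  - 2 * gaussianPDFReal 0 1 x) x := by
        intro x
        have h1 := (hasDerivAt_id x).const_mul (484/1000 : ℝ)
        convert! h1.sub (gP_deriv x) using 1
        simp
      apply monotoneOn_of_deriv_nonneg (convex_Ici 1)
      · exact fun x _ => (hd x).continuousAt.continuousWithinAt
      · exact fun x _ => (hd x).differentiableAt.differentiableWithinAt
      · intro x hx
        simp at hx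
        rw [(hd x).deriv]
        have h0 := gpdf_anti 1 x (by norm_num) hx.le
        linarith
    have := hmono (Set.mem_Ici.2 le_rfl) (Set.mem_Ici.2 h.le) h.le
    simp only at this
    linarith

lemma gpdf_le_one (x : ℝ) : 2 * gaussianPDFReal 0 1 x ≤ 1 := by
  rw [gpdf_eq]
  have h1 : Real.exp (-x ^ 2 / 2) ≤ 1 := Real.exp_le_one_iff.2 (by nlinarith [sq_nonneg x])
  have hs := sqrt2pi
  have hp : 0 < Real.sqrt (2 * Real.pi) := by linarith [hs.1]
  rw [inv_mul_eq_div, ← mul_div_assoc, div_le_iff₀ hp]; nlinarith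

lemma gP_mills (s : ℝ) (hs : 0 < s) : gP s ≤ 1 - 2 * gaussianPDFReal 0 1 s * (s / (1 + s ^ 2)) := by
  have hmono : Monotone (fun x => gP x + 2 * gaussianPDFReal 0 1 x * (x / (1 + x ^ 2))) := by
    have hd : ∀ x : ℝ, HasDerivAt (fun x => gP x + 2 * gaussianPDFReal 0 1 x * (x / (1 + x ^ 2)))
        (4 * gaussianPDFReal 0 1 x / (1 + x ^ 2) ^ 2) x := by
      intro x
      have hx : 1 + x ^ 2 ≠ 0 := by positivity
      have h2 : HasDerivAt (fun x : ℝ => x / (1 + x ^ 2)) ((1 * (1 + x ^ 2) - x * (2 * x)) / (1 + x ^ 2) ^ 2) x := by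
        have := (hasDerivAt_id x).div ((hasDerivAt_pow 2 x).const_add 1) hx
        convert! this using 1
        simp
      have h3 := (gP_deriv x).add (((gpdf_hasDerivAt x).const_mul 2).mul h2)
      convert! h3 using 1
      field_simp
      ring
    apply monotone_of_deriv_nonneg (fun x => (hd x).differentiableAt)
    intro x
    rw [(hd x).deriv]
    have := gpdf_pos x
    positivity
  suffices h : gP s + 2 * gaussianPDFReal 0 1 s * (s / (1 + s ^ 2)) ≤ 1 by linarith
  apply le_of_forall_pos_le_add
  intro e he
  have ht : 0 < max s e⁻¹ := lt_max_of_lt_left hs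
  set t := max s e⁻¹
  have h1 := hmono (le_max_left s e⁻¹)
  simp only at h1
  have h2 := gP_le_one t ht.le
  have h3 : t / (1 + t ^ 2) ≤ e := by
    rw [div_le_iff₀ (by positivity)]
    have : e⁻¹ ≤ t := le_max_right _ _
    have : 1 ≤ e * t := by
      rw [inv_le_iff_one_le_mul₀ he] at this; linarith
    nlinarith
  have h4 : 2 * gaussianPDFReal 0 1 t * (t / (1 + t ^ 2)) ≤ 1 * e := by
    apply mul_le_mul (gpdf_le_one t) h3 (by positivity) (by norm_num)
  linarith


lemma Ex_le (θ z A c W i : ℝ) (hθ : 0 ≤ θ) (hW : Real.exp (θ ^ 2 / 2) * (1 + gP θ) ≤ W)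
    (hi : (Real.sqrt (1 - z))⁻¹ ≤ i)
    (h : (1 + W) / 2 * ((i + W) / 2) ≤ Real.exp (c + θ ^ 2 / 2 - 105/1000 * θ ^ 2 / (1 - z))) :
    Real.exp (-θ * A - θ ^ 2 / 2 + 105/1000 * θ ^ 2 / (1 - z)) * (M1 θ * M2 θ z) ≤ Real.exp (c - θ * A) := by
  have hM1 := M1_pos θ hθ
  have hM2 := M2_pos θ z hθ
  have h1 : M1 θ ≤ (1 + W) / 2 := by unfold M1; linarith
  have h2 : M2 θ z ≤ (i + W) / 2 := by unfold M2; linarith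
  have h3 : M1 θ * M2 θ z ≤ Real.exp (c + θ ^ 2 / 2 - 105/1000 * θ ^ 2 / (1 - z)) :=
    le_trans (mul_le_mul h1 h2 hM2.le (by linarith)) h
  calc _ ≤ Real.exp (-θ * A - θ ^ 2 / 2 + 105/1000 * θ ^ 2 / (1 - z)) * Real.exp (c + θ ^ 2 / 2 - 105/1000 * θ ^ 2 / (1 - z)) := by gcongr
    _ = _ := by rw [← Real.exp_add]; congr 1; ring

lemma inv_sqrt_num (z i : ℝ) (hi : 0 < i) (h : 1 ≤ i ^ 2 * (1 - z)) : (Real.sqrt (1 - z))⁻¹ ≤ i := by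
  have hz : 0 < 1 - z := by
    by_contra! hh
    nlinarith [mul_nonneg (sq_nonneg i) (neg_nonneg.2 hh)]
  rw [inv_le_iff_one_le_mul₀ (Real.sqrt_pos.2 hz)]
  have : Real.sqrt ((i ^ 2) * (1 - z)) = i * Real.sqrt (1 - z) := by
    rw [Real.sqrt_mul (by positivity), Real.sqrt_sq hi.le]
  rw [mul_comm, mul_comm, ← this]
  exact Real.one_le_sqrt.2 h

lemma exp_lb_of (x c : ℝ) (n : ℕ) (hx : 0 ≤ x) (h : c ≤ ∑ i ∈ Finset.range n, x ^ i / (i.factorial : ℝ)) : c ≤ Real.exp x :=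
  h.trans (exp_lb x hx n)

lemma W_one : Real.exp ((1:ℝ) ^ 2 / 2) * (1 + gP 1) ≤ 27780/10000 := by
  have h1 : Real.exp ((1:ℝ) ^ 2 / 2) ≤ 164873/100000 := by
    have := Real.exp_bound' (x := 1/2) (by norm_num) (by norm_num) (n := 8) (by norm_num)
    norm_num [Finset.sum_range_succ, Nat.factorial] at this
    norm_num; linarith
  have h2 := gP_one
  have h3 := gP_nonneg 1 (by norm_num)
  have := Real.exp_pos ((1:ℝ) ^ 2 / 2)
  nlinarith

lemma W_16 : Real.exp ((16/10:ℝ) ^ 2 / 2) * (1 + gP (16/10)) ≤ 71934/10000 := by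
  have h0 : Real.exp (64/100) ≤ 189649/100000 := by
    have := Real.exp_bound' (x := 64/100) (by norm_num) (by norm_num) (n := 9) (by norm_num)
    norm_num [Finset.sum_range_succ, Nat.factorial] at this
    norm_num; linarith
  have h1 : Real.exp ((16/10:ℝ) ^ 2 / 2) ≤ 35967/10000 := by
    have e : (16/10:ℝ) ^ 2 / 2 = (2:ℕ) * (64/100) := by norm_num
    rw [e, Real.exp_nat_mul]
    have := Real.exp_pos (64/100)
    nlinarith
  have h2 := gP_le_one (16/10) (by norm_num)
  have h3 := gP_nonneg (16/10) (by norm_num)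
  have := Real.exp_pos ((16/10:ℝ) ^ 2 / 2)
  nlinarith

lemma C1a (A : ℝ) : Real.exp (-1 * A - 1 ^ 2 / 2 + 105/1000 * 1 ^ 2 / (1 - 1913/10000)) * (M1 1 * M2 1 (1913/10000)) ≤ Real.exp (94/100 - 1 * A) := by
  apply Ex_le 1 _ A _ _ (1.1121) (by norm_num) W_one (inv_sqrt_num _ _ (by norm_num) (by norm_num))
  exact exp_lb_of _ _ 9 (by norm_num) (by norm_num [Finset.sum_range_succ, Nat.factorial])

lemma C1b (A : ℝ) : Real.exp (-1 * A - 1 ^ 2 / 2 + 105/1000 * 1 ^ 2 / (1 - 3302/10000)) * (M1 1 * M2 1 (3302/10000)) ≤ Real.exp (99/100 - 1 * A) := by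
  apply Ex_le 1 _ A _ _ (1.2219) (by norm_num) W_one (inv_sqrt_num _ _ (by norm_num) (by norm_num))
  exact exp_lb_of _ _ 10 (by norm_num) (by norm_num [Finset.sum_range_succ, Nat.factorial])

lemma C2 (A : ℝ) : Real.exp (-(16/10) * A - (16/10) ^ 2 / 2 + 105/1000 * (16/10) ^ 2 / (1 - 2126/10000)) * (M1 (16/10) * M2 (16/10) (2126/10000)) ≤ Real.exp (19/10 - 16/10 * A) := by
  apply Ex_le (16/10) _ A _ _ (1.127) (by norm_num) W_16 (inv_sqrt_num _ _ (by norm_num) (by norm_num))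
  exact exp_lb_of _ _ 14 (by norm_num) (by norm_num [Finset.sum_range_succ, Nat.factorial])

lemma C4 (S : ℝ) (hS : 2435/1000 ≤ S) : Real.exp (-(S / (126/100)) * S - (S / (126/100)) ^ 2 / 2 + 105/1000 * (S / (126/100)) ^ 2 / (1 - 1925/10000)) * (M1 (S / (126/100)) * M2 (S / (126/100)) (1925/10000)) ≤ 12/10 * Real.exp (-(3967/10000) * S ^ 2) := by
  set θ := S / (126/100) with hθ
  have hθ1 : 193/100 ≤ θ := by rw [hθ, le_div_iff₀ (by norm_num)]; linarith
  have hSθ : S = 126/100 * θ := by rw [hθ]; ring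
  set W := Real.exp (θ ^ 2 / 2) with hW
  have hW1 : 62/10 ≤ W := by
    have h1 : 62/10 ≤ Real.exp (186/100) := exp_lb_of _ _ 9 (by norm_num) (by norm_num [Finset.sum_range_succ, Nat.factorial])
    refine h1.trans (Real.exp_le_exp.2 ?_)
    nlinarith
  have hg := gP_le_one θ (by linarith)
  have hg0 := gP_nonneg θ (by linarith)
  have hi := inv_sqrt_num (1925/10000) 1.113 (by norm_num) (by norm_num)
  have h1 : M1 θ ≤ (1 + 2 * W) / 2 := by unfold M1; nlinarith
  have h2 : M2 θ (1925/10000) ≤ (1.113 + 2 * W) / 2 := by unfold M2; nlinarith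
  have hM2 := M2_pos θ (1925/10000) (by linarith)
  have h3 : M1 θ * M2 θ (1925/10000) ≤ 12/10 * W ^ 2 := by
    refine (mul_le_mul h1 h2 hM2.le (by linarith)).trans ?_
    nlinarith
  calc _ ≤ Real.exp (-θ * S - θ ^ 2 / 2 + 105/1000 * θ ^ 2 / (1 - 1925/10000)) * (12/10 * W ^ 2) := by gcongr
    _ = 12/10 * Real.exp (-θ * S - θ ^ 2 / 2 + 105/1000 * θ ^ 2 / (1 - 1925/10000) + (2:ℕ) * (θ ^ 2 / 2)) := by
      rw [Real.exp_add _ ((2:ℕ) * (θ ^ 2 / 2)), Real.exp_nat_mul]; ring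
    _ ≤ _ := by
      gcongr
      rw [hSθ]
      push_cast
      norm_num
      nlinarith [sq_nonneg θ]


lemma chord (c k a b d : ℝ) (had : a ≤ d) (hdb : d ≤ b) (hab : a < b)
    (ha : Real.exp (c - k * a) ≤ 1 - a) (hb : Real.exp (c - k * b) ≤ 1 - b) : Real.exp (c - k * d) ≤ 1 - d := by
  have hba : 0 < b - a := by linarith
  have hc := convexOn_exp.2 (Set.mem_univ (c - k * a)) (Set.mem_univ (c - k * b))
    (div_nonneg (sub_nonneg.2 hdb) hba.le) (div_nonneg (sub_nonneg.2 had) hba.le) (by field_simp; ring)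
  simp only [smul_eq_mul] at hc
  have e1 : (b - d) / (b - a) * (c - k * a) + (d - a) / (b - a) * (c - k * b) = c - k * d := by
    field_simp; ring
  rw [e1] at hc
  refine hc.trans ?_
  have e2 : 1 - d = (b - d) / (b - a) * (1 - a) + (d - a) / (b - a) * (1 - b) := by
    field_simp; ring
  rw [e2]
  have := div_nonneg (sub_nonneg.2 hdb) hba.le
  have := div_nonneg (sub_nonneg.2 had) hba.le
  gcongr

lemma exp_tan (u u0 c : ℝ) (hc : c ≤ Real.exp (-u0)) (h : 0 ≤ 1 + u0 - u) : c * (1 + u0 - u) ≤ Real.exp (-u) := by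
  have h1 := Real.add_one_le_exp (u0 - u)
  have : Real.exp (-u) = Real.exp (-u0) * Real.exp (u0 - u) := by rw [← Real.exp_add]; congr 1; ring
  rw [this]
  have := Real.exp_pos (-u0)
  apply mul_le_mul hc (by linarith) h this.le

lemma exp_tan' (u u0 c : ℝ) (hc0 : 0 ≤ c) (hc : c ≤ Real.exp (-u0)) : c * (1 + u0 - u) ≤ Real.exp (-u) := by
  by_cases h : 0 ≤ 1 + u0 - u
  · exact exp_tan u u0 c hc h
  · push Not at h
    have := Real.exp_pos (-u)
    nlinarith

lemma exp_neg_lb (x c : ℝ) (n : ℕ) (hn : 0 < n) (hx : 0 ≤ x) (k : ℕ) (hk : 0 < k) (hxk : x / k ≤ 1) (hc : 0 < c)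
    (h : c * ((∑ m ∈ Finset.range n, (x / k) ^ m / (m.factorial : ℝ)) + (x / k) ^ n * (n + 1) / (n.factorial * n)) ^ k ≤ 1) :
    c ≤ Real.exp (-x) := by
  have h1 := Real.exp_bound' (x := x / k) (by positivity) hxk hn
  have hk0 : (k:ℝ) ≠ 0 := by positivity
  have e : Real.exp x = Real.exp (x / k) ^ k := by
    rw [← Real.exp_nat_mul]; congr 1; field_simp
  have h2 : Real.exp x ≤ ((∑ m ∈ Finset.range n, (x / k) ^ m / (m.factorial : ℝ)) + (x / k) ^ n * (n + 1) / (n.factorial * n)) ^ k := by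
    rw [e]; exact pow_le_pow_left₀ (Real.exp_pos _).le h1 k
  rw [Real.exp_neg, le_inv_comm₀ hc (Real.exp_pos x)]
  refine h2.trans ?_
  rw [← one_div, le_div_iff₀ hc]; linarith

lemma en06 : 5488/10000 ≤ Real.exp (-(6/10)) :=
  exp_neg_lb _ _ 9 (by norm_num) (by norm_num) 1 (by norm_num) (by norm_num) (by norm_num) (by norm_num [Finset.sum_range_succ, Nat.factorial])
lemma en155 : 2122/10000 ≤ Real.exp (-(155/100)) :=
  exp_neg_lb _ _ 9 (by norm_num) (by norm_num) 2 (by norm_num) (by norm_num) (by norm_num) (by norm_num [Finset.sum_range_succ, Nat.factorial])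
lemma en22 : 1108/10000 ≤ Real.exp (-(22/10)) :=
  exp_neg_lb _ _ 9 (by norm_num) (by norm_num) 4 (by norm_num) (by norm_num) (by norm_num) (by norm_num [Finset.sum_range_succ, Nat.factorial])
lemma en34 : 333/10000 ≤ Real.exp (-(34/10)) :=
  exp_neg_lb _ _ 9 (by norm_num) (by norm_num) 4 (by norm_num) (by norm_num) (by norm_num) (by norm_num [Finset.sum_range_succ, Nat.factorial])
lemma en2162 : 115/1000 ≤ Real.exp (-(2162/1000)) :=
  exp_neg_lb _ _ 9 (by norm_num) (by norm_num) 4 (by norm_num) (by norm_num) (by norm_num) (by norm_num [Finset.sum_range_succ, Nat.factorial])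
lemma en193 : 145/1000 ≤ Real.exp (-(193/100)) :=
  exp_neg_lb _ _ 9 (by norm_num) (by norm_num) 4 (by norm_num) (by norm_num) (by norm_num) (by norm_num [Finset.sum_range_succ, Nat.factorial])
lemma en1031 : 3565/10000 ≤ Real.exp (-(1031/1000)) :=
  exp_neg_lb _ _ 9 (by norm_num) (by norm_num) 4 (by norm_num) (by norm_num) (by norm_num) (by norm_num [Finset.sum_range_succ, Nat.factorial])
lemma en2438 : 871/10000 ≤ Real.exp (-(2438/1000)) :=
  exp_neg_lb _ _ 9 (by norm_num) (by norm_num) 4 (by norm_num) (by norm_num) (by norm_num) (by norm_num [Finset.sum_range_succ, Nat.factorial])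

/-- R1 numeric, small y -/
lemma numR1b (y e : ℝ) (hy : 1 ≤ y) (hy4 : y ≤ 4) (he : e = Real.exp (-((y ^ 2 + 1) / (35888/1000)))) :
    1095/1000 ≤ 11/100 * y + 12533/10000 * e := by
  have := Real.add_one_le_exp (-((y ^ 2 + 1) / (35888/1000)))
  rw [← he] at this
  nlinarith [mul_nonneg (sub_nonneg.2 hy) (sub_nonneg.2 hy4)]

lemma numR1a (y e : ℝ) (hy : 4 ≤ y) (he : e = Real.exp (-((y ^ 2 + 1) / (35888/1000)))) :
    1045/1000 ≤ 11/100 * y + 12533/10000 * e := by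
  have e0 : 0 < e := he ▸ Real.exp_pos _
  by_cases h1 : 95/10 ≤ y
  · linarith
  by_cases h2 : y ≤ 53/10
  · have := exp_tan' ((y ^ 2 + 1) / (35888/1000)) _ _ (by norm_num) en06
    rw [← he] at this
    nlinarith [mul_nonneg (sub_nonneg.2 hy) (sub_nonneg.2 h2)]
  · have := exp_tan' ((y ^ 2 + 1) / (35888/1000)) _ _ (by norm_num) en155
    rw [← he] at this
    push Not at h1 h2
    nlinarith [mul_nonneg (sub_nonneg.2 h1.le) (sub_nonneg.2 h2.le)]

lemma numR3 (y e : ℝ) (hy : 6 ≤ y) (he : e = Real.exp (-((y ^ 2 + 1) / (35888/1000)))) :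
    185/100 ≤ 176/1000 * y + 33056/10000 * e := by
  have e0 : 0 < e := he ▸ Real.exp_pos _
  by_cases h1 : 1052/100 ≤ y
  · linarith
  · have := exp_tan' ((y ^ 2 + 1) / (35888/1000)) _ _ (by norm_num) en22
    rw [← he] at this
    push Not at h1
    nlinarith [mul_nonneg (sub_nonneg.2 h1.le) (sub_nonneg.2 hy)]

/-- case II, maximisation over r -/
lemma numII (y e r : ℝ) (hy : 4 ≤ y) (he : e = Real.exp (-((y ^ 2 + 1) / (35888/1000)))) :
    r - 11/100 * r ^ 2 * y ≤ 208/1000 + 12533/10000 * e := by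
  have e0 : 0 < e := he ▸ Real.exp_pos _
  have hb : ∀ c : ℝ, 1 ≤ 44/100 * y * c → r - 11/100 * r ^ 2 * y ≤ c := by
    intro c hc
    have : r - 11/100 * r ^ 2 * y ≤ 1 / (44/100 * y) := by
      rw [le_div_iff₀ (by positivity)]
      nlinarith [sq_nonneg (22/100 * y * r - 1)]
    refine this.trans ?_
    rw [div_le_iff₀ (by positivity)]; linarith
  have hm : ∀ Y u c : ℝ, y ≤ Y → 0 ≤ Y → (Y ^ 2 + 1) / (35888/1000) ≤ u → c ≤ Real.exp (-u) → c ≤ e := by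
    intro Y u c h1 h2 h3 h4
    rw [he]
    refine h4.trans (Real.exp_le_exp.2 (neg_le_neg ?_))
    refine le_trans ?_ h3
    gcongr
  apply hb
  by_cases h1 : 11 ≤ y
  · nlinarith
  push Not at h1
  by_cases h2 : 93/10 ≤ y
  · have := hm 11 _ _ h1.le (by norm_num) (by norm_num) en34
    nlinarith
  push Not at h2
  by_cases h3 : 73/10 ≤ y
  · have := hm (93/10) _ _ (by linarith) (by norm_num) (by norm_num) en2438
    nlinarith
  push Not at h3
  by_cases h4 : 49/10 ≤ y
  · have := hm (73/10) _ _ (by linarith) (by norm_num) (by norm_num) en155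
    nlinarith
  push Not at h4
  · have := hm (49/10) _ _ (by linarith) (by norm_num) (by norm_num) en1031
    nlinarith

lemma numIIb (y e r : ℝ) (hy : 1 ≤ y) (hy4 : y ≤ 4) (hr : 0 ≤ r) (hr1 : r ≤ 1) (he : e = Real.exp (-((y ^ 2 + 1) / (35888/1000)))) :
    r - 11/100 * r ^ 2 * y ≤ 158/1000 + 12533/10000 * e := by
  have h := Real.add_one_le_exp (-((y ^ 2 + 1) / (35888/1000)))
  rw [← he] at h
  by_cases h1 : y ≤ 5/2
  · have h2 : r - 11/100 * r ^ 2 * y ≤ 1 := by nlinarith [mul_nonneg (sq_nonneg r) (by linarith : (0:ℝ) ≤ y)]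
    have h3 := mul_nonneg (sub_nonneg.2 hy) (sub_nonneg.2 h1)
    nlinarith
  · push Not at h1
    have h2 : r - 11/100 * r ^ 2 * y ≤ r - 275/1000 * r ^ 2 := by nlinarith
    have h3 := numR1b y e hy hy4 he
    have h4 : r - 275/1000 * r ^ 2 ≤ 725/1000 := by nlinarith
    nlinarith

lemma K_lb (y K s e : ℝ) (hy : 1 ≤ y) (hK0 : 0 < K) (hs : 0 ≤ s) (hK : 1 + 2 * y + 2 * y ^ 2 ≤ K ^ 2 - 2 * K * s)
    (he : e = Real.exp (-((y ^ 2 + 1) / (35888/1000)))) (hse : 12533/10000 * e ≤ s) : 371/100 ≤ K := by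
  have h := Real.add_one_le_exp (-((y ^ 2 + 1) / (35888/1000)))
  rw [← he] at h
  by_contra! hh
  have h1 : K ^ 2 - 2 * K * s ≤ (371/100) ^ 2 - 2 * (371/100) * s := by
    have : 0 ≤ K - 2 * s := by
      by_contra! h5
      nlinarith
    nlinarith
  nlinarith [mul_nonneg (sub_nonneg.2 hy) (sub_nonneg.2 hy)]

lemma chordR1 (d : ℝ) (h0 : 0 ≤ d) (h1 : d ≤ 54/100) : Real.exp (-(105/1000) - 12533/10000 * d) ≤ 1 - d := by
  apply chord _ _ 0 (54/100) d h0 h1 (by norm_num)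
  · have := exp_neg_le_of (105/1000) 1 _ (by norm_num) 3 rfl (by norm_num [Finset.sum_range_succ, Nat.factorial]) (by norm_num)
    norm_num at this ⊢
  · have := exp_neg_le_of (105/1000 + 12533/10000 * (54/100)) (46/100) _ (by norm_num) 8 rfl (by norm_num [Finset.sum_range_succ, Nat.factorial]) (by norm_num)
    norm_num at this ⊢; linarith

lemma chordR3 (d : ℝ) (h0 : 54/100 ≤ d) (h1 : d ≤ 885/1000) : Real.exp (71464/100000 - 33056/10000 * d) ≤ 1 - d := by
  apply chord _ _ (54/100) (885/1000) d h0 h1 (by norm_num)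
  · have := exp_neg_le_of (33056/10000 * (54/100) - 71464/100000) (46/100) _ (by norm_num) 8 rfl (by norm_num [Finset.sum_range_succ, Nat.factorial]) (by norm_num)
    norm_num at this ⊢; linarith
  · have := exp_neg_le_of (33056/10000 * (885/1000) - 71464/100000) (115/1000) _ (by norm_num) 9 rfl (by norm_num [Finset.sum_range_succ, Nat.factorial]) (by norm_num)
    norm_num at this ⊢; linarith

lemma chordII (d : ℝ) (h0 : 54/100 ≤ d) (h1 : d ≤ 69/100) : Real.exp (8635/10000 - 33056/10000 * d) ≤ 1 - d := by
  apply chord _ _ (54/100) (69/100) d h0 h1 (by norm_num)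
  · have := exp_neg_le_of (33056/10000 * (54/100) - 8635/10000) (46/100) _ (by norm_num) 8 rfl (by norm_num [Finset.sum_range_succ, Nat.factorial]) (by norm_num)
    norm_num at this ⊢; linarith
  · have := exp_neg_le_of (33056/10000 * (69/100) - 8635/10000) (31/100) _ (by norm_num) 9 rfl (by norm_num [Finset.sum_range_succ, Nat.factorial]) (by norm_num)
    norm_num at this ⊢; linarith


lemma sqrt_e (y u0 c e : ℝ) (he : e = Real.exp (-((y ^ 2 + 1) / (35888/1000)))) (hc : c ≤ Real.exp (-u0)) (h : e < c) :
    u0 < (y ^ 2 + 1) / (35888/1000) := by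
  have : Real.exp (-((y ^ 2 + 1) / (35888/1000))) < Real.exp (-u0) := by rw [← he]; linarith
  have := Real.exp_lt_exp.1 this
  linarith

lemma mills_num (s : ℝ) (hs : 15/10 ≤ s) : 12/10 * Real.exp (-(1076/1000 * s ^ 2)) ≤ 1 - gP s := by
  have h := gP_mills s (by linarith)
  refine le_trans ?_ (show 2 * gaussianPDFReal 0 1 s * (s / (1 + s ^ 2)) ≤ 1 - gP s by linarith)
  rw [gpdf_eq]
  have e1 : Real.exp (-(1076/1000 * s ^ 2)) = Real.exp (-s ^ 2 / 2) * Real.exp (-(576/1000 * s ^ 2)) := by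
    rw [← Real.exp_add]; congr 1; ring
  have e2 : 365/100 ≤ Real.exp (1296/1000) := exp_lb_of _ _ 9 (by norm_num) (by norm_num [Finset.sum_range_succ, Nat.factorial])
  have e3 : 365/100 * (576/1000 * s ^ 2 - 296/1000) ≤ Real.exp (576/1000 * s ^ 2) := by
    have h1 := Real.add_one_le_exp (576/1000 * s ^ 2 - 1296/1000)
    have : Real.exp (576/1000 * s ^ 2) = Real.exp (1296/1000) * Real.exp (576/1000 * s ^ 2 - 1296/1000) := by
      rw [← Real.exp_add]; congr 1; ring
    rw [this]
    apply mul_le_mul e2 (by linarith) _ (Real.exp_pos _).le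
    nlinarith
  rw [e1]
  have hs2 := sqrt2pi
  have hp : 0 < Real.sqrt (2 * Real.pi) := by linarith [hs2.1]
  have hA := Real.exp_pos (-s ^ 2 / 2)
  have key : 12/10 * Real.exp (-(576/1000 * s ^ 2)) ≤ 2 * (Real.sqrt (2 * Real.pi))⁻¹ * (s / (1 + s ^ 2)) := by
    have f1 : 2 * (Real.sqrt (2 * Real.pi))⁻¹ * (s / (1 + s ^ 2)) = 2 * s / (Real.sqrt (2 * Real.pi) * (1 + s ^ 2)) := by
      field_simp
    rw [f1, Real.exp_neg, le_div_iff₀ (by positivity), ← div_eq_mul_inv, div_mul_eq_mul_div, div_le_iff₀ (Real.exp_pos _)]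
    have g1 : 12/10 * (Real.sqrt (2 * Real.pi) * (1 + s ^ 2)) ≤ 12/10 * (25067/10000 * (1 + s ^ 2)) := by
      gcongr; exact hs2.2
    refine g1.trans ?_
    refine le_trans ?_ (mul_le_mul_of_nonneg_left e3 (by linarith : 0 ≤ 2 * s))
    obtain ⟨d, hd, rfl⟩ : ∃ d, 0 ≤ d ∧ s = 15/10 + d := ⟨s - 15/10, by linarith, by ring⟩
    nlinarith [pow_nonneg hd 3, pow_nonneg hd 2]
  calc _ = Real.exp (-s ^ 2 / 2) * (12/10 * Real.exp (-(576/1000 * s ^ 2))) := by ring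
    _ ≤ Real.exp (-s ^ 2 / 2) * (2 * (Real.sqrt (2 * Real.pi))⁻¹ * (s / (1 + s ^ 2))) := by gcongr
    _ = _ := by ring

lemma gP_15 : gP (15/10) ≤ 885/1000 := by
  have h := gP_mills (15/10) (by norm_num)
  rw [gpdf_eq] at h
  have h1 : 324/1000 ≤ Real.exp (-(15/10) ^ 2 / 2) := by
    have := exp_neg_lb (1125/1000) (324/1000) 9 (by norm_num) (by norm_num) 4 (by norm_num) (by norm_num) (by norm_num) (by norm_num [Finset.sum_range_succ, Nat.factorial])
    convert this using 2; norm_num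
  have h2 : 10000/25067 ≤ (Real.sqrt (2 * Real.pi))⁻¹ := by
    rw [le_inv_comm₀ (by norm_num) (by have := sqrt2pi.1; linarith)]
    exact sqrt2pi.2.trans (by norm_num)
  have h3 : 10000/25067 * (324/1000) ≤ (Real.sqrt (2 * Real.pi))⁻¹ * Real.exp (-(15/10) ^ 2 / 2) := by
    gcongr
  norm_num at h h3
  linarith

set_option maxHeartbeats 2000000 in
lemma mainR (y K s1 s3 G e : ℝ) (hy : 1 ≤ y) (hK0 : 0 < K) (hs1 : 0 < s1) (hs3 : 0 < s3)
    (hK : 1 + 2 * y + 2 * y ^ 2 ≤ K ^ 2 - 2 * K * s1) (hG1 : G ≤ 1)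
    (H : ∀ s v θ z : ℝ, 0 ≤ s → s ≤ s1 → s ≤ 13/10 * y → 0 ≤ v → v ≤ 1 → v ≤ s3 → 0 < θ →
      12248/10000 * θ / K ≤ z → z < 1 →
      G ≤ Real.exp (-θ * (s + 11/100 * v * y) - θ ^ 2 / 2 + 105/1000 * θ ^ 2 / (1 - z)) * (M1 θ * M2 θ z))
    (he : e = Real.exp (-((y ^ 2 + 1) / (35888/1000)))) :
    G ≤ (1 - gP s1) + (1 - gP (Real.sqrt s3)) + e := by
  have hKs : 0 ≤ K * s1 := by positivity
  have he0 : 0 < e := he ▸ Real.exp_pos _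
  have hP1 := gP_le_one s1 hs1.le
  have hP0 := gP_nonneg s1 hs1.le
  have hPl := gP_lin s1 hs1.le
  have hPt := gP_tan s1 hs1.le
  set P := gP s1 with hP
  set r := Real.sqrt s3 with hr
  have hr0 : 0 ≤ r := Real.sqrt_nonneg _
  have hr2 : r ^ 2 = s3 := Real.sq_sqrt hs3.le
  have hR1 := gP_le_one r hr0
  have hRl := gP_lin r hr0
  have hR0 := gP_nonneg r hr0
  set R := gP r with hR
  -- consequences of H
  have Ha : 4 ≤ y → ∀ s v : ℝ, 0 ≤ s → s ≤ s1 → s ≤ 13/10 * y → 0 ≤ v → v ≤ 1 → v ≤ s3 →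
      G ≤ Real.exp (94/100 - (s + 11/100 * v * y)) := by
    intro h4 s v a1 a2 a3 a4 a5 a6
    have hK64 : 6403/1000 ≤ K := by
      by_contra! hh; nlinarith
    refine (H s v 1 (1913/10000) a1 a2 a3 a4 a5 a6 one_pos (by rw [div_le_iff₀ hK0]; linarith) (by norm_num)).trans ?_
    have := C1a (s + 11/100 * v * y)
    rwa [one_mul] at this
  have Hb : e ≤ P → ∀ s v : ℝ, 0 ≤ s → s ≤ s1 → s ≤ 13/10 * y → 0 ≤ v → v ≤ 1 → v ≤ s3 →
      G ≤ Real.exp (99/100 - (s + 11/100 * v * y)) := by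
    intro h4 s v a1 a2 a3 a4 a5 a6
    have hK64 : 371/100 ≤ K := K_lb y K s1 e hy hK0 hs1.le hK he (by linarith)
    refine (H s v 1 (3302/10000) a1 a2 a3 a4 a5 a6 one_pos (by rw [div_le_iff₀ hK0]; linarith) (by norm_num)).trans ?_
    have := C1b (s + 11/100 * v * y)
    rwa [one_mul] at this
  have Hc : 6 ≤ y → ∀ s v : ℝ, 0 ≤ s → s ≤ s1 → s ≤ 13/10 * y → 0 ≤ v → v ≤ 1 → v ≤ s3 →
      G ≤ Real.exp (19/10 - 16/10 * (s + 11/100 * v * y)) := by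
    intro h4 s v a1 a2 a3 a4 a5 a6
    have hK64 : 9219/1000 ≤ K := by
      by_contra! hh; nlinarith
    exact (H s v (16/10) (2126/10000) a1 a2 a3 a4 a5 a6 (by norm_num) (by rw [div_le_iff₀ hK0]; linarith) (by norm_num)).trans (C2 _)
  by_cases hs31 : 1 ≤ s3
  · -- Case I
    by_cases hd : P - e ≤ 0
    · linarith
    push Not at hd
    suffices hh : G ≤ 1 - (P - e) by linarith
    by_cases hd1 : P - e ≤ 54/100
    · refine le_trans ?_ (chordR1 (P - e) hd.le hd1)
      by_cases hy4 : 4 ≤ y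
      · refine (Ha hy4 (12533/10000 * P) 1 (by positivity) hPl (by linarith) (by norm_num) le_rfl hs31).trans (Real.exp_le_exp.2 ?_)
        have := numR1a y e hy4 he
        linarith
      · push Not at hy4
        refine (Hb (by linarith) (12533/10000 * P) 1 (by positivity) hPl (by linarith) (by norm_num) le_rfl hs31).trans (Real.exp_le_exp.2 ?_)
        have := numR1b y e hy hy4.le he
        linarith
    push Not at hd1
    by_cases hy6 : y ≤ 6
    · have he1 : 3565/10000 ≤ e := by
        rw [he]; refine en1031.trans (Real.exp_le_exp.2 (neg_le_neg ?_))
        rw [div_le_iff₀ (by norm_num)]; nlinarith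
      have hs14 : 14/10 ≤ s1 := by linarith
      refine le_trans (b := e) ?_ (by linarith)
      by_cases hy4 : 4 ≤ y
      · refine (Ha hy4 (14/10) 1 (by norm_num) hs14 (by linarith) (by norm_num) le_rfl hs31).trans ?_
        rw [he]
        apply Real.exp_le_exp.2
        nlinarith
      · push Not at hy4
        refine (Hb (by linarith) (11/10) 1 (by norm_num) (by linarith) (by linarith) (by norm_num) le_rfl hs31).trans ?_
        rw [he]
        apply Real.exp_le_exp.2
        nlinarith
    push Not at hy6
    by_cases hd2 : P - e ≤ 885/1000
    · refine le_trans ?_ (chordR3 (P - e) hd1.le hd2)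
      refine (Hc hy6.le (2066/1000 * P - 4154/10000) 1 (by linarith) (by linarith) (by linarith) (by norm_num) le_rfl hs31).trans (Real.exp_le_exp.2 ?_)
      have := numR3 y e hy6.le he
      linarith
    push Not at hd2
    have hu := sqrt_e y _ _ e he en2162 (by linarith)
    rw [lt_div_iff₀ (by norm_num)] at hu
    have hy87 : 87/10 ≤ y := by
      by_contra! hh; nlinarith
    have hs15 : 15/10 ≤ s1 := by
      by_contra! hh
      have := gP_mono hh.le
      have := gP_15
      linarith
    have hKy : 141421/100000 * y ≤ K := by
      apply abs_le_of_sq_le_sq' _ hK0.le |>.2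
      nlinarith
    have Hd : ∀ s : ℝ, 1479/1000 ≤ s → s ≤ s1 → s ≤ 17/100 * y → G ≤ 12/10 * Real.exp (-(3967/10000) * (s + 11/100 * y) ^ 2) := by
      intro s b1 b2 b3
      have hC := C4 (s + 11/100 * y) (by linarith)
      refine le_trans ?_ hC
      have := H s 1 ((s + 11/100 * y) / (126/100)) (1925/10000) (by linarith) b2 (by linarith) (by norm_num) le_rfl hs31 (by apply div_pos <;> linarith)
        (by rw [div_le_iff₀ hK0]; linarith) (by norm_num)
      rwa [show s + 11/100 * 1 * y = s + 11/100 * y by ring] at this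
    by_cases hsy : 17/100 * y ≤ s1
    · refine le_trans (b := e) ?_ (by linarith)
      refine (Hd (17/100 * y) (by linarith) hsy le_rfl).trans ?_
      have h12 : (12/10 : ℝ) ≤ Real.exp (183/1000) := exp_lb_of _ _ 5 (by norm_num) (by norm_num [Finset.sum_range_succ, Nat.factorial])
      calc _ ≤ Real.exp (183/1000) * Real.exp (-(3967/10000) * (17/100 * y + 11/100 * y) ^ 2) := by gcongr
        _ = Real.exp (183/1000 + -(3967/10000) * (17/100 * y + 11/100 * y) ^ 2) := by rw [Real.exp_add]
        _ ≤ e := by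
          rw [he]
          apply Real.exp_le_exp.2
          nlinarith
    · push Not at hsy
      refine le_trans (b := 1 - P) ?_ (by linarith)
      refine (Hd s1 (by linarith) le_rfl hsy.le).trans ?_
      refine le_trans ?_ (mills_num s1 hs15)
      gcongr
      have : 1647/1000 * s1 ≤ s1 + 11/100 * y := by linarith
      have h7 := pow_le_pow_left₀ (by positivity) this 2
      have h8 := sq_nonneg s1
      rw [mul_pow] at h7
      linarith
  · -- Case II
    push Not at hs31
    have hr1 : r ≤ 1 := by
      by_contra! hh; nlinarith
    have hR6 : R ≤ 6849/10000 := (gP_mono hr1).trans gP_one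
    by_cases hd : P + R - 1 - e ≤ 0
    · linarith
    push Not at hd
    suffices hh : G ≤ 1 - (P + R - 1 - e) by linarith
    by_cases hd1 : P + R - 1 - e ≤ 54/100
    · refine le_trans ?_ (chordR1 (P + R - 1 - e) hd.le hd1)
      by_cases hy4 : 4 ≤ y
      · refine (Ha hy4 (12533/10000 * P) s3 (by positivity) hPl (by linarith) hs3.le hs31.le le_rfl).trans (Real.exp_le_exp.2 ?_)
        have := numII y e r hy4 he
        rw [hr2] at this
        linarith
      · push Not at hy4
        refine (Hb (by linarith) (12533/10000 * P) s3 (by positivity) hPl (by linarith) hs3.le hs31.le le_rfl).trans (Real.exp_le_exp.2 ?_)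
        have := numIIb y e r hy hy4.le hr0 hr1 he
        rw [hr2] at this
        linarith
    push Not at hd1
    have hu := sqrt_e y _ _ e he en193 (by linarith)
    rw [lt_div_iff₀ (by norm_num)] at hu
    have hy82 : 82/10 ≤ y := by
      by_contra! hh; nlinarith
    have hr67 : 6767/10000 ≤ r := by linarith
    refine le_trans ?_ (chordII (P + R - 1 - e) hd1.le (by linarith))
    refine (Hc (by linarith) (2066/1000 * P - 4154/10000) s3 (by linarith) (by linarith) (by linarith) hs3.le hs31.le le_rfl).trans (Real.exp_le_exp.2 ?_)
    have h1 : 6767/10000 * (6767/10000) ≤ s3 := by rw [← hr2]; nlinarith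
    have h2 : 6767/10000 * (6767/10000) * (82/10) ≤ s3 * y := by gcongr
    nlinarith



theorem pca_top_eigenvalue_upper_bound
    (n p : ℕ) (hn : 1 ≤ n) (hp : 2 ≤ p) (hnp : n ≤ p)
    (σ V : ℝ) (hσ : 0 < σ) (hV : 0 < V)
    (u : Fin n → ℝ)
    (su : ℝ) (hsu : su = Real.sqrt ((n : ℝ)⁻¹ * ∑ ν, (u ν) ^ 2)) (hsupos : 0 < su)
    (κ : ℝ) (hκ : κ = V * su)
    (s₁ s₂ s₃ : ℝ) (hs₁ : 0 < s₁) (hs₂ : 0 < s₂) (hs₃ : 0 < s₃)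
    (ε ε₁ ε₂ ε₃ : ℝ)
    (hε : ε = Real.exp (-(p : ℝ) / (2 * (Real.sqrt 5 + 2) ^ 2)))
    (hε₁ : ε₁ = ((gaussianReal 0 1 : Measure ℝ) {x | s₁ < |x|}).toReal)
    (hε₂ : ε₂ = ((Measure.pi fun _ : Fin (p - 1) => (gaussianReal 0 1 : Measure ℝ))
        {g : Fin (p - 1) → ℝ |
          s₂ / Real.sqrt ((p : ℝ) - 1) < |(∑ i, (g i) ^ 2) / ((p : ℝ) - 1) - 1|}).toReal)
    (hε₃ : ε₃ = ((gaussianReal 0 1 : Measure ℝ) {x | s₃ < x ^ 2}).toReal)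
    (hsignal : σ ^ 2 * ((1 + Real.sqrt (((p : ℝ) - 1) / n)) ^ 2 + ((p : ℝ) - 1) / n)
        < κ ^ 2 - 2 * σ * s₁ * κ / Real.sqrt n) :
    1 - ε₁ - ε₂ - ε₃ - ε ≤
      ((Measure.pi fun _ : Fin n => Measure.pi fun _ : Fin p => (gaussianReal 0 1 : Measure ℝ))
        {ξ : Fin n → Fin p → ℝ |
          maxEig (sampleCov n p
              (fun ν i => u ν * (if (i : ℕ) = 0 then V else 0) + σ * ξ ν i))
          ≤ κ ^ 2 * (1 + 2 * σ * s₁ / (κ * Real.sqrt n) + σ ^ 2 * s₃ / κ ^ 2)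
            + σ * κ * Real.sqrt (((p : ℝ) - 1) / n) *
              Real.sqrt (1 + 2 * σ * s₁ / (κ * Real.sqrt n) + σ ^ 2 * s₃ / κ ^ 2) *
              (1 + s₂ / Real.sqrt ((p : ℝ) - 1))}).toReal := by
  have hn0 : (0:ℝ) < n := by exact_mod_cast hn
  have hn1 : (1:ℝ) ≤ n := by exact_mod_cast hn
  have hp1 : (2:ℝ) ≤ p := by exact_mod_cast hp
  have hm0 : (0:ℝ) ≤ (p:ℝ) - 1 := by linarith
  have hκ0 : 0 < κ := by rw [hκ]; positivity
  have hr : 0 < Real.sqrt n := Real.sqrt_pos.2 hn0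
  set K := κ * Real.sqrt n / σ with hK
  have hK0 : 0 < K := by positivity
  set y := Real.sqrt ((p:ℝ) - 1) with hy
  have hy2 : y ^ 2 = (p:ℝ) - 1 := Real.sq_sqrt hm0
  have hy1 : 1 ≤ y := Real.one_le_sqrt.2 (by linarith)
  have hsig := signal_scaled n hn _ σ κ s₁ K hm0 hσ hK hsignal
  rw [← hy, ← hy2] at hsig
  have hK1 : 1 + 2 * y + 2 * y ^ 2 ≤ K ^ 2 - 2 * K * s₁ := by
    have h1 : 1 ≤ Real.sqrt n := Real.one_le_sqrt.2 hn1
    nlinarith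
  have ht := fun s v θ z hs hss hsy hv hv1 hvs hθ hz hz1 =>
    tail3 n p hn hp hnp σ V hσ hV u su hsu hsupos κ hκ s₁ s₂ s₃ hs₁ hs₂ hs₃ hsignal K y hK hy s v θ z hs hss hsy hv hv1 hvs hθ hz hz1
  rw [← hy] at ht
  set Bd := κ ^ 2 * (1 + 2 * σ * s₁ / (κ * Real.sqrt n) + σ ^ 2 * s₃ / κ ^ 2)
            + σ * κ * Real.sqrt (((p : ℝ) - 1) / n) *
              Real.sqrt (1 + 2 * σ * s₁ / (κ * Real.sqrt n) + σ ^ 2 * s₃ / κ ^ 2) *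
              (1 + s₂ / y) with hBd
  set μ := Measure.pi fun _ : Fin n => Measure.pi fun _ : Fin p => (gaussianReal 0 1 : Measure ℝ) with hμ
  set good := {ξ : Fin n → Fin p → ℝ | maxEig (sampleCov n p
              (fun ν i => u ν * (if (i : ℕ) = 0 then V else 0) + σ * ξ ν i)) ≤ Bd} with hgood
  set bad := {ξ : Fin n → Fin p → ℝ | Bd < maxEig (sampleCov n p
              (fun ν i => u ν * (if (i : ℕ) = 0 then V else 0) + σ * ξ ν i))} with hbad
  have hun : 1 ≤ (μ good).toReal + (μ bad).toReal := by
    have h1 : good ∪ bad = Set.univ := by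
      ext ξ; simp only [hgood, hbad, Set.mem_union, Set.mem_setOf_eq, Set.mem_univ, iff_true]
      exact le_or_gt _ _
    have h2 := measureReal_union_le (μ := μ) good bad
    rw [h1] at h2
    simpa [Measure.real] using h2
  have hG1 : (μ bad).toReal ≤ 1 := by
    have := measureReal_le_one (μ := μ) (s := bad)
    simpa [Measure.real] using this
  have hm := mainR y K s₁ s₃ (μ bad).toReal _ hy1 hK0 hs₁ hs₃ hK1 hG1
    (by
      intro s v θ z a1 a2 a3 a4 a5 a6 a7 a8 a9
      have h := ht s v θ z a1 a2 a3 a4 a5 a6 a7 a8 a9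
      refine ENNReal.toReal_le_of_le_ofReal ?_ h
      have := M1_pos θ a7.le
      have := M2_pos θ z a7.le
      positivity) rfl
  rw [← meas_abs s₁ hs₁.le, ← meas_sq s₃ hs₃.le, ← hε₁, ← hε₃] at hm
  have hεlb : Real.exp (-((y ^ 2 + 1) / (35888/1000))) ≤ ε := by
    rw [hε]
    apply Real.exp_le_exp.2
    rw [hy2, neg_div]
    apply neg_le_neg
    have h5 : (223606/100000 : ℝ) ≤ Real.sqrt 5 := Real.le_sqrt_of_sq_le (by norm_num)
    rw [show (p:ℝ) - 1 + 1 = p by ring]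
    apply div_le_div_of_nonneg_left (by linarith) (by norm_num)
    nlinarith
  have hε₂0 : 0 ≤ ε₂ := by rw [hε₂]; exact ENNReal.toReal_nonneg
  linarith
end
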